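/- arXiv:2602.07552 — 3 statements merged into one kernel-verified Lean document; each statement's English description precedes it below -/
import Mathlib

section
/- For all integers b ≥ 0 and d ≥ 1 there exists a natural number r = r(b,d) with the following property. Let ℱ be a family of subsets of ℝ^d such that for every finite set S ⊆ ℝ^d, the set conv_ℱ(S) has at most b+1 path-connected components and dim_{ℤ₂} H_i(conv_ℱ(S); ℤ₂) ≤ b for all 1 ≤ i ≤ ⌈d/2⌉−1. Then every set P ⊆ ℝ^d with exactly r points contains two disjoint subsets A, B ⊆ P such that conv_ℱ(A) ∩ conv_ℱ(B) ≠ ∅. -/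
open CategoryTheory AlgebraicTopology

/-- Singular homology of a topological space with coefficients in a commutative ring `R`. -/
noncomputable def SingularHomology (R : Type) [CommRing R]
    (X : Type) [TopologicalSpace X] (n : ℕ) : ModuleCat R :=
  (((alternatingFaceMapComplex (ModuleCat R)).obj
      (((SimplicialObject.whiskering _ _).obj (ModuleCat.free R)).obj
        (TopCat.toSSet.obj (TopCat.of X)))).homology n)

/-- The generalized convex hull of `S` with respect to a family `ℱ`: the intersection of
all members of `ℱ` containing `S` (the whole space if there is no such member). -/
def convFam {X : Type} (ℱ : Set (Set X)) (S : Set X) : Set X :=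
  ⋂₀ {F | F ∈ ℱ ∧ S ⊆ F}

/-- Simplicial chains modulo two on the full simplex with vertex set `V`, graded by the number of
vertices, so that the empty simplex spans the augmentation degree. -/
abbrev SimpChain (V : Type*) := Finset V →₀ ZMod 2

namespace SimpChain

open Classical in
/-- The boundary operator. -/
noncomputable def bd {V : Type*} : SimpChain V →ₗ[ZMod 2] SimpChain V :=
  Finsupp.linearCombination (ZMod 2) fun A : Finset V =>
    ∑ a ∈ A, (Finsupp.single (A.erase a) 1 : SimpChain V)

open Classical in
/-- The cone operator with apex `o`; simplices already containing `o` are killed. -/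
noncomputable def cone {V : Type*} (o : V) : SimpChain V →ₗ[ZMod 2] SimpChain V :=
  Finsupp.linearCombination (ZMod 2) fun A : Finset V =>
    if o ∈ A then 0 else (Finsupp.single (insert o A) 1 : SimpChain V)

open Classical in
/-- The chain map induced by a map of vertices; degenerate images are killed. -/
noncomputable def push {V W : Type*} (f : V → W) : SimpChain V →ₗ[ZMod 2] SimpChain W :=
  Finsupp.linearCombination (ZMod 2) fun A : Finset V =>
    if Set.InjOn f A then (Finsupp.single (A.image f) 1 : SimpChain W) else 0

variable {V W U : Type*}

open Classical in
theorem bd_single (A : Finset V) :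
    bd (Finsupp.single A 1) = ∑ a ∈ A, (Finsupp.single (A.erase a) 1 : SimpChain V) := by
  simp [bd]

open Classical in
theorem cone_single (o : V) (A : Finset V) :
    cone o (Finsupp.single A 1) =
      if o ∈ A then 0 else (Finsupp.single (insert o A) 1 : SimpChain V) := by
  simp [cone]

open Classical in
theorem push_single (f : V → W) (A : Finset V) :
    push f (Finsupp.single A 1) =
      if Set.InjOn f A then (Finsupp.single (A.image f) 1 : SimpChain W) else 0 := by
  simp [push]

theorem add_self_eq_zero {M : Type*} [AddCommGroup M] [Module (ZMod 2) M] (x : M) :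
    x + x = 0 := by
  have : (1 + 1 : ZMod 2) = 0 := by decide
  have h : ((1 + 1 : ZMod 2)) • x = 0 := by rw [this, zero_smul]
  rwa [add_smul, one_smul] at h

/-- In characteristic two a sum over ordered pairs of distinct elements of a function that depends
only on the underlying unordered pair vanishes. -/
theorem sum_sum_erase_eq_zero [DecidableEq V] {M : Type*} [AddCommGroup M] [Module (ZMod 2) M]
    (A : Finset V) (F : V → V → M) (hF : ∀ a b, F a b = F b a) :
    ∑ a ∈ A, ∑ b ∈ A.erase a, F a b = 0 := by
  rw [Finset.sum_sigma']
  refine Finset.sum_involution (fun x _ => ⟨x.2, x.1⟩) ?_ ?_ ?_ ?_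
  · rintro ⟨a, b⟩ h
    simp only
    rw [hF b a]
    exact add_self_eq_zero _
  · rintro ⟨a, b⟩ h _ h'
    simp at h h'
    exact h.2.1 h'.1
  · rintro ⟨a, b⟩ h
    simp at h ⊢
    exact ⟨h.2.2, fun h' => h.2.1 h'.symm, h.1⟩
  · rintro ⟨a, b⟩ h
    rfl

/-- Two linear maps on chains agree when they agree on simplices. -/
theorem hom_ext {M : Type*} [AddCommGroup M] [Module (ZMod 2) M]
    {f g : SimpChain V →ₗ[ZMod 2] M}
    (h : ∀ A : Finset V, f (Finsupp.single A 1) = g (Finsupp.single A 1)) : f = g :=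
  Finsupp.lhom_ext' fun A => LinearMap.ext_ring (h A)

theorem bd_cone (o : V) (c : SimpChain V) : bd (cone o c) = c + cone o (bd c) := by
  classical
  suffices h : (bd ∘ₗ cone o : SimpChain V →ₗ[ZMod 2] SimpChain V) =
      LinearMap.id + cone o ∘ₗ bd from LinearMap.congr_fun h c
  refine hom_ext fun A => ?_
  simp only [LinearMap.comp_apply, LinearMap.add_apply, LinearMap.id_apply, bd_single, map_sum,
    cone_single]
  split_ifs with h
  · rw [map_zero, Finset.sum_eq_single_of_mem o h]
    · simp [Finset.insert_erase h, add_self_eq_zero]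
    · intro a _ ha
      rw [if_pos]
      exact Finset.mem_erase.2 ⟨Ne.symm ha, h⟩
  · rw [bd_single, Finset.sum_insert h, Finset.erase_insert h]
    congr 1
    refine Finset.sum_congr rfl fun a ha => ?_
    have hao : o ≠ a := fun e => h (e ▸ ha)
    rw [if_neg (fun h' => h (Finset.mem_of_mem_erase h')), Finset.erase_insert_of_ne hao]

theorem bd_push (f : V → W) (c : SimpChain V) : bd (push f c) = push f (bd c) := by
  classical
  suffices h : (bd ∘ₗ push f : SimpChain V →ₗ[ZMod 2] SimpChain W) = push f ∘ₗ bd from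
    LinearMap.congr_fun h c
  refine hom_ext fun A => ?_
  simp only [LinearMap.comp_apply, bd_single, map_sum, push_single]
  split_ifs with h
  · rw [bd_single, Finset.sum_image h]
    refine Finset.sum_congr rfl fun a ha => ?_
    rw [if_pos (h.mono (by simp))]
    congr 1
    ext y
    simp only [Finset.mem_erase, Finset.mem_image]
    constructor
    · rintro ⟨h1, x, hx, rfl⟩
      exact ⟨x, ⟨fun e => h1 (e ▸ rfl), hx⟩, rfl⟩
    · rintro ⟨x, ⟨h1, hx⟩, rfl⟩
      exact ⟨fun e => h1 (h hx ha e), x, hx, rfl⟩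
  · rw [map_zero]
    simp only [Set.InjOn, not_forall] at h
    obtain ⟨p, hp, q, hq, hpq, hne⟩ := h
    have key : ∀ a ∈ A, a ≠ p → a ≠ q → ¬ Set.InjOn f (A.erase a : Finset V) := by
      intro a _ hap haq hi
      exact hne (hi (by simp [Ne.symm hap]; exact hp) (by simp [Ne.symm haq]; exact hq) hpq)
    have hsub : ({p, q} : Finset V) ⊆ A := by
      intro x hx
      simp at hx
      rcases hx with rfl | rfl <;> assumption
    rw [← Finset.sum_subset hsub]
    · rw [Finset.sum_pair hne]
      have him : ∀ x y, x ∈ A → y ∈ A → x ≠ y → f x = f y → (A.erase x).image f = A.image f := by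
        intro x y hx hy hxy hf
        refine (Finset.image_subset_image (Finset.erase_subset _ _)).antisymm ?_
        intro z hz
        obtain ⟨w, hw, rfl⟩ := Finset.mem_image.1 hz
        by_cases hwx : w = x
        · exact Finset.mem_image.2 ⟨y, Finset.mem_erase.2 ⟨Ne.symm hxy, hy⟩, by rw [hwx, hf]⟩
        · exact Finset.mem_image_of_mem _ (Finset.mem_erase.2 ⟨hwx, hw⟩)
      have hinj : ∀ x y, x ∈ A → y ∈ A → x ≠ y → f x = f y →
          (Set.InjOn f (A.erase x : Finset V) ↔ (A.image f).card = A.card - 1) := by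
        intro x y hx hy hxy hf
        rw [← Finset.card_image_iff, him x y hx hy hxy hf, Finset.card_erase_of_mem hx]
      have e1 := hinj p q hp hq hne hpq
      have e2 := hinj q p hq hp (Ne.symm hne) hpq.symm
      rw [him p q hp hq hne hpq, him q p hq hp (Ne.symm hne) hpq.symm]
      simp only [e1, e2]
      exact (add_self_eq_zero _).symm
    · intro a ha ha'
      simp at ha'
      exact if_neg (key a ha ha'.1 ha'.2)

theorem push_push (g : W → U) (f : V → W) (c : SimpChain V) :
    push g (push f c) = push (g ∘ f) c := by
  classical
  suffices h : (push g ∘ₗ push f : SimpChain V →ₗ[ZMod 2] SimpChain U) = push (g ∘ f) from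
    LinearMap.congr_fun h c
  refine hom_ext fun A => ?_
  simp only [LinearMap.comp_apply, push_single]
  split_ifs with h1 h2 h2
  · rw [push_single, Finset.image_image, if_pos]
    rw [Finset.coe_image]
    exact h2.image_of_comp
  · rw [push_single, if_neg]
    intro h3
    rw [Finset.coe_image] at h3
    exact h2 (h3.comp h1 (Set.mapsTo_image _ _))
  · exact absurd (fun x hx y hy e => h2 hx hy (congrArg g e)) h1
  · exact map_zero _

theorem push_cone {f : V → W} (hf : Function.Injective f) (o : V) (c : SimpChain V) :
    push f (cone o c) = cone (f o) (push f c) := by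
  classical
  suffices h : (push f ∘ₗ cone o : SimpChain V →ₗ[ZMod 2] SimpChain W) = cone (f o) ∘ₗ push f from
    LinearMap.congr_fun h c
  refine hom_ext fun A => ?_
  simp only [LinearMap.comp_apply, push_single, cone_single, if_pos hf.injOn]
  by_cases h : o ∈ A
  · rw [if_pos h, if_pos (Finset.mem_image_of_mem _ h), map_zero]
  · rw [if_neg h, if_neg, push_single, if_pos hf.injOn, Finset.image_insert]
    rintro h'
    obtain ⟨x, hx, e⟩ := Finset.mem_image.1 h'
    exact h (hf e ▸ hx)

/-- A chain is the sum of the simplices in its support. -/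
theorem eq_sum_support (c : SimpChain V) : c = ∑ A ∈ c.support, Finsupp.single A 1 := by
  conv_lhs => rw [← Finsupp.sum_single c]
  refine Finset.sum_congr rfl fun A hA => ?_
  have : ∀ x : ZMod 2, x ≠ 0 → x = 1 := by decide
  rw [this _ (Finsupp.mem_support_iff.1 hA)]

theorem mem_support_sum {ι : Type*} {s : Finset ι} {f : ι → SimpChain V} {A : Finset V}
    (h : A ∈ (∑ i ∈ s, f i).support) : ∃ i ∈ s, A ∈ (f i).support := by
  classical
  obtain ⟨i, hi, h'⟩ := Finset.mem_biUnion.1 (Finsupp.support_finsetSum h)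
  exact ⟨i, hi, h'⟩

theorem mem_support_map {F : SimpChain V →ₗ[ZMod 2] SimpChain W} {c : SimpChain V} {B : Finset W}
    (h : B ∈ (F c).support) : ∃ A ∈ c.support, B ∈ (F (Finsupp.single A 1)).support := by
  rw [eq_sum_support c, map_sum] at h
  exact mem_support_sum h

theorem mem_support_cone [DecidableEq V] {o : V} {c : SimpChain V} {B : Finset V}
    (h : B ∈ (cone o c).support) :
    ∃ A ∈ c.support, o ∉ A ∧ B = insert o A := by
  obtain ⟨A, hA, h⟩ := mem_support_map h
  rw [cone_single] at h
  split_ifs at h with h'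
  · simp at h
  · refine ⟨A, hA, h', ?_⟩
    convert Finset.mem_singleton.1 (Finsupp.support_single_subset h)

theorem mem_support_push [DecidableEq W] {f : V → W} {c : SimpChain V} {B : Finset W}
    (h : B ∈ (push f c).support) : ∃ A ∈ c.support, Set.InjOn f A ∧ B = A.image f := by
  obtain ⟨A, hA, h⟩ := mem_support_map h
  rw [push_single] at h
  split_ifs at h with h'
  · refine ⟨A, hA, h', ?_⟩
    convert Finset.mem_singleton.1 (Finsupp.support_single_subset h)
  · simp at h

theorem push_congr {f g : V → W} {c : SimpChain V}
    (h : ∀ A ∈ c.support, ∀ a ∈ A, f a = g a) : push f c = push g c := by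
  classical
  rw [eq_sum_support c, map_sum, map_sum]
  refine Finset.sum_congr rfl fun A hA => ?_
  have h1 : Set.EqOn f g A := fun a ha => h A hA a ha
  have h2 : A.image f = A.image g := Finset.image_congr h1
  rw [push_single, push_single, h2]
  exact if_congr h1.injOn_iff rfl rfl

end SimpChain

/-- **Ramsey's theorem** for uniform hypergraphs, finite version. -/
theorem exists_ramsey_card (κ : Type) [Fintype κ] (m : ℕ) : ∀ q : ℕ, ∃ n : ℕ, ∀ X : Finset ℕ,
    n ≤ X.card → ∀ f : Finset ℕ → κ, ∃ Q ⊆ X, Q.card = q ∧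
      ∃ k : κ, ∀ A ⊆ Q, A.card = m → f A = k := by
  classical
  induction m with
  | zero =>
    intro q
    refine ⟨q, fun X hX f => ?_⟩
    obtain ⟨Q, hQ, hq⟩ := Finset.exists_subset_card_eq hX
    exact ⟨Q, hQ, hq, f ∅, fun A _ hA => by rw [Finset.card_eq_zero.1 hA]⟩
  | succ m ih =>
    have key : ∀ t : ℕ, ∃ n : ℕ, ∀ X : Finset ℕ, n ≤ X.card → ∀ f : Finset ℕ → κ,
        ∃ Y ⊆ X, Y.card = t ∧ ∃ h : ℕ → κ, ∀ A ⊆ Y, A.card = m + 1 →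
          ∀ a ∈ A, (∀ b ∈ A, a ≤ b) → f A = h a := by
      intro t
      induction t with
      | zero =>
        refine ⟨0, fun X _ f => ⟨∅, by simp, by simp, fun _ => f ∅, fun A hA hA' => ?_⟩⟩
        rw [Finset.subset_empty.1 hA] at hA'
        simp at hA'
      | succ t iht =>
        obtain ⟨n, hn⟩ := iht
        obtain ⟨N, hN⟩ := ih n
        refine ⟨N + 1, fun X hX f => ?_⟩
        have hne : X.Nonempty := Finset.card_pos.1 (by omega)
        set x := X.min' hne
        have hx : x ∈ X := X.min'_mem hne
        obtain ⟨Q, hQX, hQ, k, hk⟩ := hN (X.erase x)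
          (by rw [Finset.card_erase_of_mem hx]; omega) (fun B => f (insert x B))
        obtain ⟨Y, hYQ, hY, h, hh⟩ := hn Q hQ.ge f
        have hlt : ∀ y ∈ Y, x < y := fun y hy => by
          have := hQX (hYQ hy)
          exact lt_of_le_of_ne (X.min'_le _ (Finset.mem_of_mem_erase this))
            (Ne.symm (Finset.ne_of_mem_erase this))
        have hxY : x ∉ Y := fun h' => lt_irrefl _ (hlt x h')
        refine ⟨insert x Y, ?_, by rw [Finset.card_insert_of_notMem hxY, hY],
          fun a => if a = x then k else h a, ?_⟩
        · exact Finset.insert_subset hx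
            ((hYQ.trans hQX).trans (Finset.erase_subset _ _))
        · intro A hA hcard a ha hmin
          by_cases hxA : x ∈ A
          · have hax : a = x := by
              rcases Finset.mem_insert.1 (hA ha) with h1 | h1
              · exact h1
              · exact absurd (hmin x hxA) (not_le.2 (hlt a h1))
            simp only [if_pos hax]
            have := hk (A.erase x) ?_ (by rw [Finset.card_erase_of_mem hxA, hcard]; rfl)
            · rwa [Finset.insert_erase hxA] at this
            · intro y hy
              rcases Finset.mem_insert.1 (hA (Finset.mem_of_mem_erase hy)) with h1 | h1
              · exact absurd h1 (Finset.ne_of_mem_erase hy)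
              · exact hYQ h1
          · have hax : a ≠ x := fun e => hxA (e ▸ ha)
            simp only [if_neg hax]
            exact hh A ((Finset.subset_insert_iff_of_notMem hxA).1 hA) hcard a ha hmin
    intro q
    obtain ⟨n, hn⟩ := key (Fintype.card κ * q + 1)
    refine ⟨n, fun X hX f => ?_⟩
    obtain ⟨Y, hYX, hY, h, hh⟩ := hn X hX f
    obtain ⟨k, -, hk⟩ := Finset.exists_lt_card_fiber_of_mul_lt_card_of_maps_to
      (s := Y) (t := Finset.univ) (f := h) (n := q) (fun _ _ => Finset.mem_univ _)
      (by rw [hY, Finset.card_univ]; omega)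
    obtain ⟨Q, hQ, hq⟩ := Finset.exists_subset_card_eq hk.le
    refine ⟨Q, hQ.trans ((Finset.filter_subset _ _).trans hYX), hq, k, fun A hA hcard => ?_⟩
    have hne : A.Nonempty := Finset.card_pos.1 (by omega)
    rw [hh A (hA.trans (hQ.trans (Finset.filter_subset _ _))) hcard (A.min' hne) (A.min'_mem hne)
      fun b hb => A.min'_le b hb]
    exact (Finset.mem_filter.1 (hQ (hA (A.min'_mem hne)))).2

/-- Ramsey's theorem for increasing tuples. -/
theorem exists_ramsey_strictMono (κ : Type) [Fintype κ] (m q : ℕ) :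
    ∃ n : ℕ, ∀ f : (Fin m → ℕ) → κ, ∃ g : ℕ → ℕ, StrictMonoOn g (Set.Iio q) ∧
      (∀ x < q, g x < n) ∧ ∃ k : κ, ∀ e : Fin m → ℕ, StrictMono e → (∀ x, e x < q) →
        f (fun x => g (e x)) = k := by
  classical
  obtain ⟨n, hn⟩ := exists_ramsey_card κ m q
  refine ⟨n, fun f => ?_⟩
  obtain ⟨Q, hQ, hq, k, hk⟩ := hn (Finset.range n) (by simp)
    (fun A => if h : A.card = m then f (A.orderEmbOfFin h) else f (fun _ => 0))
  refine ⟨fun x => if h : x < q then Q.orderEmbOfFin hq ⟨x, h⟩ else 0, ?_, ?_, k, ?_⟩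
  · intro x hx y hy hxy
    simp only [Set.mem_Iio] at hx hy
    simp only [hx, hy, dif_pos]
    exact (Q.orderEmbOfFin hq).strictMono (by simpa using hxy)
  · intro x hx
    simp only [hx, dif_pos]
    exact Finset.mem_range.1 (hQ (Q.orderEmbOfFin_mem hq _))
  · intro e he heq
    simp only [heq, dif_pos]
    set e' : Fin m → ℕ := fun x => Q.orderEmbOfFin hq ⟨e x, heq x⟩ with he'
    have hmono : StrictMono e' := fun x y hxy =>
      (Q.orderEmbOfFin hq).strictMono (by simpa using he hxy)
    have hcard : (Finset.univ.image e').card = m := by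
      rw [Finset.card_image_of_injective _ hmono.injective, Finset.card_univ, Fintype.card_fin]
    have := hk (Finset.univ.image e') (by
      intro y hy
      obtain ⟨x, -, rfl⟩ := Finset.mem_image.1 hy
      exact Q.orderEmbOfFin_mem hq _) hcard
    rw [dif_pos hcard] at this
    rw [← this]
    congr 1
    exact Finset.orderEmbOfFin_unique hcard (fun x => Finset.mem_image_of_mem _ (Finset.mem_univ _))
      hmono

open Classical in
/-- Evaluation of the indicator cochain of a set of simplices. -/
noncomputable def SimpChain.ev {E : Type*} (P : Finset E → Prop) : SimpChain E →ₗ[ZMod 2] ZMod 2 :=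
  Finsupp.linearCombination (ZMod 2) fun U : Finset E => if P U then (1 : ZMod 2) else 0

open Classical in
theorem SimpChain.ev_single {E : Type*} (P : Finset E → Prop) (U : Finset E) :
    SimpChain.ev P (Finsupp.single U 1) = if P U then (1 : ZMod 2) else 0 := by
  simp [SimpChain.ev]

/-- The vectors `u i`, `i ∈ U`, are in general position: any `m ≤ n` of them are linearly
independent after truncation to the first `m` coordinates. -/
def GenericOn {E : Type*} (u : E → ℕ → ℝ) (n : ℕ) (U : Finset E) : Prop :=
  ∀ W ⊆ U, W.card ≤ n → ∀ t : E → ℝ,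
    (∀ l < W.card, ∑ i ∈ W, t i * u i l = 0) → ∀ i ∈ W, t i = 0

/-- The origin is a positive combination of the vectors `u i` truncated to `m` coordinates. -/
def PosDep {E : Type*} (u : E → ℕ → ℝ) (m : ℕ) (U : Finset E) : Prop :=
  ∃ t : E → ℝ, (∀ i ∈ U, 0 < t i) ∧ ∀ l < m, ∑ i ∈ U, t i * u i l = 0

/-- A positive multiple of the coordinate vector with index `m` is a positive combination of the
vectors `u i` truncated to `m + 1` coordinates. -/
def PosRay {E : Type*} (u : E → ℕ → ℝ) (m : ℕ) (U : Finset E) : Prop :=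
  ∃ t : E → ℝ, (∀ i ∈ U, 0 < t i) ∧ (∀ l < m, ∑ i ∈ U, t i * u i l = 0) ∧
    0 < ∑ i ∈ U, t i * u i m

section GeneralPosition

variable {E : Type*} {u : E → ℕ → ℝ} {n m : ℕ} {U : Finset E}

theorem GenericOn.mono {V : Finset E} (h : GenericOn u n U) (hV : V ⊆ U) : GenericOn u n V :=
  fun W hW => h W (hW.trans hV)

open Classical in
/-- The linear map sending coefficients on `U` to the truncated linear combination. -/
noncomputable def truncComb (u : E → ℕ → ℝ) (m : ℕ) (U : Finset E) :
    (U → ℝ) →ₗ[ℝ] (Fin m → ℝ) where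
  toFun t l := ∑ i : U, t i * u i l
  map_add' s t := by ext l; simp [add_mul, Finset.sum_add_distrib]
  map_smul' a t := by ext l; simp [Finset.mul_sum, mul_assoc]

open Classical in
theorem truncComb_apply_restrict (t : E → ℝ) (l : Fin m) :
    truncComb u m U (fun i => t i) l = ∑ i ∈ U, t i * u i l :=
  Finset.sum_coe_sort U fun i => t i * u i l

open Classical in
theorem exists_extend (t : U → ℝ) : ∃ s : E → ℝ, (fun i : U => s i) = t :=
  ⟨fun i => if h : i ∈ U then t ⟨i, h⟩ else 0, by ext i; simp⟩

theorem exists_dependency (hU : m < U.card) :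
    ∃ c : E → ℝ, (∃ i ∈ U, c i ≠ 0) ∧ ∀ l < m, ∑ i ∈ U, c i * u i l = 0 := by
  classical
  have : LinearMap.ker (truncComb u m U) ≠ ⊥ :=
    LinearMap.ker_ne_bot_of_finrank_lt (by simpa using hU)
  obtain ⟨t, ht, hne⟩ := (Submodule.ne_bot_iff _).1 this
  obtain ⟨c, rfl⟩ := exists_extend t
  refine ⟨c, ?_, fun l hl => ?_⟩
  · by_contra! h
    exact hne (by ext i; exact h i i.2)
  · rw [← truncComb_apply_restrict c ⟨l, hl⟩, LinearMap.mem_ker.1 ht]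
    rfl

theorem GenericOn.exists_dependency (h : GenericOn u n U) (hmn : m ≤ n) (hU : U.card = m + 1) :
    ∃ c : E → ℝ, (∀ i ∈ U, c i ≠ 0) ∧ ∀ l < m, ∑ i ∈ U, c i * u i l = 0 := by
  classical
  obtain ⟨c, ⟨j, hj, hcj⟩, hc⟩ := _root_.exists_dependency (u := u) (m := m) (U := U) (by omega)
  refine ⟨c, fun i hi hci => hcj ?_, hc⟩
  have hcard : (U.erase i).card = m := by rw [Finset.card_erase_of_mem hi, hU]; rfl
  have hji : j ≠ i := fun e => hcj (e ▸ hci)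
  refine h (U.erase i) (Finset.erase_subset _ _) (by omega) c (fun l hl => ?_) j
    (Finset.mem_erase.2 ⟨hji, hj⟩)
  rw [Finset.sum_erase _ (by rw [hci, zero_mul])]
  exact hc l (by omega)

theorem GenericOn.exists_solution (h : GenericOn u n U) (hmn : m + 1 ≤ n) (hU : U.card = m + 1) :
    ∃ p : E → ℝ, (∀ l < m, ∑ i ∈ U, p i * u i l = 0) ∧ ∑ i ∈ U, p i * u i m = 1 := by
  classical
  have hinj : Function.Injective (truncComb u (m + 1) U) := by
    rw [← LinearMap.ker_eq_bot, LinearMap.ker_eq_bot']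
    intro t ht
    obtain ⟨c, rfl⟩ := exists_extend t
    ext i
    refine h U subset_rfl (by omega) c (fun l hl => ?_) i i.2
    rw [← truncComb_apply_restrict (m := m + 1) c ⟨l, by omega⟩, ht]
    rfl
  have hsurj : Function.Surjective (truncComb u (m + 1) U) :=
    (LinearMap.injective_iff_surjective_of_finrank_eq_finrank (by simp [hU])).1 hinj
  obtain ⟨t, ht⟩ := hsurj (Pi.single (Fin.last m) 1)
  obtain ⟨p, rfl⟩ := exists_extend t
  refine ⟨p, fun l hl => ?_, ?_⟩
  · rw [← truncComb_apply_restrict (m := m + 1) p ⟨l, by omega⟩, ht, Pi.single_eq_of_ne]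
    intro e
    have := congrArg Fin.val e
    simp at this
    omega
  · rw [← truncComb_apply_restrict (m := m + 1) p ⟨m, by omega⟩, ht]
    exact Pi.single_eq_same _ _

open Classical in
theorem GenericOn.posDep_eq_posRay_add_posRay (h : GenericOn u n U) (hmn : m + 1 ≤ n)
    (hU : U.card = m + 1) :
    (if PosDep u m U then (1 : ZMod 2) else 0) =
      (if PosRay u m U then 1 else 0) + (if PosRay (fun i l => - u i l) m U then 1 else 0) := by
  obtain ⟨a, ha⟩ : U.Nonempty := Finset.card_pos.1 (by omega)
  have h1 : PosDep u m U ↔ (PosRay u m U ∨ PosRay (fun i l => - u i l) m U) := by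
    constructor
    · rintro ⟨t, ht, hs⟩
      rcases lt_trichotomy (∑ i ∈ U, t i * u i m) 0 with h0 | h0 | h0
      · refine Or.inr ⟨t, ht, fun l hl => by simp [hs l hl], by simpa using h0⟩
      · refine absurd (h U subset_rfl (by omega) t (fun l hl => ?_) a ha) (ht a ha).ne'
        rcases (show l < m ∨ l = m by omega) with h2 | rfl
        · exact hs l h2
        · exact h0
      · exact Or.inl ⟨t, ht, hs, h0⟩
    · rintro (⟨t, ht, hs, -⟩ | ⟨t, ht, hs, -⟩)
      · exact ⟨t, ht, hs⟩
      · exact ⟨t, ht, fun l hl => by simpa using hs l hl⟩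
  have h2 : ¬ (PosRay u m U ∧ PosRay (fun i l => - u i l) m U) := by
    rintro ⟨⟨t, ht, hs, h0⟩, ⟨t', ht', hs', h0'⟩⟩
    simp only [mul_neg, Finset.sum_neg_distrib, neg_eq_zero] at hs' h0'
    set α := ∑ i ∈ U, t i * u i m
    set β := ∑ i ∈ U, t' i * u i m with hβ
    have := h U subset_rfl (by omega) (fun i => - β * t i + α * t' i) (fun l hl => ?_) a ha
    · have h3 : 0 < -β * t a := mul_pos h0' (ht a ha)
      have h4 : 0 < α * t' a := mul_pos h0 (ht' a ha)
      linarith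
    · have : ∑ i ∈ U, (-β * t i + α * t' i) * u i l =
          -β * ∑ i ∈ U, t i * u i l + α * ∑ i ∈ U, t' i * u i l := by
        rw [Finset.mul_sum, Finset.mul_sum, ← Finset.sum_add_distrib]
        exact Finset.sum_congr rfl fun i _ => by ring
      rw [this]
      rcases (show l < m ∨ l = m by omega) with h2 | rfl
      · rw [hs l h2, hs' l h2]; ring
      · change -β * α + α * β = 0
        ring
  by_cases hp : PosRay u m U <;> by_cases hq : PosRay (fun i l => - u i l) m U <;>
    simp_all

open Classical in
/-- Along a linear order, the number of elements below which all signs are negative and above which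
all signs are positive is odd exactly when all signs agree. -/
theorem sum_sign_change (r c : E → ℝ) (U : Finset E) (hU : U.Nonempty)
    (hr : Set.InjOn r U) (hc : ∀ i ∈ U, c i ≠ 0) :
    ∑ i ∈ U, (if ∀ k ∈ U.erase i, 0 < c k * (r k - r i) then (1 : ZMod 2) else 0) =
      if (∀ i ∈ U, 0 < c i) ∨ (∀ i ∈ U, c i < 0) then 1 else 0 := by
  induction U using Finset.induction_on_max_value r with
  | empty => exact absurd hU (by simp)
  | insert a s has hmax ih =>
    have hlt : ∀ x ∈ s, r x < r a := fun x hx => lt_of_le_of_ne (hmax x hx)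
      (fun e => has (hr (by simp [hx]) (by simp) e ▸ hx))
    rw [Finset.sum_insert has, Finset.erase_insert has]
    have e1 : (∀ k ∈ s, 0 < c k * (r k - r a)) ↔ ∀ k ∈ s, c k < 0 := by
      refine forall₂_congr fun k hk => ?_
      have hneg := sub_neg.2 (hlt k hk)
      exact ⟨fun h => neg_of_mul_pos_left h hneg.le, fun h => mul_pos_of_neg_of_neg h hneg⟩
    have e2 : ∀ i ∈ s, (∀ k ∈ (insert a s).erase i, 0 < c k * (r k - r i)) ↔
        (0 < c a ∧ ∀ k ∈ s.erase i, 0 < c k * (r k - r i)) := by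
      intro i hi
      rw [Finset.erase_insert_of_ne (by rintro rfl; exact has hi), Finset.forall_mem_insert,
        mul_pos_iff_of_pos_right (sub_pos.2 (hlt i hi))]
    rw [Finset.sum_congr rfl fun i hi => if_congr (e2 i hi) rfl rfl]
    simp only [e1, Finset.forall_mem_insert]
    rcases s.eq_empty_or_nonempty with rfl | hs
    · have := hc a (by simp)
      rcases lt_or_gt_of_ne this with h | h <;> simp [h]
    · have ih' := ih hs (hr.mono (by simp)) (fun i hi => hc i (by simp [hi]))
      obtain ⟨b, hb⟩ := hs
      rcases lt_or_gt_of_ne (hc a (by simp)) with h | h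
      · simp [h, not_lt.2 h.le]
      · simp only [h, true_and, not_lt.2 h.le, false_and, or_false]
        rw [ih']
        by_cases hp : ∀ i ∈ s, 0 < c i
        · have : ¬ ∀ i ∈ s, c i < 0 := fun h' => lt_asymm (h' b hb) (hp b hb)
          simp [this]
        · by_cases hq : ∀ i ∈ s, c i < 0
          · simp [hp, SimpChain.add_self_eq_zero]
          · simp [hp, hq]

open Classical in
theorem GenericOn.posDep_eq_sum_posRay (h : GenericOn u n U) (hmn : m + 1 ≤ n)
    (hU : U.card = m + 2) :
    (if PosDep u (m + 1) U then (1 : ZMod 2) else 0) =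
      ∑ i ∈ U, if PosRay u m (U.erase i) then (1 : ZMod 2) else 0 := by
  obtain ⟨a, ha⟩ : U.Nonempty := Finset.card_pos.1 (by omega)
  have hcard : ∀ i ∈ U, (U.erase i).card = m + 1 := fun i hi => by
    rw [Finset.card_erase_of_mem hi, hU]; rfl
  obtain ⟨c, hc0, hc⟩ := h.exists_dependency hmn hU
  obtain ⟨p', hp', hp1'⟩ := (h.mono (Finset.erase_subset a U)).exists_solution hmn (hcard a ha)
  obtain ⟨p, hp, hp1⟩ : ∃ p : E → ℝ, (∀ l < m, ∑ i ∈ U, p i * u i l = 0) ∧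
      ∑ i ∈ U, p i * u i m = 1 := by
    have : ∀ l, ∑ i ∈ U, (if i = a then 0 else p' i) * u i l = ∑ i ∈ U.erase a, p' i * u i l := by
      intro l
      rw [← Finset.sum_erase _ (a := a) (by simp)]
      exact Finset.sum_congr rfl fun i hi => by rw [if_neg (Finset.ne_of_mem_erase hi)]
    exact ⟨fun i => if i = a then 0 else p' i, fun l hl => by rw [this, hp' l hl],
      by rw [this, hp1']⟩
  have lin : ∀ (s t : E → ℝ) (x : ℝ) (l : ℕ), ∑ i ∈ U, (s i - x * t i) * u i l =
      ∑ i ∈ U, s i * u i l - x * ∑ i ∈ U, t i * u i l := fun s t x l => by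
    rw [Finset.mul_sum, ← Finset.sum_sub_distrib]
    exact Finset.sum_congr rfl fun i _ => by ring
  have hr : Set.InjOn (fun i => p i / c i) U := by
    intro i hi j hj hij
    by_contra hne
    simp only at hij
    have hW : ((U.erase i).erase j).card = m := by
      rw [Finset.card_erase_of_mem (Finset.mem_erase.2 ⟨Ne.symm hne, hj⟩), hcard i hi]; rfl
    have hzi : p i - (p i / c i) * c i = 0 := by
      rw [div_mul_cancel₀ _ (hc0 i hi), sub_self]
    have hzj : p j - (p i / c i) * c j = 0 := by
      rw [hij, div_mul_cancel₀ _ (hc0 j hj), sub_self]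
    have key := h ((U.erase i).erase j)
      ((Finset.erase_subset _ _).trans (Finset.erase_subset _ _)) (by omega)
      (fun k => p k - (p i / c i) * c k) (fun l hl => by
        rw [Finset.sum_erase _ (by rw [hzj, zero_mul]), Finset.sum_erase _ (by rw [hzi, zero_mul]),
          lin, hp l (by omega), hc l (by omega)]; ring)
    have : ∑ k ∈ U, (p k - (p i / c i) * c k) * u k m = 0 := by
      refine Finset.sum_eq_zero fun k hk => ?_
      by_cases hki : k = i
      · rw [hki, hzi, zero_mul]
      by_cases hkj : k = j
      · rw [hkj, hzj, zero_mul]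
      rw [key k (Finset.mem_erase.2 ⟨hkj, Finset.mem_erase.2 ⟨hki, hk⟩⟩), zero_mul]
    rw [lin, hp1, hc m (by omega)] at this
    norm_num at this
  have hray : ∀ i ∈ U, PosRay u m (U.erase i) ↔
      ∀ k ∈ U.erase i, 0 < c k * (p k / c k - p i / c i) := by
    intro i hi
    have hk : ∀ k ∈ U, c k * (p k / c k - p i / c i) = p k - (p i / c i) * c k := fun k hk => by
      rw [mul_sub, mul_div_cancel₀ _ (hc0 k hk)]; ring
    have hzi : p i - (p i / c i) * c i = 0 := by
      rw [div_mul_cancel₀ _ (hc0 i hi), sub_self]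
    constructor
    · rintro ⟨t, ht, hs, hs1⟩ k hkU
      set α := ∑ i ∈ U.erase i, t i * u i m
      set t' : E → ℝ := fun k => if k = i then 0 else t k
      have ht' : ∀ l, ∑ k ∈ U, t' k * u k l = ∑ k ∈ U.erase i, t k * u k l := by
        intro l
        rw [← Finset.sum_erase _ (a := i) (by simp [t'])]
        exact Finset.sum_congr rfl fun k hk => by simp [t', Finset.ne_of_mem_erase hk]
      have key := h (U.erase i) (Finset.erase_subset _ _) (by rw [hcard i hi]; omega)
        (fun k => t' k - α * (p k - (p i / c i) * c k)) (fun l hl => by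
          rw [Finset.sum_erase _ (by simp only [hzi]; simp [t']), lin, lin, ht']
          rw [hcard i hi] at hl
          rcases (show l < m ∨ l = m by omega) with h2 | rfl
          · rw [hs l h2, hp l h2, hc l (by omega)]; ring
          · rw [hp1, hc l (by omega)]; ring) k hkU
      simp only [t', if_neg (Finset.ne_of_mem_erase hkU)] at key
      rw [hk k (Finset.mem_of_mem_erase hkU)]
      have h1 := ht k hkU
      have h2 : 0 < α * (p k - (p i / c i) * c k) := by linarith
      exact (pos_iff_pos_of_mul_pos h2).1 hs1
    · intro hpos
      refine ⟨fun k => p k - (p i / c i) * c k, fun k hkU => ?_, fun l hl => ?_, ?_⟩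
      · have := hpos k hkU
        rwa [hk k (Finset.mem_of_mem_erase hkU)] at this
      · rw [Finset.sum_erase _ (by simp only [hzi, zero_mul]), lin, hp l hl, hc l (by omega)]; ring
      · rw [Finset.sum_erase _ (by simp only [hzi, zero_mul]), lin, hp1, hc m (by omega)]; norm_num
  have hdep : PosDep u (m + 1) U ↔ ((∀ i ∈ U, 0 < c i) ∨ (∀ i ∈ U, c i < 0)) := by
    constructor
    · rintro ⟨t, ht, hs⟩
      have hza : t a - (t a / c a) * c a = 0 := by
        rw [div_mul_cancel₀ _ (hc0 a ha), sub_self]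
      have key := h (U.erase a) (Finset.erase_subset _ _) (by rw [hcard a ha]; omega)
        (fun k => t k - (t a / c a) * c k) (fun l hl => by
          rw [hcard a ha] at hl
          rw [Finset.sum_erase _ (by simp only [hza]; simp), lin, hs l hl, hc l hl]; ring)
      have key' : ∀ k ∈ U, 0 < (t a / c a) * c k := by
        intro k hk
        by_cases hka : k = a
        · rw [hka]; linarith [ht a ha]
        · linarith [key k (Finset.mem_erase.2 ⟨hka, hk⟩), ht k hk]
      rcases lt_or_gt_of_ne (hc0 a ha) with h0 | h0
      · right
        intro i hi
        exact (neg_of_mul_pos_right (key' i hi) (div_neg_of_pos_of_neg (ht a ha) h0).le)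
      · left
        intro i hi
        exact (mul_pos_iff_of_pos_left (div_pos (ht a ha) h0)).1 (key' i hi)
    · rintro (h' | h')
      · exact ⟨c, h', hc⟩
      · exact ⟨fun i => - c i, fun i hi => by linarith [h' i hi], fun l hl => by simp [hc l hl]⟩
  rw [if_congr hdep rfl rfl, ← sum_sign_change (fun i => p i / c i) c U ⟨a, ha⟩ hr hc0]
  exact Finset.sum_congr rfl fun i hi => if_congr (hray i hi).symm rfl rfl

end GeneralPosition

open SimpChain

namespace SimpChain

variable {V : Type*}

/-- The join of two chains on disjoint copies of the vertex set. -/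
noncomputable def join : SimpChain V →ₗ[ZMod 2] SimpChain V →ₗ[ZMod 2] SimpChain (V ⊕ V) :=
  Finsupp.linearCombination (ZMod 2) fun A : Finset V =>
    Finsupp.linearCombination (ZMod 2) fun B : Finset V =>
      (Finsupp.single (A.disjSum B) 1 : SimpChain (V ⊕ V))

theorem join_single (A B : Finset V) :
    join (Finsupp.single A 1) (Finsupp.single B 1) = Finsupp.single (A.disjSum B) 1 := by
  simp [join]

theorem mem_support_join {a b : SimpChain V} {U : Finset (V ⊕ V)} (h : U ∈ (join a b).support) :
    ∃ A ∈ a.support, ∃ B ∈ b.support, U = A.disjSum B := by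
  classical
  rw [eq_sum_support a, map_sum, LinearMap.sum_apply] at h
  obtain ⟨A, hA, h⟩ := mem_support_sum h
  rw [eq_sum_support b, map_sum] at h
  obtain ⟨B, hB, h⟩ := mem_support_sum h
  rw [join_single, Finsupp.mem_support_iff, Finsupp.single_apply] at h
  exact ⟨A, hA, B, hB, by by_contra h'; exact h (if_neg (Ne.symm h'))⟩

theorem bd_join (a b : SimpChain V) : bd (join a b) = join (bd a) b + join a (bd b) := by
  classical
  suffices h : (bd ∘ₗ (join.flip b) : SimpChain V →ₗ[ZMod 2] SimpChain (V ⊕ V)) =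
      join.flip b ∘ₗ bd + join.flip (bd b) from LinearMap.congr_fun h a
  refine hom_ext fun A => ?_
  suffices h : (bd ∘ₗ (join (Finsupp.single A 1)) : SimpChain V →ₗ[ZMod 2] SimpChain (V ⊕ V)) =
      join (bd (Finsupp.single A 1)) + join (Finsupp.single A 1) ∘ₗ bd from LinearMap.congr_fun h b
  refine hom_ext fun B => ?_
  simp only [LinearMap.comp_apply, LinearMap.add_apply, join_single, bd_single, map_sum,
    LinearMap.sum_apply, Finset.sum_disjSum]
  congr 1 <;> refine Finset.sum_congr rfl fun x hx => ?_ <;> congr 1 <;> ext y <;>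
    rcases y with y | y <;> simp

theorem push_swap_join (a b : SimpChain V) : push Sum.swap (join a b) = join b a := by
  classical
  suffices h : (push Sum.swap ∘ₗ (join.flip b) : SimpChain V →ₗ[ZMod 2] SimpChain (V ⊕ V)) =
      join b from LinearMap.congr_fun h a
  refine hom_ext fun A => ?_
  suffices h : (push Sum.swap ∘ₗ join (Finsupp.single A 1) :
      SimpChain V →ₗ[ZMod 2] SimpChain (V ⊕ V)) = join.flip (Finsupp.single A 1) from
    LinearMap.congr_fun h b
  refine hom_ext fun B => ?_
  simp only [LinearMap.comp_apply, LinearMap.flip_apply, join_single, push_single]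
  rw [if_pos (Sum.swap_leftInverse.injective.injOn)]
  congr 1
  ext y
  rcases y with y | y <;> simp

end SimpChain

section Deleted

variable {V : Type*}

/-- Antipodal extension of a vector configuration to two copies of the vertex set. -/
def antipodal (φ : V → ℕ → ℝ) : V ⊕ V → ℕ → ℝ :=
  Sum.elim φ fun v l => - φ v l

variable (γ : Finset ℕ → SimpChain V) (φ : V → ℕ → ℝ)

/-- The chain on the `i`-th deleted-join sphere spanned by a family of chains. -/
noncomputable def sphereChain (i : ℕ) : SimpChain (V ⊕ V) :=
  ∑ A ∈ (Finset.range i).powerset, join (γ A) (γ (Finset.range i \ A))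

/-- The chain on the upper hemisphere of the `i + 1`-st deleted-join sphere. -/
noncomputable def hemisphereChain (i : ℕ) : SimpChain (V ⊕ V) :=
  ∑ A ∈ (Finset.range i).powerset, join (γ (insert i A)) (γ (Finset.range i \ A))

theorem sphereChain_succ (i : ℕ) : sphereChain γ (i + 1) =
    hemisphereChain γ i + push Sum.swap (hemisphereChain γ i) := by
  rw [sphereChain, Finset.range_add_one, Finset.sum_powerset_insert (by simp), add_comm,
    hemisphereChain, map_sum]
  congr 1
  · refine Finset.sum_congr rfl fun A hA => ?_
    congr 2
    ext x
    simp only [Finset.mem_sdiff, Finset.mem_insert, Finset.mem_range]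
    have : x ∈ A → x < i := fun h => Finset.mem_range.1 (Finset.mem_powerset.1 hA h)
    grind
  · refine Finset.sum_nbij' (fun A => Finset.range i \ A) (fun A => Finset.range i \ A)
      ?_ ?_ ?_ ?_ ?_
    · intro A _; simp
    · intro A _; simp
    · intro A hA; simpa using hA
    · intro A hA; simpa using hA
    · intro A hA
      rw [push_swap_join]
      have hA' := Finset.mem_powerset.1 hA
      rw [Finset.sdiff_sdiff_eq_self hA', Finset.insert_sdiff_of_notMem]
      intro h
      simpa using hA' h

theorem bd_hemisphereChain {M : ℕ}
    (hbd : ∀ A ⊆ Finset.range M, bd (γ A) = ∑ a ∈ A, γ (A.erase a)) {i : ℕ} (hi : i < M) :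
    bd (hemisphereChain γ i) = sphereChain γ i := by
  have key : ∀ A ∈ (Finset.range i).powerset,
      bd (join (γ (insert i A)) (γ (Finset.range i \ A))) = join (γ A) (γ (Finset.range i \ A)) +
        (∑ a ∈ A, join (γ (insert i (A.erase a))) (γ (Finset.range i \ A)) +
        ∑ c ∈ Finset.range i \ A, join (γ (insert i A)) (γ ((Finset.range i \ A).erase c))) := by
    intro A hA
    have hA' := Finset.mem_powerset.1 hA
    have hiA : i ∉ A := fun h => by simpa using hA' h
    have hr : Finset.range i ⊆ Finset.range M := Finset.range_subset_range.2 hi.le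
    rw [bd_join, hbd _ (Finset.insert_subset (by simpa using hi) (hA'.trans hr)),
      hbd _ (Finset.sdiff_subset.trans hr), Finset.sum_insert hiA, Finset.erase_insert hiA,
      map_add, LinearMap.add_apply, map_sum, map_sum, LinearMap.sum_apply, add_assoc]
    congr 2
    refine Finset.sum_congr rfl fun a ha => ?_
    rw [Finset.erase_insert_of_ne]
    rintro rfl
    exact hiA ha
  rw [hemisphereChain, map_sum, Finset.sum_congr rfl key, Finset.sum_add_distrib,
    Finset.sum_add_distrib, sphereChain]
  refine add_eq_left.2 ?_
  refine Eq.trans (congrArg (· + _) ?_) (add_self_eq_zero _)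
  rw [Finset.sum_sigma', Finset.sum_sigma']
  symm
  refine Finset.sum_bij' (fun x _ => ⟨insert x.2 x.1, x.2⟩) (fun x _ => ⟨x.1.erase x.2, x.2⟩)
    ?_ ?_ ?_ ?_ ?_
  · rintro ⟨A, a⟩ h
    simp only [Finset.mem_sigma, Finset.mem_powerset, Finset.mem_sdiff] at h ⊢
    exact ⟨Finset.insert_subset h.2.1 h.1, Finset.mem_insert_self _ _⟩
  · rintro ⟨A, a⟩ h
    simp only [Finset.mem_sigma, Finset.mem_powerset, Finset.mem_sdiff] at h ⊢
    exact ⟨(Finset.erase_subset _ _).trans h.1, h.1 h.2, by simp⟩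
  · rintro ⟨A, a⟩ h
    simp only [Finset.mem_sigma, Finset.mem_powerset, Finset.mem_sdiff] at h
    simp [Finset.erase_insert h.2.2]
  · rintro ⟨A, a⟩ h
    simp only [Finset.mem_sigma, Finset.mem_powerset] at h
    simp [Finset.insert_erase h.2]
  · rintro ⟨A, a⟩ h
    simp only [Finset.mem_sigma, Finset.mem_powerset, Finset.mem_sdiff] at h
    simp only [Finset.erase_insert h.2.2]
    congr 2
    ext x
    simp
    tauto

theorem ev_posDep_eq_ev_posRay {E : Type*} {u : E → ℕ → ℝ} {m n : ℕ} (hmn : m + 1 ≤ n)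
    {c : SimpChain E} (hc : ∀ U ∈ c.support, U.card = m + 2 ∧ GenericOn u n U) :
    ev (PosDep u (m + 1)) c = ev (PosRay u m) (bd c) := by
  classical
  rw [eq_sum_support c, map_sum, map_sum, map_sum]
  refine Finset.sum_congr rfl fun U hU => ?_
  rw [ev_single, bd_single, map_sum]
  convert (hc U hU).2.posDep_eq_sum_posRay hmn (hc U hU).1 using 2
  rw [ev_single]

open Classical in
theorem posRay_image_iff {E : Type*} {u : E → ℕ → ℝ} {m : ℕ} {f : E → E}
    (hf : Function.Involutive f) (hu : ∀ x l, u (f x) l = - u x l) {U : Finset E} :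
    PosRay u m (U.image f) ↔ PosRay (fun i l => - u i l) m U := by
  have hsum : ∀ (t : E → ℝ) l, ∑ i ∈ U.image f, t i * u i l = ∑ i ∈ U, t (f i) * - u i l :=
    fun t l => by
      rw [Finset.sum_image hf.injective.injOn]
      simp only [hu]
  constructor
  · rintro ⟨t, ht, h1, h2⟩
    refine ⟨fun i => t (f i), fun i hi => ht _ (Finset.mem_image_of_mem _ hi), fun l hl => ?_, ?_⟩
    · rw [← hsum, h1 l hl]
    · rw [← hsum]; exact h2
  · rintro ⟨t, ht, h1, h2⟩
    refine ⟨fun i => t (f i), ?_, fun l hl => ?_, ?_⟩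
    · intro i hi
      obtain ⟨j, hj, rfl⟩ := Finset.mem_image.1 hi
      simpa [hf j] using ht j hj
    · rw [hsum]; simpa only [hf _] using h1 l hl
    · rw [hsum]; simpa only [hf _] using h2

theorem ev_posRay_add_swap {m n : ℕ} (hmn : m + 1 ≤ n)
    {c : SimpChain (V ⊕ V)}
    (hc : ∀ U ∈ c.support, U.card = m + 1 ∧ GenericOn (antipodal φ) n U) :
    ev (PosRay (antipodal φ) m) (c + push Sum.swap c) = ev (PosDep (antipodal φ) m) c := by
  classical
  rw [eq_sum_support c, map_add, map_sum, map_sum, map_sum, map_sum, ← Finset.sum_add_distrib]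
  refine Finset.sum_congr rfl fun U hU => ?_
  have hinj : Function.Injective (Sum.swap : V ⊕ V → V ⊕ V) := Sum.swap_leftInverse.injective
  rw [push_single, if_pos hinj.injOn, ev_single, ev_single, ev_single,
    (hc U hU).2.posDep_eq_posRay_add_posRay hmn (hc U hU).1]
  congr 2
  refine propext (posRay_image_iff (fun x => Sum.swap_swap x) ?_)
  rintro (x | x) l <;> simp [antipodal]

/-- A chain-level Radon theorem: the images of two complementary faces of a simplex under a
chain map to a generic configuration cannot all be separated. -/
theorem exists_posDep_of_chainMap {M : ℕ} (h0 : γ ∅ = Finsupp.single ∅ 1)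
    (hbd : ∀ A ⊆ Finset.range (M + 1), bd (γ A) = ∑ a ∈ A, γ (A.erase a))
    (hcard : ∀ A ⊆ Finset.range (M + 1), ∀ U ∈ (γ A).support, U.card = A.card)
    (hgen : ∀ A ⊆ Finset.range (M + 1), ∀ B ⊆ Finset.range (M + 1), Disjoint A B →
      ∀ U ∈ (γ A).support, ∀ U' ∈ (γ B).support,
        GenericOn (antipodal φ) (M + 1) (U.disjSum U')) :
    ∃ A B : Finset ℕ, Disjoint A B ∧ A ∪ B = Finset.range (M + 1) ∧
      ∃ U ∈ (γ A).support, ∃ U' ∈ (γ B).support, PosDep (antipodal φ) M (U.disjSum U') := by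
  classical
  have hsupp : ∀ i < M + 1, ∀ W ∈ (hemisphereChain γ i).support,
      W.card = i + 1 ∧ GenericOn (antipodal φ) (M + 1) W := by
    intro i hi W hW
    obtain ⟨A, hA, hW⟩ := mem_support_sum hW
    obtain ⟨U, hU, U', hU', rfl⟩ := mem_support_join hW
    have hA' := Finset.mem_powerset.1 hA
    have hr : Finset.range i ⊆ Finset.range (M + 1) := Finset.range_subset_range.2 hi.le
    have hiA : i ∉ A := fun h => by simpa using hA' h
    have h1 : insert i A ⊆ Finset.range (M + 1) :=
      Finset.insert_subset (by simpa using hi) (hA'.trans hr)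
    have h2 : Finset.range i \ A ⊆ Finset.range (M + 1) := Finset.sdiff_subset.trans hr
    refine ⟨?_, hgen _ h1 _ h2 ?_ U hU U' hU'⟩
    · rw [Finset.card_disjSum, hcard _ h1 U hU, hcard _ h2 U' hU', Finset.card_insert_of_notMem hiA,
        Finset.card_sdiff_of_subset hA', Finset.card_range]
      have := Finset.card_le_card hA'
      rw [Finset.card_range] at this
      omega
    · rw [Finset.disjoint_insert_left]
      exact ⟨by simp, Finset.disjoint_sdiff⟩
  have hev : ∀ i < M + 1, ev (PosDep (antipodal φ) i) (hemisphereChain γ i) = 1 := by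
    intro i
    induction i with
    | zero =>
      intro _
      have hb : bd (γ {0}) = Finsupp.single ∅ 1 := by rw [hbd _ (by simp)]; simpa using h0
      have : ev (PosDep (antipodal φ) 0) (hemisphereChain γ 0) =
          ev (fun _ => True) (bd (γ {0})) := by
        simp only [hemisphereChain, Finset.range_zero, Finset.powerset_empty, Finset.sum_singleton,
          insert_empty_eq, Finset.empty_sdiff, h0]
        have hc := hcard {0} (by simp)
        rw [eq_sum_support (γ {0}), map_sum, map_sum, map_sum, LinearMap.sum_apply, map_sum]
        refine Finset.sum_congr rfl fun U hU => ?_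
        obtain ⟨v, rfl⟩ := Finset.card_eq_one.1 (hc U hU)
        rw [join_single, ev_single, bd_single, if_pos ⟨1, by simp, by simp⟩]
        simp [ev_single]
      rw [this, hb, ev_single, if_pos trivial]
    | succ i ih =>
      intro hi
      rw [ev_posDep_eq_ev_posRay (n := M + 1) (by omega) (hsupp (i + 1) hi),
        bd_hemisphereChain γ hbd hi, sphereChain_succ,
        ev_posRay_add_swap φ (n := M + 1) (by omega) (hsupp i (by omega))]
      exact ih (by omega)
  have h1 := hev M (by omega)
  rw [eq_sum_support (hemisphereChain γ M), map_sum] at h1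
  obtain ⟨W, hW, hW'⟩ := Finset.exists_ne_zero_of_sum_ne_zero (h1.trans_ne one_ne_zero)
  rw [ev_single] at hW'
  have hpos : PosDep (antipodal φ) M W := by
    by_contra h
    exact hW' (if_neg h)
  obtain ⟨A, hA, hW⟩ := mem_support_sum hW
  obtain ⟨U, hU, U', hU', rfl⟩ := mem_support_join hW
  have hA' := Finset.mem_powerset.1 hA
  refine ⟨insert M A, Finset.range M \ A, ?_, ?_, U, hU, U', hU', hpos⟩
  · rw [Finset.disjoint_insert_left]
    exact ⟨by simp, Finset.disjoint_sdiff⟩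
  · rw [Finset.insert_union, Finset.union_sdiff_of_subset hA', Finset.range_add_one]

end Deleted

section Perturbation

variable {V : Type*}

theorem GenericOn.antipodal {φ : V → ℕ → ℝ} {n : ℕ} {V₀ U U' : Finset V} (h : GenericOn φ n V₀)
    (hU : U ⊆ V₀) (hU' : U' ⊆ V₀) (hd : Disjoint U U') :
    GenericOn (antipodal φ) n (U.disjSum U') := by
  classical
  intro W hW hn t ht
  have h1 : W.toLeft ⊆ U := fun v hv => by
    simpa using hW (Finset.mem_toLeft.1 hv)
  have h2 : W.toRight ⊆ U' := fun v hv => by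
    simpa using hW (Finset.mem_toRight.1 hv)
  have hd' : Disjoint W.toLeft W.toRight := Finset.disjoint_of_subset_left h1
    (Finset.disjoint_of_subset_right h2 hd)
  have hc : (W.toLeft ∪ W.toRight).card = W.card := by
    rw [Finset.card_union_of_disjoint hd', Finset.card_toLeft_add_card_toRight]
  have key := h (W.toLeft ∪ W.toRight) (Finset.union_subset (h1.trans hU) (h2.trans hU'))
    (hc.trans_le hn) (fun v => if v ∈ U then t (Sum.inl v) else - t (Sum.inr v)) (fun l hl => by
      rw [hc] at hl
      rw [← ht l hl, ← Finset.toLeft_disjSum_toRight (u := W), Finset.sum_disjSum,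
        Finset.sum_union (by simpa using hd')]
      simp only [Finset.toLeft_disjSum, Finset.toRight_disjSum]
      congr 1
      · exact Finset.sum_congr rfl fun v hv => by simp [_root_.antipodal, h1 hv]
      · refine Finset.sum_congr rfl fun v hv => ?_
        rw [if_neg (Finset.disjoint_right.1 hd (h2 hv))]
        simp [_root_.antipodal])
  rintro (v | v) hi
  · simpa [h1 (Finset.mem_toLeft.2 hi)] using
      key v (Finset.mem_union_left _ (Finset.mem_toLeft.2 hi))
  · simpa [Finset.disjoint_right.1 hd (h2 (Finset.mem_toRight.2 hi))] using
      key v (Finset.mem_union_right _ (Finset.mem_toRight.2 hi))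

open Polynomial in
/-- Moving points along generic points of the moment curve puts them in general position. -/
theorem eventually_genericOn (ψ : V → ℕ → ℝ) (s : V → ℝ) (V₀ : Finset V) (hs : Set.InjOn s V₀)
    (n : ℕ) : ∀ᶠ t in nhdsWithin (0 : ℝ) {0}ᶜ,
      GenericOn (fun v l => ψ v l + t * s v ^ l) n V₀ := by
  classical
  have key : ∀ W ∈ V₀.powerset, ∀ᶠ t in nhdsWithin (0 : ℝ) {0}ᶜ, ∀ c : V → ℝ,
      (∀ l < W.card, ∑ i ∈ W, c i * (ψ i l + t * s i ^ l) = 0) → ∀ i ∈ W, c i = 0 := by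
    intro W hW
    have hW' := Finset.mem_powerset.1 hW
    let e := W.equivFin.symm
    let A : Matrix (Fin W.card) (Fin W.card) ℝ := Matrix.vandermonde fun i => s (e i)
    let B : Matrix (Fin W.card) (Fin W.card) ℝ := Matrix.of fun i l => ψ (e i) l
    let p : ℝ[X] := Matrix.det ((X : ℝ[X]) • A.map C + B.map C)
    have hA : A.det ≠ 0 := Matrix.det_vandermonde_ne_zero_iff.2 fun i j hij =>
      e.injective (Subtype.ext (hs (hW' (e i).2) (hW' (e j).2) hij))
    have hp : p ≠ 0 := by
      intro hp
      have := Polynomial.coeff_det_X_add_C_card A B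
      change p.coeff _ = _ at this
      rw [hp, coeff_zero] at this
      exact hA this.symm
    have hfin : {t | p.IsRoot t}.Finite := Polynomial.finite_setOfPred_isRoot hp
    have hev : ∀ᶠ t in nhdsWithin (0 : ℝ) {0}ᶜ, ¬ p.IsRoot t := by
      have h1 : ({t | p.IsRoot t} \ {0})ᶜ ∈ nhds (0 : ℝ) :=
        (hfin.subset Set.sdiff_subset).isClosed.isOpen_compl.mem_nhds (by simp)
      filter_upwards [nhdsWithin_le_nhds h1, self_mem_nhdsWithin] with t ht h0 hr
      exact ht ⟨hr, h0⟩
    filter_upwards [hev] with t ht c hc i hi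
    have hdet : (Matrix.of fun (i : Fin W.card) (l : Fin W.card) =>
        ψ (e i) l + t * s (e i) ^ (l : ℕ)).det ≠ 0 := by
      intro h0
      apply ht
      rw [IsRoot.def, ← Polynomial.coe_evalRingHom, RingHom.map_det, ← h0]
      congr 1
      ext i l
      simp [A, B, Matrix.vandermonde_apply]
      ring
    have := Matrix.eq_zero_of_vecMul_eq_zero hdet (v := fun i => c (e i)) (by
      ext l
      simp only [Matrix.vecMul, dotProduct, Matrix.of_apply, Pi.zero_apply]
      rw [← hc l l.2, ← Finset.sum_coe_sort W]
      exact e.sum_comp fun i : W => c i * (ψ i l + t * s i ^ (l : ℕ)))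
    have h := congrFun this (e.symm ⟨i, hi⟩)
    simpa using h
  have := (Filter.eventually_all_finset _).2 key
  filter_upwards [this] with t ht W hW _ c hc
  exact ht W (Finset.mem_powerset.2 hW) c hc

/-- Strictly separated configurations have no positive dependency, even after perturbation. -/
theorem eventually_not_posDep (ψ : V → ℕ → ℝ) (s : V → ℝ) {M : ℕ} {U U' : Finset V}
    (hne : (U.disjSum U').Nonempty) (Λ : ℕ → ℝ)
    (hU : ∀ v ∈ U, 0 < ∑ l ∈ Finset.range M, Λ l * ψ v l)
    (hU' : ∀ v ∈ U', ∑ l ∈ Finset.range M, Λ l * ψ v l < 0) :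
    ∀ᶠ t in nhds (0 : ℝ),
      ¬ PosDep (antipodal fun v l => ψ v l + t * s v ^ l) M (U.disjSum U') := by
  have hcont : ∀ v, Continuous fun t : ℝ =>
      ∑ l ∈ Finset.range M, Λ l * (ψ v l + t * s v ^ l) := fun v => by fun_prop
  have h1 : ∀ v ∈ U, ∀ᶠ t in nhds (0 : ℝ),
      0 < ∑ l ∈ Finset.range M, Λ l * (ψ v l + t * s v ^ l) := fun v hv =>
    (hcont v).continuousAt.eventually_const_lt (by simpa using hU v hv)
  have h2 : ∀ v ∈ U', ∀ᶠ t in nhds (0 : ℝ),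
      ∑ l ∈ Finset.range M, Λ l * (ψ v l + t * s v ^ l) < 0 := fun v hv =>
    (hcont v).continuousAt.eventually_lt_const (by simpa using hU' v hv)
  filter_upwards [(Filter.eventually_all_finset _).2 h1, (Filter.eventually_all_finset _).2 h2]
    with t h1 h2
  rintro ⟨c, hc, hc0⟩
  have : ∑ i ∈ U.disjSum U', c i * ∑ l ∈ Finset.range M,
      Λ l * antipodal (fun v l => ψ v l + t * s v ^ l) i l = 0 := by
    simp only [Finset.mul_sum]
    rw [Finset.sum_comm]
    refine Finset.sum_eq_zero fun l hl => ?_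
    rw [← mul_zero (Λ l), ← hc0 l (Finset.mem_range.1 hl), Finset.mul_sum]
    exact Finset.sum_congr rfl fun i _ => by ring
  refine this.not_gt (Finset.sum_pos (fun i hi => mul_pos (hc i hi) ?_) hne)
  rcases i with v | v
  · exact h1 v (by simpa using hi)
  · have := h2 v (by simpa using hi)
    simpa [antipodal, ← neg_add_rev, Finset.sum_neg_distrib, mul_neg, -neg_add_rev] using this

end Perturbation

section Extension

variable {X : Type*} (k : ℕ) (γ : Finset ℕ → SimpChain X)

/-- Extension of a family of chains beyond dimension `k` by successive coning from new vertices. -/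
noncomputable def coneExtension (A : Finset ℕ) : SimpChain (X ⊕ Finset ℕ) :=
  if A.card ≤ k + 1 then push Sum.inl (γ A)
  else cone (Sum.inr A) (∑ a ∈ A.attach, coneExtension (A.erase a))
termination_by A.card
decreasing_by exact Finset.card_erase_lt_of_mem a.2

theorem coneExtension_of_le {A : Finset ℕ} (hA : A.card ≤ k + 1) :
    coneExtension k γ A = push Sum.inl (γ A) := by
  rw [coneExtension, if_pos hA]

theorem coneExtension_of_gt {A : Finset ℕ} (hA : ¬ A.card ≤ k + 1) :
    coneExtension k γ A = cone (Sum.inr A) (∑ a ∈ A, coneExtension k γ (A.erase a)) := by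
  rw [coneExtension, if_neg hA]
  rw [Finset.sum_attach A fun a => coneExtension k γ (A.erase a)]

variable {k γ} {S : Finset ℕ}

theorem bd_coneExtension
    (hbd : ∀ A ⊆ S, A.card ≤ k + 1 → bd (γ A) = ∑ a ∈ A, γ (A.erase a)) (A : Finset ℕ)
    (hA : A ⊆ S) : bd (coneExtension k γ A) = ∑ a ∈ A, coneExtension k γ (A.erase a) := by
  induction A using Finset.strongInduction with
  | H A ih =>
    by_cases h : A.card ≤ k + 1
    · rw [coneExtension_of_le k γ h, bd_push, hbd A hA h, map_sum]
      refine Finset.sum_congr rfl fun a ha => ?_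
      rw [coneExtension_of_le]
      exact (Finset.card_erase_le).trans h
    · rw [coneExtension_of_gt k γ h, bd_cone, map_sum]
      refine add_eq_left.2 ?_
      rw [Finset.sum_congr rfl fun a ha => ih _ (Finset.erase_ssubset ha)
        ((Finset.erase_subset _ _).trans hA),
        sum_sum_erase_eq_zero A (fun a b => coneExtension k γ ((A.erase a).erase b)), map_zero]
      intro a b
      rw [Finset.erase_right_comm]

theorem card_of_mem_support_coneExtension
    (hcard : ∀ A ⊆ S, A.card ≤ k + 1 → ∀ U ∈ (γ A).support, U.card = A.card) (A : Finset ℕ)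
    (hA : A ⊆ S) : ∀ U ∈ (coneExtension k γ A).support, U.card = A.card := by
  classical
  induction A using Finset.strongInduction with
  | H A ih =>
    intro U hU
    by_cases h : A.card ≤ k + 1
    · rw [coneExtension_of_le k γ h] at hU
      obtain ⟨U₀, hU₀, hinj, rfl⟩ := mem_support_push hU
      rw [← hcard A hA h U₀ hU₀]
      exact Finset.card_image_of_injOn hinj
    · rw [coneExtension_of_gt k γ h] at hU
      obtain ⟨U₀, hU₀, hn, rfl⟩ := mem_support_cone hU
      obtain ⟨a, ha, hU₀⟩ := mem_support_sum hU₀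
      have := ih _ (Finset.erase_ssubset ha) ((Finset.erase_subset _ _).trans hA) _ hU₀
      have h2 := Finset.card_insert_of_notMem hn
      have h3 := Finset.card_erase_add_one ha
      rw [← h3, ← this, ← h2]

theorem exists_of_mem_support_coneExtension (A : Finset ℕ) :
    ∀ U ∈ (coneExtension k γ A).support,
      (∃ A₀ ⊆ A, A₀.card ≤ k + 1 ∧ ∃ U₀ ∈ (γ A₀).support, ∀ x, Sum.inl x ∈ U → x ∈ U₀) ∧
      ∀ B, Sum.inr B ∈ U → B ⊆ A ∧ B.Nonempty := by
  classical
  induction A using Finset.strongInduction with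
  | H A ih =>
    intro U hU
    by_cases h : A.card ≤ k + 1
    · rw [coneExtension_of_le k γ h] at hU
      obtain ⟨U₀, hU₀, hinj, rfl⟩ := mem_support_push hU
      exact ⟨⟨A, subset_rfl, h, U₀, hU₀, fun x hx => by simpa using hx⟩,
        fun B hB => by simp at hB⟩
    · rw [coneExtension_of_gt k γ h] at hU
      obtain ⟨U₀, hU₀, hn, rfl⟩ := mem_support_cone hU
      obtain ⟨a, ha, hU₀⟩ := mem_support_sum hU₀
      obtain ⟨⟨A₀, hA₀, hc, U₁, hU₁, hx⟩, hB⟩ := ih _ (Finset.erase_ssubset ha) _ hU₀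
      refine ⟨⟨A₀, hA₀.trans (Finset.erase_subset _ _), hc, U₁, hU₁, fun x hx' => hx x ?_⟩,
        fun B hB' => ?_⟩
      · simpa using hx'
      · rcases Finset.mem_insert.1 hB' with h' | h'
        · cases h'
          exact ⟨subset_rfl, ⟨a, ha⟩⟩
        · exact ⟨(hB B h').1.trans (Finset.erase_subset _ _), (hB B h').2⟩

end Extension

section VanKampenFlores

/-- Affine lift of points and cone vertices: a homogenizing coordinate, a height coordinate, and
the coordinates of the point. -/
noncomputable def affineLift {d : ℕ} : (Fin d → ℝ) ⊕ Finset ℕ → ℕ → ℝ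
  | _, 0 => 1
  | Sum.inl _, 1 => 0
  | Sum.inr _, 1 => 1
  | Sum.inl x, l + 2 => if h : l < d then x ⟨l, h⟩ else 0
  | Sum.inr _, _ + 2 => 0

/-- The linear functional on lifted points given by an affine functional and a height slope. -/
noncomputable def liftFunctional {d : ℕ} (w : Fin d → ℝ) (c H : ℝ) : ℕ → ℝ
  | 0 => c
  | 1 => H
  | l + 2 => if h : l < d then w ⟨l, h⟩ else 0

theorem sum_liftFunctional_inl {d k : ℕ} (hdk : d ≤ 2 * k) (w : Fin d → ℝ) (c H : ℝ)
    (x : Fin d → ℝ) : ∑ l ∈ Finset.range (2 * k + 2), liftFunctional w c H l *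
      affineLift (Sum.inl x) l = c + ∑ l, w l * x l := by
  rw [Finset.sum_range_succ', Finset.sum_range_succ']
  have : ∑ l, w l * x l = ∑ l ∈ Finset.range d, liftFunctional w c H (l + 1 + 1) *
      affineLift (Sum.inl x) (l + 1 + 1) := by
    rw [Finset.sum_range]
    exact Finset.sum_congr rfl fun l _ => by simp [liftFunctional, affineLift]
  rw [this, Finset.sum_subset (Finset.range_subset_range.2 hdk)]
  · simp [liftFunctional, affineLift]
    ring
  · intro l _ hl
    simp only [Finset.mem_range] at hl
    simp [liftFunctional, hl]

theorem sum_liftFunctional_inr {d k : ℕ} (w : Fin d → ℝ) (c H : ℝ) (B : Finset ℕ) :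
    ∑ l ∈ Finset.range (2 * k + 2), liftFunctional w c H l * affineLift (d := d) (Sum.inr B) l =
      c + H := by
  rw [Finset.sum_range_succ', Finset.sum_range_succ']
  simp [liftFunctional, affineLift]
  ring

/-- A chain-level van Kampen–Flores theorem. -/
theorem false_of_separated_chainMap {d k : ℕ} (hdk : d ≤ 2 * k)
    (γ : Finset ℕ → SimpChain (Fin d → ℝ)) (h0 : γ ∅ = Finsupp.single ∅ 1)
    (hbd : ∀ A ⊆ Finset.range (2 * k + 3), A.card ≤ k + 1 → bd (γ A) = ∑ a ∈ A, γ (A.erase a))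
    (hcard : ∀ A ⊆ Finset.range (2 * k + 3), A.card ≤ k + 1 → ∀ U ∈ (γ A).support,
      U.card = A.card)
    (hsep : ∀ A ⊆ Finset.range (2 * k + 3), A.card ≤ k + 1 →
      ∀ B ⊆ Finset.range (2 * k + 3), B.card ≤ k + 1 → Disjoint A B →
      ∀ U ∈ (γ A).support, ∀ U' ∈ (γ B).support, ∃ (w : Fin d → ℝ) (c : ℝ),
        (∀ x ∈ U, 0 < c + ∑ l, w l * x l) ∧ ∀ x ∈ U', c + ∑ l, w l * x l < 0) : False := by
  classical
  set R := Finset.range (2 * k + 3) with hR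
  let γ' := coneExtension k γ
  let V₀ : Finset ((Fin d → ℝ) ⊕ Finset ℕ) := R.powerset.biUnion fun A => (γ' A).support.biUnion id
  have hV₀ : ∀ A ⊆ R, ∀ U ∈ (γ' A).support, U ⊆ V₀ := fun A hA U hU v hv =>
    Finset.mem_biUnion.2 ⟨A, Finset.mem_powerset.2 hA, Finset.mem_biUnion.2 ⟨U, hU, hv⟩⟩
  let s : (Fin d → ℝ) ⊕ Finset ℕ → ℝ := fun v =>
    if h : v ∈ V₀ then ((V₀.equivFin ⟨v, h⟩ : ℕ) : ℝ) else 0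
  have hs : Set.InjOn s V₀ := by
    intro v hv w hw h
    simp only [s, dif_pos (Finset.mem_coe.1 hv), dif_pos (Finset.mem_coe.1 hw), Nat.cast_inj] at h
    simpa using V₀.equivFin.injective (Fin.ext h)
  have hcard' := card_of_mem_support_coneExtension hcard
  have hnopos : ∀ A ⊆ R, ∀ B ⊆ R, Disjoint A B → A ∪ B = R → ∀ U ∈ (γ' A).support,
      ∀ U' ∈ (γ' B).support, ∀ᶠ t in nhdsWithin (0 : ℝ) {0}ᶜ,
      ¬ PosDep (antipodal fun v l => affineLift v l + t * s v ^ l) (2 * k + 2)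
        (U.disjSum U') := by
    intro A hA B hB hAB hABR U hU U' hU'
    refine (nhdsWithin_le_nhds :
      nhdsWithin (0 : ℝ) {0}ᶜ ≤ nhds 0) ?_
    have hsum : A.card + B.card = 2 * k + 3 := by
      rw [← Finset.card_union_of_disjoint hAB, hABR, hR, Finset.card_range]
    have hne : (U.disjSum U').Nonempty := by
      rw [← Finset.card_pos, Finset.card_disjSum, hcard' A hA U hU, hcard' B hB U' hU']
      omega
    obtain ⟨⟨A₀, hA₀, hAc, U₀, hU₀, hx⟩, -⟩ := exists_of_mem_support_coneExtension A U hU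
    obtain ⟨⟨B₀, hB₀, hBc, U₀', hU₀', hx'⟩, -⟩ := exists_of_mem_support_coneExtension B U' hU'
    obtain ⟨w, c, hw, hw'⟩ := hsep A₀ (hA₀.trans hA) hAc B₀ (hB₀.trans hB) hBc
      (Finset.disjoint_of_subset_left hA₀ (Finset.disjoint_of_subset_right hB₀ hAB))
      U₀ hU₀ U₀' hU₀'
    rcases (show A.card ≤ k + 1 ∨ B.card ≤ k + 1 by omega) with h | h
    · have hUl : ∀ C, Sum.inr C ∉ U := by
        simp only [γ'] at hU
        rw [coneExtension_of_le k γ h] at hU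
        obtain ⟨U₁, -, -, rfl⟩ := mem_support_push hU
        simp
      refine eventually_not_posDep _ s hne (liftFunctional w c (-1 - |c|)) ?_ ?_
      · rintro (x | C) hv
        · rw [sum_liftFunctional_inl hdk]
          exact hw x (hx x hv)
        · exact absurd hv (hUl C)
      · rintro (x | C) hv
        · rw [sum_liftFunctional_inl hdk]
          exact hw' x (hx' x hv)
        · rw [sum_liftFunctional_inr]
          linarith [le_abs_self c]
    · have hUl : ∀ C, Sum.inr C ∉ U' := by
        simp only [γ'] at hU'
        rw [coneExtension_of_le k γ h] at hU'
        obtain ⟨U₁, -, -, rfl⟩ := mem_support_push hU'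
        simp
      refine eventually_not_posDep _ s hne (liftFunctional w c (1 + |c|)) ?_ ?_
      · rintro (x | C) hv
        · rw [sum_liftFunctional_inl hdk]
          exact hw x (hx x hv)
        · rw [sum_liftFunctional_inr]
          linarith [neg_abs_le c]
      · rintro (x | C) hv
        · rw [sum_liftFunctional_inl hdk]
          exact hw' x (hx' x hv)
        · exact absurd hv (hUl C)
  have hdisj : ∀ A ⊆ R, ∀ B ⊆ R, Disjoint A B → ∀ U ∈ (γ' A).support,
      ∀ U' ∈ (γ' B).support, Disjoint U U' := by
    intro A hA B hB hAB U hU U' hU'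
    obtain ⟨⟨A₀, hA₀, hAc, U₀, hU₀, hx⟩, hr⟩ := exists_of_mem_support_coneExtension A U hU
    obtain ⟨⟨B₀, hB₀, hBc, U₀', hU₀', hx'⟩, hr'⟩ := exists_of_mem_support_coneExtension B U' hU'
    obtain ⟨w, c, hw, hw'⟩ := hsep A₀ (hA₀.trans hA) hAc B₀ (hB₀.trans hB) hBc
      (Finset.disjoint_of_subset_left hA₀ (Finset.disjoint_of_subset_right hB₀ hAB))
      U₀ hU₀ U₀' hU₀'
    rw [Finset.disjoint_left]
    rintro (x | C) hv hv'
    · exact lt_asymm (hw x (hx x hv)) (hw' x (hx' x hv'))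
    · obtain ⟨a, ha⟩ := (hr C hv).2
      exact Finset.disjoint_left.1 hAB ((hr C hv).1 ha) ((hr' C hv').1 ha)
  have hev : ∀ᶠ t in nhdsWithin (0 : ℝ) {0}ᶜ, ∀ A ∈ R.powerset, ∀ B ∈ R.powerset,
      ∀ U ∈ (γ' A).support, ∀ U' ∈ (γ' B).support, Disjoint A B → A ∪ B = R →
      ¬ PosDep (antipodal fun v l => affineLift v l + t * s v ^ l) (2 * k + 2)
        (U.disjSum U') := by
    refine (Filter.eventually_all_finset _).2 fun A hA => (Filter.eventually_all_finset _).2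
      fun B hB => (Filter.eventually_all_finset _).2 fun U hU => (Filter.eventually_all_finset _).2
      fun U' hU' => ?_
    by_cases h : Disjoint A B ∧ A ∪ B = R
    · filter_upwards [hnopos A (Finset.mem_powerset.1 hA) B (Finset.mem_powerset.1 hB) h.1 h.2 U hU
        U' hU'] with t ht _ _
      exact ht
    · exact Filter.Eventually.of_forall fun t h1 h2 => absurd ⟨h1, h2⟩ h
  obtain ⟨t, ht, hgen⟩ := (hev.and (eventually_genericOn affineLift s V₀ hs (2 * k + 3))).exists
  obtain ⟨A, B, hAB, hABR, U, hU, U', hU', hpos⟩ := exists_posDep_of_chainMap γ'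
    (fun v l => affineLift v l + t * s v ^ l) (M := 2 * k + 2)
    (by
      simp only [γ']
      rw [coneExtension_of_le k γ (by simp), h0, push_single]
      simp)
    (bd_coneExtension hbd) hcard'
    (fun A hA B hB hAB U hU U' hU' => hgen.antipodal (hV₀ A hA U hU) (hV₀ B hB U' hU')
      (hdisj A hA B hB hAB U hU U' hU'))
  refine ht A (Finset.mem_powerset.2 ?_) B (Finset.mem_powerset.2 ?_) U hU U' hU' hAB hABR hpos
  · rw [hR, ← hABR]; exact Finset.subset_union_left
  · rw [hR, ← hABR]; exact Finset.subset_union_right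

end VanKampenFlores

namespace SimpChain

section Subdivision

variable {E F : Type*} [NormedAddCommGroup E] [NormedSpace ℝ E] [NormedAddCommGroup F]
  [NormedSpace ℝ F]

/-- The barycenter of a finite set. -/
noncomputable def bary (A : Finset E) : E := (A.card : ℝ)⁻¹ • ∑ a ∈ A, a

theorem bary_image {L : E →ₗ[ℝ] F} (hL : Function.Injective L) [DecidableEq F] (A : Finset E) :
    bary (A.image L) = L (bary A) := by
  rw [bary, bary, Finset.card_image_of_injective _ hL, Finset.sum_image hL.injOn, map_smul, map_sum]

theorem dist_bary_le {A : Finset E} {D : ℝ} (hD : ∀ x ∈ A, ∀ y ∈ A, dist x y ≤ D) {v : E}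
    (hv : v ∈ A) : dist v (bary A) ≤ (1 - (A.card : ℝ)⁻¹) * D := by
  classical
  have h0 : (0 : ℝ) < A.card := by exact_mod_cast Finset.card_pos.2 ⟨v, hv⟩
  have h1 : v - bary A = (A.card : ℝ)⁻¹ • ∑ a ∈ A, (v - a) := by
    rw [bary, Finset.sum_sub_distrib, Finset.sum_const, ← Nat.cast_smul_eq_nsmul ℝ, smul_sub,
      smul_smul, inv_mul_cancel₀ h0.ne', one_smul]
  have h2 : ∑ a ∈ A, (v - a) = ∑ a ∈ A.erase v, (v - a) :=
    (Finset.sum_erase _ (by simp)).symm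
  have h3 : ‖∑ a ∈ A.erase v, (v - a)‖ ≤ (A.card - 1) * D := by
    refine (norm_sum_le_of_le _ (f := fun a => v - a) (n := fun _ => D) fun a ha => ?_).trans ?_
    · rw [← dist_eq_norm]
      exact hD v hv a (Finset.mem_of_mem_erase ha)
    · rw [Finset.sum_const, Finset.card_erase_of_mem hv, nsmul_eq_mul,
        Nat.cast_pred (Finset.card_pos.2 ⟨v, hv⟩)]
  rw [dist_eq_norm, h1, h2, norm_smul, norm_inv, Real.norm_of_nonneg h0.le]
  calc (A.card : ℝ)⁻¹ * ‖∑ a ∈ A.erase v, (v - a)‖ ≤ (A.card : ℝ)⁻¹ * ((A.card - 1) * D) := by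
        gcongr
    _ = _ := by field_simp

theorem bary_mem_convexHull {A : Finset E} (hA : A.Nonempty) :
    bary A ∈ convexHull ℝ (A : Set E) := by
  have h0 : (0 : ℝ) < A.card := by exact_mod_cast Finset.card_pos.2 hA
  rw [bary, Finset.smul_sum]
  refine (convex_convexHull ℝ _).sum_mem (fun _ _ => by positivity) ?_
    fun a ha => subset_convexHull ℝ _ ha
  rw [Finset.sum_const, nsmul_eq_mul, mul_inv_cancel₀ h0.ne']

open Classical in
/-- The barycentric subdivision of a simplex. -/
noncomputable def sdSimplex (A : Finset E) : SimpChain E :=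
  if A = ∅ then Finsupp.single ∅ 1
  else cone (bary A) (∑ a ∈ A.attach, sdSimplex (A.erase a))
termination_by A.card
decreasing_by exact Finset.card_erase_lt_of_mem a.2

theorem sdSimplex_empty : sdSimplex (∅ : Finset E) = Finsupp.single ∅ 1 := by
  rw [sdSimplex, if_pos rfl]

theorem sdSimplex_of_nonempty [DecidableEq E] {A : Finset E} (hA : A.Nonempty) :
    sdSimplex A = cone (bary A) (∑ a ∈ A, sdSimplex (A.erase a)) := by
  rw [sdSimplex, if_neg hA.ne_empty]
  rw [Finset.sum_attach A fun a =>
    sdSimplex (@Finset.erase _ (fun _ _ => Classical.propDecidable _) A a)]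
  congr!

/-- Barycentric subdivision of simplicial chains. -/
noncomputable def sd : SimpChain E →ₗ[ZMod 2] SimpChain E :=
  Finsupp.linearCombination (ZMod 2) sdSimplex

theorem sd_single (A : Finset E) : sd (Finsupp.single A 1) = sdSimplex A := by
  simp [sd]

theorem bd_sdSimplex [DecidableEq E] (A : Finset E) :
    bd (sdSimplex A) = ∑ a ∈ A, sdSimplex (A.erase a) := by
  induction A using Finset.strongInduction with
  | H A ih =>
    rcases A.eq_empty_or_nonempty with rfl | h
    · rw [sdSimplex_empty, bd_single]; simp
    · rw [sdSimplex_of_nonempty h, bd_cone, map_sum]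
      refine add_eq_left.2 ?_
      rw [Finset.sum_congr rfl fun a ha => ih _ (Finset.erase_ssubset ha),
        sum_sum_erase_eq_zero A (fun a b => sdSimplex ((A.erase a).erase b)), map_zero]
      intro a b
      rw [Finset.erase_right_comm]

theorem bd_sd (c : SimpChain E) : bd (sd c) = sd (bd c) := by
  classical
  suffices h : (bd ∘ₗ sd : SimpChain E →ₗ[ZMod 2] SimpChain E) = sd ∘ₗ bd from
    LinearMap.congr_fun h c
  refine hom_ext fun A => ?_
  simp only [LinearMap.comp_apply, sd_single, bd_sdSimplex, bd_single, map_sum]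

theorem push_sdSimplex [DecidableEq F] {L : E →ₗ[ℝ] F} (hL : Function.Injective L) (A : Finset E) :
    push L (sdSimplex A) = sdSimplex (A.image L) := by
  classical
  induction A using Finset.strongInduction with
  | H A ih =>
    rcases A.eq_empty_or_nonempty with rfl | h
    · rw [sdSimplex_empty, push_single]; simp [sdSimplex_empty]
    · rw [sdSimplex_of_nonempty h, push_cone hL, sdSimplex_of_nonempty (h.image L), bary_image hL,
        map_sum, Finset.sum_image hL.injOn]
      congr 1
      refine Finset.sum_congr rfl fun a ha => ?_
      rw [ih _ (Finset.erase_ssubset ha), Finset.image_erase hL]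

theorem push_sd {L : E →ₗ[ℝ] F} (hL : Function.Injective L) (c : SimpChain E) :
    push L (sd c) = sd (push L c) := by
  classical
  suffices h : (push L ∘ₗ sd : SimpChain E →ₗ[ZMod 2] SimpChain F) = sd ∘ₗ push L from
    LinearMap.congr_fun h c
  refine hom_ext fun A => ?_
  simp only [LinearMap.comp_apply, sd_single, push_single, if_pos hL.injOn, push_sdSimplex hL]

theorem mem_support_sdSimplex {A : Finset E} {n : ℕ} {D : ℝ} (hn : A.card ≤ n)
    (hD : ∀ x ∈ A, ∀ y ∈ A, dist x y ≤ D) {U : Finset E} (hU : U ∈ (sdSimplex A).support) :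
    U.card = A.card ∧ (U : Set E) ⊆ convexHull ℝ (A : Set E) ∧
      ∀ x ∈ U, ∀ y ∈ U, dist x y ≤ (1 - (n : ℝ)⁻¹) * D := by
  classical
  induction A using Finset.strongInduction generalizing U with
  | H A ih =>
    rcases A.eq_empty_or_nonempty with rfl | h
    · rw [sdSimplex_empty] at hU
      have : U = ∅ := Finset.mem_singleton.1 (Finsupp.support_single_subset hU)
      subst this
      simp
    · rw [sdSimplex_of_nonempty h] at hU
      obtain ⟨U₀, hU₀, ho, rfl⟩ := mem_support_cone hU
      obtain ⟨a, ha, hU₀⟩ := mem_support_sum hU₀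
      obtain ⟨h1, h2, h3⟩ := ih _ (Finset.erase_ssubset ha) (Finset.card_erase_le.trans hn)
        (fun x hx y hy => hD x (Finset.mem_of_mem_erase hx) y (Finset.mem_of_mem_erase hy)) hU₀
      have h2' : (U₀ : Set E) ⊆ convexHull ℝ (A : Set E) :=
        h2.trans (convexHull_mono (by simp))
      have hD0 : 0 ≤ D := dist_nonneg.trans (hD a ha a ha)
      have h0 : (0 : ℝ) < A.card := by exact_mod_cast Finset.card_pos.2 h
      have hinv : (n : ℝ)⁻¹ ≤ (A.card : ℝ)⁻¹ := by gcongr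
      have hle : (1 - (A.card : ℝ)⁻¹) * D ≤ (1 - (n : ℝ)⁻¹) * D := by gcongr
      have hball : convexHull ℝ (A : Set E) ⊆
          Metric.closedBall (bary A) ((1 - (n : ℝ)⁻¹) * D) :=
        convexHull_min (fun v hv => (dist_bary_le hD hv).trans hle) (convex_closedBall _ _)
      refine ⟨?_, ?_, ?_⟩
      · rw [Finset.card_insert_of_notMem ho, h1, Finset.card_erase_add_one ha]
      · rw [Finset.coe_insert]
        exact Set.insert_subset (bary_mem_convexHull h) h2'
      · intro x hx y hy
        rcases Finset.mem_insert.1 hx with rfl | hx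
        · rcases Finset.mem_insert.1 hy with rfl | hy
          · exact Metric.mem_closedBall.1 (hball (bary_mem_convexHull h))
          · rw [dist_comm]
            exact Metric.mem_closedBall.1 (hball (h2' hy))
        · rcases Finset.mem_insert.1 hy with rfl | hy
          · exact Metric.mem_closedBall.1 (hball (h2' hx))
          · exact h3 x hx y hy

theorem mem_support_sd_iterate {n : ℕ} {D : ℝ} {K : Set E} (hK : Convex ℝ K) {c : SimpChain E}
    (hc : ∀ A ∈ c.support, A.card = n ∧ (A : Set E) ⊆ K ∧ ∀ x ∈ A, ∀ y ∈ A, dist x y ≤ D) (N : ℕ) :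
    ∀ U ∈ (sd^[N] c).support, U.card = n ∧ (U : Set E) ⊆ K ∧
      ∀ x ∈ U, ∀ y ∈ U, dist x y ≤ (1 - (n : ℝ)⁻¹) ^ N * D := by
  induction N with
  | zero => simpa using hc
  | succ N ih =>
    intro U hU
    rw [Function.iterate_succ_apply'] at hU
    obtain ⟨A, hA, hU⟩ := mem_support_map hU
    rw [sd_single] at hU
    obtain ⟨h1, h2, h3⟩ := ih A hA
    obtain ⟨h1', h2', h3'⟩ := mem_support_sdSimplex h1.le h3 hU
    refine ⟨h1'.trans h1, h2'.trans (convexHull_min h2 hK), fun x hx y hy => ?_⟩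
    rw [pow_succ', mul_assoc]
    exact h3' x hx y hy

theorem bd_sd_iterate (c : SimpChain E) (N : ℕ) : bd (sd^[N] c) = sd^[N] (bd c) := by
  induction N generalizing c with
  | zero => rfl
  | succ N ih => rw [Function.iterate_succ_apply, ih, bd_sd, Function.iterate_succ_apply]

theorem push_sd_iterate {L : E →ₗ[ℝ] F} (hL : Function.Injective L) (c : SimpChain E) (N : ℕ) :
    push L (sd^[N] c) = sd^[N] (push L c) := by
  induction N generalizing c with
  | zero => rfl
  | succ N ih => rw [Function.iterate_succ_apply, ih, push_sd hL, Function.iterate_succ_apply]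

end Subdivision

end SimpChain

section SingularChains

/-- Singular simplices of all dimensions `≥ -1`, graded by number of vertices. -/
abbrev SingSimplex (X : Type*) [TopologicalSpace X] := Σ i : ℕ, C(stdSimplex ℝ (Fin i), X)

/-- Augmented singular chains with coefficients in `ℤ₂`. -/
abbrev SingChain (X : Type*) [TopologicalSpace X] := SingSimplex X →₀ ZMod 2

/-- The inclusion of the face of the standard simplex opposite to the vertex `k`. -/
noncomputable def simplexFace {i : ℕ} (k : Fin (i + 1)) :
    C(stdSimplex ℝ (Fin i), stdSimplex ℝ (Fin (i + 1))) :=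
  ⟨stdSimplex.map k.succAbove, stdSimplex.continuous_map _⟩

variable {X : Type*} [TopologicalSpace X]

/-- The boundary of a singular simplex. -/
noncomputable def singSimplexBd : SingSimplex X → SingChain X
  | ⟨0, _⟩ => 0
  | ⟨i + 1, σ⟩ => ∑ k : Fin (i + 1), Finsupp.single ⟨i, σ.comp (simplexFace k)⟩ 1

/-- The boundary map on singular chains. -/
noncomputable def singBd : SingChain X →ₗ[ZMod 2] SingChain X :=
  Finsupp.linearCombination (ZMod 2) singSimplexBd

theorem singBd_single (s : SingSimplex X) : singBd (Finsupp.single s 1) = singSimplexBd s := by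
  simp [singBd]

instance isEmpty_stdSimplex_zero : IsEmpty (stdSimplex ℝ (Fin 0)) :=
  ⟨fun x => by simpa using x.2.2⟩

/-- The generator in degree `-1`. -/
noncomputable def singOne : SingChain X :=
  Finsupp.single ⟨0, ⟨isEmptyElim, continuous_of_const fun x => isEmptyElim x⟩⟩ 1

/-- Singular chains with `i` vertices in a subset. -/
noncomputable def singIn (i : ℕ) (Y : Set X) : Submodule (ZMod 2) (SingChain X) :=
  Finsupp.supported (ZMod 2) (ZMod 2) {s : SingSimplex X | s.1 = i ∧ Set.range s.2 ⊆ Y}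

theorem singIn_mono (i : ℕ) {Y Z : Set X} (h : Y ⊆ Z) : singIn i Y ≤ singIn i Z :=
  Finsupp.supported_mono fun _ hs => ⟨hs.1, hs.2.trans h⟩

variable [Zero X]

/-- Extension by zero of a singular simplex to the ambient vector space. -/
noncomputable def SingSimplex.extend (s : SingSimplex X) (x : Fin s.1 → ℝ) : X :=
  open Classical in if h : x ∈ stdSimplex ℝ (Fin s.1) then s.2 ⟨x, h⟩ else 0

theorem SingSimplex.extend_of_mem (s : SingSimplex X) {x : Fin s.1 → ℝ}
    (h : x ∈ stdSimplex ℝ (Fin s.1)) : s.extend x = s.2 ⟨x, h⟩ := dif_pos h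

/-- The vertices of the standard simplex. -/
noncomputable def stdVertices (i : ℕ) : Finset (Fin i → ℝ) :=
  Finset.univ.image fun k => Pi.single k 1

theorem single_injective (i : ℕ) :
    Function.Injective fun k : Fin i => (Pi.single k 1 : Fin i → ℝ) := by
  intro a b h
  by_contra hne
  have := congrFun h a
  simp [hne] at this

theorem card_stdVertices (i : ℕ) : (stdVertices i).card = i := by
  rw [stdVertices, Finset.card_image_of_injective _ (single_injective i), Finset.card_univ,
    Fintype.card_fin]

theorem stdVertices_subset (i : ℕ) : (stdVertices i : Set (Fin i → ℝ)) ⊆ stdSimplex ℝ (Fin i) := by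
  intro x hx
  obtain ⟨k, -, rfl⟩ := Finset.mem_image.1 (Finset.mem_coe.1 hx)
  exact single_mem_stdSimplex ℝ k

theorem dist_stdVertices_le {i : ℕ} : ∀ x ∈ stdVertices i, ∀ y ∈ stdVertices i, dist x y ≤ 1 := by
  intro x hx y hy
  obtain ⟨k, -, rfl⟩ := Finset.mem_image.1 hx
  obtain ⟨l, -, rfl⟩ := Finset.mem_image.1 hy
  refine (dist_pi_le_iff zero_le_one).2 fun m => ?_
  rw [Real.dist_eq, Pi.single_apply, Pi.single_apply]
  split_ifs <;> norm_num

theorem funOnFinite_linearMap_injective {i j : ℕ} {f : Fin i → Fin j} (hf : Function.Injective f) :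
    Function.Injective (FunOnFinite.linearMap ℝ ℝ f) := by
  intro v w h
  ext x
  have := congrFun h (f x)
  simpa [FunOnFinite.linearMap_apply_apply, hf.eq_iff, Finset.filter_eq'] using this

theorem stdVertices_erase {i : ℕ} [DecidableEq (Fin (i + 1) → ℝ)] (k : Fin (i + 1)) :
    (stdVertices (i + 1)).erase (Pi.single k 1) =
      (stdVertices i).image (FunOnFinite.linearMap ℝ ℝ k.succAbove) := by
  ext v
  simp only [stdVertices, Finset.mem_erase, Finset.mem_image, Finset.mem_univ, true_and]
  constructor
  · rintro ⟨h, l, rfl⟩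
    obtain ⟨m, rfl⟩ := Fin.exists_succAbove_eq (x := l) (y := k) (by rintro rfl; exact h rfl)
    exact ⟨_, ⟨m, rfl⟩, FunOnFinite.linearMap_piSingle _ _ _ _ _⟩
  · rintro ⟨_, ⟨m, rfl⟩, rfl⟩
    rw [FunOnFinite.linearMap_piSingle]
    refine ⟨fun h => ?_, _, rfl⟩
    exact Fin.succAbove_ne k m (single_injective (i + 1) h)

/-- The vertices of the `N`-fold barycentric subdivision of a singular simplex. -/
noncomputable def sdSingSimplex (N : ℕ) (s : SingSimplex X) : SimpChain X :=
  push s.extend (sd^[N] (Finsupp.single (stdVertices s.1) 1))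

/-- The realization of singular chains as simplicial chains by iterated subdivision. -/
noncomputable def sdSing (N : ℕ) : SingChain X →ₗ[ZMod 2] SimpChain X :=
  Finsupp.linearCombination (ZMod 2) (sdSingSimplex N)

theorem sdSing_single (N : ℕ) (s : SingSimplex X) :
    sdSing N (Finsupp.single s 1) = sdSingSimplex N s := by
  simp [sdSing]

theorem sd_iterate_sum {E ι : Type*} [NormedAddCommGroup E] [NormedSpace ℝ E] (N : ℕ)
    (t : Finset ι) (f : ι → SimpChain E) : sd^[N] (∑ a ∈ t, f a) = ∑ a ∈ t, sd^[N] (f a) := by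
  have : ∀ c : SimpChain E, sd^[N] c = ((sd : Module.End (ZMod 2) (SimpChain E)) ^ N) c :=
    fun c => (Module.End.pow_apply _ _ _).symm
  simp only [this, map_sum]

theorem sd_iterate_empty {E : Type*} [NormedAddCommGroup E] [NormedSpace ℝ E] (N : ℕ) :
    sd^[N] (Finsupp.single ∅ 1 : SimpChain E) = Finsupp.single ∅ 1 :=
  Function.iterate_fixed (by rw [sd_single, sdSimplex_empty]) N

theorem mem_support_sd_stdVertices {i N : ℕ} {U : Finset (Fin i → ℝ)}
    (hU : U ∈ (sd^[N] (Finsupp.single (stdVertices i) 1)).support) :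
    U.card = i ∧ (U : Set (Fin i → ℝ)) ⊆ stdSimplex ℝ (Fin i) ∧
      ∀ x ∈ U, ∀ y ∈ U, dist x y ≤ (1 - (i : ℝ)⁻¹) ^ N := by
  have := mem_support_sd_iterate (n := i) (D := 1) (convex_stdSimplex ℝ (Fin i))
    (c := Finsupp.single (stdVertices i) 1) (fun A hA => by
      obtain rfl := Finset.mem_singleton.1 (Finsupp.support_single_subset hA)
      exact ⟨card_stdVertices i, stdVertices_subset i, dist_stdVertices_le⟩) N U hU
  simpa using this

theorem bd_sdSingSimplex (N : ℕ) (s : SingSimplex X) :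
    bd (sdSingSimplex N s) = sdSing N (singSimplexBd s) := by
  classical
  obtain ⟨i, σ⟩ := s
  rw [sdSingSimplex, bd_push, bd_sd_iterate, bd_single, sd_iterate_sum, map_sum]
  cases i with
  | zero => simp [singSimplexBd, stdVertices]
  | succ i =>
    simp only [singSimplexBd, map_sum, sdSing_single]
    rw [stdVertices, Finset.sum_image (single_injective _).injOn]
    refine Finset.sum_congr rfl fun k _ => ?_
    have hinj := funOnFinite_linearMap_injective (f := k.succAbove) Fin.succAbove_right_injective
    have h : (Finsupp.single ((stdVertices (i + 1)).erase (Pi.single k 1)) 1 : SimpChain _) =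
        push (FunOnFinite.linearMap ℝ ℝ k.succAbove) (Finsupp.single (stdVertices i) 1) := by
      rw [push_single, if_pos hinj.injOn]
      congr 1
      convert stdVertices_erase k
    rw [stdVertices] at h
    refine (congrArg (fun c => push (SingSimplex.extend ⟨i + 1, σ⟩) (sd^[N] c))
      (?_ : _ = push (FunOnFinite.linearMap ℝ ℝ k.succAbove)
        (Finsupp.single (stdVertices i) 1))).trans ?_
    · convert h
    rw [← push_sd_iterate hinj, push_push, sdSingSimplex]
    refine push_congr fun A hA a ha => ?_
    have ha' := (mem_support_sd_stdVertices hA).2.1 ha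
    rw [SingSimplex.extend_of_mem _ ha', Function.comp_apply, SingSimplex.extend_of_mem]
    rfl

theorem bd_sdSing (N : ℕ) (c : SingChain X) : bd (sdSing N c) = sdSing N (singBd c) := by
  suffices h : (bd ∘ₗ sdSing N : SingChain X →ₗ[ZMod 2] SimpChain X) = sdSing N ∘ₗ singBd from
    LinearMap.congr_fun h c
  refine Finsupp.lhom_ext' fun s => LinearMap.ext_ring ?_
  simp only [LinearMap.comp_apply, Finsupp.lsingle_apply, sdSing_single, singBd_single,
    bd_sdSingSimplex]

theorem sdSing_singOne (N : ℕ) : sdSing N (singOne : SingChain X) = Finsupp.single ∅ 1 := by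
  rw [singOne, sdSing_single, sdSingSimplex]
  have : stdVertices 0 = ∅ := rfl
  simp only [this]
  rw [sd_iterate_empty, push_single]
  simp

theorem mem_support_sdSingSimplex {N : ℕ} {s : SingSimplex X} {U : Finset X}
    (hU : U ∈ (sdSingSimplex N s).support) : U.card = s.1 ∧ (U : Set X) ⊆ Set.range s.2 := by
  classical
  obtain ⟨A, hA, hinj, rfl⟩ := mem_support_push hU
  obtain ⟨h1, h2, -⟩ := mem_support_sd_stdVertices hA
  refine ⟨by rw [Finset.card_image_of_injOn hinj, h1], fun x hx => ?_⟩
  obtain ⟨a, ha, rfl⟩ := Finset.mem_image.1 (Finset.mem_coe.1 hx)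
  rw [SingSimplex.extend_of_mem _ (h2 ha)]
  exact ⟨_, rfl⟩

theorem mem_support_sdSing {N : ℕ} {c : SingChain X} {U : Finset X}
    (hU : U ∈ (sdSing N c).support) : ∃ s ∈ c.support, U ∈ (sdSingSimplex N s).support := by
  have : c = ∑ s ∈ c.support, Finsupp.single s 1 := by
    conv_lhs => rw [← Finsupp.sum_single c]
    refine Finset.sum_congr rfl fun A hA => ?_
    have : ∀ x : ZMod 2, x ≠ 0 → x = 1 := by decide
    rw [this _ (Finsupp.mem_support_iff.1 hA)]
  rw [this, map_sum] at hU
  obtain ⟨s, hs, h⟩ := mem_support_sum hU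
  rw [sdSing_single] at h
  exact ⟨s, hs, h⟩

end SingularChains

section Separation

open Filter Topology

theorem eventually_dist_lt {X : Type*} [PseudoMetricSpace X] [Zero X] (s : SingSimplex X) {ε : ℝ}
    (hε : 0 < ε) : ∀ᶠ N in atTop, ∀ U ∈ (sdSingSimplex N s).support, ∀ x ∈ U, ∀ y ∈ U,
      dist x y < ε := by
  classical
  have huc : UniformContinuous s.2 :=
    CompactSpace.uniformContinuous_of_continuous s.2.continuous
  obtain ⟨δ, hδ, h⟩ := Metric.uniformContinuous_iff.1 huc ε hε
  have hlim : ∀ᶠ N in atTop, s.1 = 0 ∨ (1 - (s.1 : ℝ)⁻¹) ^ N < δ := by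
    rcases Nat.eq_zero_or_pos s.1 with h0 | h0
    · exact Eventually.of_forall fun _ => Or.inl h0
    · have h1 : (1 : ℝ) ≤ s.1 := by exact_mod_cast h0
      have h2 : (s.1 : ℝ)⁻¹ ≤ 1 := inv_le_one_of_one_le₀ h1
      have h3 : 0 < (s.1 : ℝ)⁻¹ := by positivity
      have := tendsto_pow_atTop_nhds_zero_of_lt_one (r := 1 - (s.1 : ℝ)⁻¹) (by linarith)
        (by linarith)
      filter_upwards [this.eventually_lt_const hδ] with N hN using Or.inr hN
  filter_upwards [hlim] with N hN U hU x hx y hy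
  obtain ⟨A, hA, hinj, rfl⟩ := mem_support_push hU
  obtain ⟨h1, h2, h3⟩ := mem_support_sd_stdVertices hA
  obtain ⟨a, ha, rfl⟩ := Finset.mem_image.1 hx
  obtain ⟨b, hb, rfl⟩ := Finset.mem_image.1 hy
  rw [SingSimplex.extend_of_mem _ (h2 ha), SingSimplex.extend_of_mem _ (h2 hb)]
  rcases hN with hN | hN
  · rw [← h1, Finset.card_eq_zero] at hN
    simp [hN] at ha
  · exact h ((h3 a ha b hb).trans_lt hN)

/-- Two finite sets of small diameter at larger distance are separated by a hyperplane. -/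
theorem exists_separating {d : ℕ} {U U' : Finset (Fin d → ℝ)} {δ : ℝ} (hδ : 0 < δ)
    (hU : ∀ x ∈ U, ∀ y ∈ U, dist x y < δ / 3) (hU' : ∀ x ∈ U', ∀ y ∈ U', dist x y < δ / 3)
    (hUU' : ∀ x ∈ U, ∀ y ∈ U', δ ≤ dist x y) :
    ∃ (w : Fin d → ℝ) (c : ℝ),
        (∀ x ∈ U, 0 < c + ∑ l, w l * x l) ∧ ∀ x ∈ U', c + ∑ l, w l * x l < 0 := by
  rcases U.eq_empty_or_nonempty with rfl | ⟨p, hp⟩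
  · exact ⟨0, -1, by simp, by simp⟩
  rcases U'.eq_empty_or_nonempty with rfl | ⟨q, hq⟩
  · exact ⟨0, 1, by simp, by simp⟩
  obtain ⟨l, hl⟩ : ∃ l, δ ≤ |p l - q l| := by
    by_contra! h
    exact ((dist_pi_lt_iff hδ).2 h).not_ge (hUU' p hp q hq)
  have hs : ∀ (a : ℝ) (x : Fin d → ℝ), ∑ m, (Pi.single l a : Fin d → ℝ) m * x m = a * x l := by
    intro a x
    rw [Finset.sum_eq_single l] <;> simp +contextual
  have h1 : ∀ x ∈ U, |x l - p l| < δ / 3 := fun x hx =>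
    (dist_le_pi_dist x p l).trans_lt (hU x hx p hp)
  have h2 : ∀ x ∈ U', |x l - q l| < δ / 3 := fun x hx =>
    (dist_le_pi_dist x q l).trans_lt (hU' x hx q hq)
  rcases le_abs.1 hl with h | h
  · refine ⟨Pi.single l 1, -(p l + q l) / 2, fun x hx => ?_, fun x hx => ?_⟩
    · rw [hs]; linarith [(abs_lt.1 (h1 x hx)).1]
    · rw [hs]; linarith [(abs_lt.1 (h2 x hx)).2]
  · refine ⟨Pi.single l (-1), (p l + q l) / 2, fun x hx => ?_, fun x hx => ?_⟩
    · rw [hs]; linarith [(abs_lt.1 (h1 x hx)).2]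
    · rw [hs]; linarith [(abs_lt.1 (h2 x hx)).1]

/-- A van Kampen–Flores theorem for singular chains: pairwise disjoint simplices cannot be mapped to
singular chains with disjoint carriers. -/
theorem false_of_disjoint_singChains {d k : ℕ} (hdk : d ≤ 2 * k)
    (γ : Finset ℕ → SingChain (Fin d → ℝ)) (Y : Finset ℕ → Set (Fin d → ℝ)) (h0 : γ ∅ = singOne)
    (hmem : ∀ A ⊆ Finset.range (2 * k + 3), A.card ≤ k + 1 → γ A ∈ singIn A.card (Y A))
    (hbd : ∀ A ⊆ Finset.range (2 * k + 3), A.card ≤ k + 1 → A.Nonempty →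
      singBd (γ A) = ∑ a ∈ A, γ (A.erase a))
    (hY : ∀ A ⊆ Finset.range (2 * k + 3), A.card ≤ k + 1 →
      ∀ B ⊆ Finset.range (2 * k + 3), B.card ≤ k + 1 → Disjoint A B → Disjoint (Y A) (Y B)) :
    False := by
  classical
  set R := Finset.range (2 * k + 3) with hR
  have hsupp : ∀ A ⊆ R, A.card ≤ k + 1 → ∀ s ∈ (γ A).support, s.1 = A.card ∧
      Set.range s.2 ⊆ Y A := fun A hA hAc s hs =>
    (Finsupp.mem_supported (ZMod 2) (γ A)).1 (hmem A hA hAc) hs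
  have hpair : ∀ A ∈ R.powerset, ∀ B ∈ R.powerset, ∀ᶠ N in atTop, A.card ≤ k + 1 →
      B.card ≤ k + 1 → Disjoint A B → ∀ U ∈ (sdSing N (γ A)).support,
      ∀ U' ∈ (sdSing N (γ B)).support, ∃ (w : Fin d → ℝ) (c : ℝ),
        (∀ x ∈ U, 0 < c + ∑ l, w l * x l) ∧ ∀ x ∈ U', c + ∑ l, w l * x l < 0 := by
    intro A hA B hB
    rw [Finset.mem_powerset] at hA hB
    by_cases h : A.card ≤ k + 1 ∧ B.card ≤ k + 1 ∧ Disjoint A B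
    swap
    · exact Eventually.of_forall fun N h1 h2 h3 => absurd ⟨h1, h2, h3⟩ h
    obtain ⟨hAc, hBc, hAB⟩ := h
    let K : Finset ℕ → Set (Fin d → ℝ) := fun C => ⋃ s ∈ (γ C).support, Set.range s.2
    have hK : ∀ C, IsCompact (K C) := fun C =>
      (γ C).support.isCompact_biUnion fun s _ => isCompact_range s.2.continuous
    have hKY : ∀ C ⊆ R, C.card ≤ k + 1 → K C ⊆ Y C := fun C hC hCc =>
      Set.iUnion₂_subset fun s hs => (hsupp C hC hCc s hs).2
    obtain ⟨δ, hδ, hd⟩ := Metric.exists_pos_forall_lt_edist (hK A) (hK B).isClosed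
      ((hY A hA hAc B hB hBc hAB).mono (hKY A hA hAc) (hKY B hB hBc))
    have hδ3 : (0 : ℝ) < δ / 3 := by positivity
    filter_upwards [(eventually_all_finset (γ A).support).2 fun s _ => eventually_dist_lt s hδ3,
      (eventually_all_finset (γ B).support).2 fun s _ => eventually_dist_lt s hδ3]
      with N hNA hNB _ _ _ U hU U' hU'
    obtain ⟨s, hs, hU⟩ := mem_support_sdSing hU
    obtain ⟨s', hs', hU'⟩ := mem_support_sdSing hU'
    refine exists_separating (δ := δ) (by positivity) (hNA s hs U hU) (hNB s' hs' U' hU')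
      fun x hx y hy => ?_
    have := hd x (Set.mem_biUnion hs ((mem_support_sdSingSimplex hU).2 hx)) y
      (Set.mem_biUnion hs' ((mem_support_sdSingSimplex hU').2 hy))
    rw [edist_nndist, ENNReal.coe_lt_coe] at this
    exact_mod_cast this.le
  obtain ⟨N, hN⟩ := ((eventually_all_finset R.powerset).2 fun A hA =>
    (eventually_all_finset R.powerset).2 fun B hB => hpair A hA B hB).exists
  refine false_of_separated_chainMap hdk (fun A => sdSing N (γ A)) ?_ ?_ ?_ ?_
  · simp only [h0, sdSing_singOne]
  · intro A hA hAc
    rcases A.eq_empty_or_nonempty with rfl | hne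
    · simp only [h0, sdSing_singOne, bd_single, Finset.sum_empty]
    · simp only [bd_sdSing, hbd A hA hAc hne, map_sum]
  · intro A hA hAc U hU
    obtain ⟨s, hs, hU⟩ := mem_support_sdSing hU
    rw [(mem_support_sdSingSimplex hU).1, (hsupp A hA hAc s hs).1]
  · intro A hA hAc B hB hBc hAB
    exact hN A (Finset.mem_powerset.2 hA) B (Finset.mem_powerset.2 hB) hAc hBc hAB

end Separation

theorem exists_coloring_of_rank_le {V : Type} [AddCommGroup V] [Module (ZMod 2) V] {b : ℕ}
    (h : Module.rank (ZMod 2) V ≤ b) : ∃ κ : V → Fin (2 ^ (b + 1)), Function.Injective κ := by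
  have hfin : Module.Finite (ZMod 2) V :=
    Module.rank_lt_aleph0_iff.1 (h.trans_lt (Cardinal.natCast_lt_aleph0))
  have : Finite V := Module.finite_of_finite (ZMod 2)
  have := Fintype.ofFinite V
  have hb : Module.finrank (ZMod 2) V ≤ b := Module.finrank_le_of_rank_le h
  have hc : Fintype.card V ≤ Fintype.card (Fin (2 ^ (b + 1))) := by
    rw [← Nat.card_eq_fintype_card, Module.natCard_eq_pow_finrank (K := ZMod 2), Nat.card_zmod,
      Fintype.card_fin]
    exact Nat.pow_le_pow_right two_pos (hb.trans b.le_succ)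
  obtain ⟨f⟩ := Function.Embedding.nonempty_of_card_le hc
  exact ⟨f, f.injective⟩

/-- Cycles in a complex of `ℤ₂`-vector spaces are classified up to boundaries by
finitely many colors if the homology has bounded rank. -/
theorem exists_cycle_coloring (C : ChainComplex (ModuleCat.{0} (ZMod 2)) ℕ) (j b : ℕ)
    (h : Module.rank (ZMod 2) (C.homology (j + 1)) ≤ b) :
    ∃ κ : C.X (j + 1) → Fin (2 ^ (b + 1)), ∀ x y, C.d (j + 1) j x = 0 → C.d (j + 1) j y = 0 →
      κ x = κ y → ∃ e, C.d (j + 2) (j + 1) e = x - y := by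
  classical
  let S := C.sc' (j + 2) (j + 1) j
  let i : C.homology (j + 1) ≅ S.moduleCatLeftHomologyData.H :=
    ShortComplex.homologyMapIso (C.isoSc' (j + 2) (j + 1) j (by simp) (by simp)) ≪≫
      S.moduleCatHomologyIso
  obtain ⟨κ, hκ⟩ := exists_coloring_of_rank_le (V := S.moduleCatLeftHomologyData.H)
    (i.toLinearEquiv.rank_eq.symm.trans_le h)
  let c : LinearMap.ker S.g.hom → S.moduleCatLeftHomologyData.H :=
    (LinearMap.range S.moduleCatToCycles).mkQ
  refine ⟨fun x => if hx : C.d (j + 1) j x = 0 then κ (c ⟨x, hx⟩) else 0, fun x y hx hy hxy => ?_⟩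
  simp only [dif_pos hx, dif_pos hy] at hxy
  obtain ⟨e, he⟩ := (Submodule.Quotient.eq _).1 (hκ hxy)
  exact ⟨e, congrArg Subtype.val he⟩

section Comparison

variable {X : Type} [TopologicalSpace X] (Y : Set X)

/-- The complex computing the singular homology of a subspace. -/
noncomputable abbrev singComplex : ChainComplex (ModuleCat.{0} (ZMod 2)) ℕ :=
  (alternatingFaceMapComplex (ModuleCat (ZMod 2))).obj
    (((SimplicialObject.whiskering _ _).obj (ModuleCat.free (ZMod 2))).obj
      (TopCat.toSSet.obj (TopCat.of Y)))

/-- A singular simplex of a subspace as a singular simplex of the whole space. -/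
noncomputable def singInclSimplex (n : ℕ)
    (s : (TopCat.toSSet.obj (TopCat.of Y)).obj (Opposite.op (SimplexCategory.mk n))) :
    SingSimplex X :=
  ⟨n + 1, (⟨Subtype.val, continuous_subtype_val⟩ : C(Y, X)).comp (TopCat.toSSetObjEquiv _ _ s)⟩

/-- The inclusion of the singular chains of a subspace. -/
noncomputable def singIncl (n : ℕ) : (singComplex Y).X n →ₗ[ZMod 2] SingChain X :=
  Finsupp.lmapDomain (ZMod 2) (ZMod 2) (singInclSimplex Y n)

theorem singInclSimplex_injective (n : ℕ) : Function.Injective (singInclSimplex Y n) := by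
  intro s t h
  have h1 := eq_of_heq (Sigma.mk.inj h).2
  refine (TopCat.toSSetObjEquiv _ _).injective (ContinuousMap.ext fun x => Subtype.ext ?_)
  exact DFunLike.congr_fun h1 x

theorem singIncl_injective (n : ℕ) : Function.Injective (singIncl Y n) :=
  Finsupp.mapDomain_injective (singInclSimplex_injective Y n)

theorem singIncl_mem (n : ℕ) (x : (singComplex Y).X n) : singIncl Y n x ∈ singIn (n + 1) Y := by
  classical
  refine (Finsupp.mem_supported _ _).2 fun s hs => ?_
  obtain ⟨t, -, rfl⟩ := Finset.mem_image.1 (Finsupp.mapDomain_support hs)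
  refine ⟨rfl, ?_⟩
  rintro _ ⟨x, rfl⟩
  exact Subtype.prop _

theorem exists_singIncl_eq {n : ℕ} {z : SingChain X} (hz : z ∈ singIn (n + 1) Y) :
    ∃ x, singIncl Y n x = z := by
  have h : singIn (n + 1) Y ≤ LinearMap.range (singIncl Y n) := by
    rw [singIn, Finsupp.supported_eq_span_single, Submodule.span_le]
    rintro _ ⟨⟨m, σ⟩, ⟨hm, hs⟩, rfl⟩
    obtain rfl : m = n + 1 := hm
    refine ⟨Finsupp.single ((TopCat.toSSetObjEquiv _ _).symm
      (⟨fun x => ⟨σ x, hs ⟨x, rfl⟩⟩, by fun_prop⟩ : C(stdSimplex ℝ (Fin (n + 1)), Y))) 1, ?_⟩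
    refine Finsupp.mapDomain_single.trans ?_
    rw [singInclSimplex, Equiv.apply_symm_apply]
    rfl
  exact h hz

theorem neg_one_pow_zsmul {V : Type*} [AddCommGroup V] [Module (ZMod 2) V] (k : ℕ) (v : V) :
    (-1 : ℤ) ^ k • v = v := by
  rw [← Int.cast_smul_eq_zsmul (ZMod 2)]
  simp [show (-1 : ZMod 2) = 1 from rfl]

theorem freeComplex_d_single (S : SSet.{0}) (n : ℕ)
    (s : S.obj (Opposite.op (SimplexCategory.mk (n + 1)))) :
    ((alternatingFaceMapComplex (ModuleCat (ZMod 2))).obj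
      (((SimplicialObject.whiskering _ _).obj (ModuleCat.free (ZMod 2))).obj S)).d (n + 1) n
      (ModuleCat.freeMk s) = ∑ k : Fin (n + 2), ModuleCat.freeMk (S.δ k s) := by
  rw [alternatingFaceMapComplex_obj_d]
  simp only [AlternatingFaceMapComplex.objD, ModuleCat.hom_sum]
  refine (LinearMap.sum_apply _ _ _).trans (Finset.sum_congr rfl fun k _ => ?_)
  rw [ModuleCat.hom_zsmul, neg_one_pow_zsmul]
  exact ModuleCat.free_map_apply _ _

theorem singBd_singIncl (n : ℕ) (x : (singComplex Y).X (n + 1)) :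
    singBd (singIncl Y (n + 1) x) = singIncl Y n ((singComplex Y).d (n + 1) n x) := by
  let L : ((TopCat.toSSet.obj (TopCat.of Y)).obj (Opposite.op (SimplexCategory.mk (n + 1))) →₀
      ZMod 2) →ₗ[ZMod 2] SingChain X := singBd ∘ₗ singIncl Y (n + 1)
  let L' : ((TopCat.toSSet.obj (TopCat.of Y)).obj (Opposite.op (SimplexCategory.mk (n + 1))) →₀
      ZMod 2) →ₗ[ZMod 2] SingChain X :=
    singIncl Y n ∘ₗ ((singComplex Y).d (n + 1) n).hom
  suffices h : L = L' from LinearMap.congr_fun h x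
  refine Finsupp.lhom_ext' fun s => LinearMap.ext_ring ?_
  have h1 : singIncl Y (n + 1) (Finsupp.single s 1) = Finsupp.single (singInclSimplex Y _ s) 1 :=
    Finsupp.mapDomain_single
  refine (congrArg singBd h1).trans ((singBd_single _).trans ?_)
  refine .trans ?_ (congrArg (singIncl Y n) (freeComplex_d_single _ n s)).symm
  refine .trans ?_ (map_sum (singIncl Y n) _ _).symm
  refine Finset.sum_congr rfl fun k _ => ?_
  refine .trans ?_ Finsupp.mapDomain_single.symm
  rfl

end Comparison

section Filling

variable {X : Type} [TopologicalSpace X] {Y : Set X}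

theorem exists_filling_of_rank_le {j b : ℕ}
    (h : Module.rank (ZMod 2) (SingularHomology (ZMod 2) Y (j + 1)) ≤ b) :
    ∃ κ : SingChain X → Fin (2 ^ (b + 1)), ∀ z ∈ singIn (j + 2) Y, ∀ z' ∈ singIn (j + 2) Y,
      singBd z = 0 → singBd z' = 0 → κ z = κ z' → ∃ e ∈ singIn (j + 3) Y, singBd e = z + z' := by
  obtain ⟨κ, hκ⟩ := exists_cycle_coloring (singComplex Y) j b h
  refine ⟨fun z => κ (Function.invFun (singIncl Y (j + 1)) z), fun z hz z' hz' h0 h0' he => ?_⟩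
  have hker : ∀ x, singBd (singIncl Y (j + 1) x) = 0 → (singComplex Y).d (j + 1) j x = 0 :=
    fun x hx => singIncl_injective Y j
      ((singBd_singIncl Y j x).symm.trans (hx.trans (map_zero (singIncl Y j)).symm))
  obtain ⟨x, rfl⟩ := exists_singIncl_eq Y hz
  obtain ⟨x', rfl⟩ := exists_singIncl_eq Y hz'
  have hinv := Function.leftInverse_invFun (singIncl_injective Y (j + 1))
  change κ (Function.invFun _ _) = κ (Function.invFun _ _) at he
  rw [hinv, hinv] at he
  obtain ⟨e, he⟩ := hκ x x' (hker x h0) (hker x' h0') he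
  refine ⟨singIncl Y (j + 2) e, singIncl_mem Y _ e, ?_⟩
  rw [singBd_singIncl, he, map_sub, sub_eq_add_neg]
  congr 1
  exact (eq_neg_of_add_eq_zero_left (SimpChain.add_self_eq_zero _)).symm

/-- The singular chain of a point. -/
noncomputable def singPt (x : X) : SingChain X :=
  Finsupp.single ⟨1, ContinuousMap.const _ x⟩ 1

theorem singPt_mem {x : X} (hx : x ∈ Y) : singPt x ∈ singIn 1 Y := by
  refine Finsupp.single_mem_supported _ _ ⟨rfl, ?_⟩
  rintro _ ⟨_, rfl⟩
  exact hx

theorem singBd_singPt (x : X) : singBd (singPt x) = singOne := by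
  rw [singPt, singBd_single, singSimplexBd, Fin.sum_univ_one, singOne]
  congr 2
  ext y
  exact isEmptyElim y

theorem singOne_mem : singOne ∈ singIn 0 Y := by
  refine Finsupp.single_mem_supported _ _ ⟨rfl, ?_⟩
  rintro _ ⟨x, rfl⟩
  exact isEmptyElim x

theorem exists_singBd_eq_of_joined {x y : Y} (h : Joined x y) :
    ∃ e ∈ singIn 2 Y, singBd e = singPt (x : X) + singPt (y : X) := by
  obtain ⟨p⟩ := h
  refine ⟨Finsupp.single ⟨2, ⟨fun t => p (stdSimplexHomeomorphUnitInterval t), by fun_prop⟩⟩ 1,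
    Finsupp.single_mem_supported _ _ ⟨rfl, ?_⟩, ?_⟩
  · rintro _ ⟨t, rfl⟩
    exact Subtype.prop _
  · rw [singBd_single, singSimplexBd, Fin.sum_univ_two, singPt, singPt]
    have h0 (t) : simplexFace (0 : Fin 2) t = ⟨_, single_mem_stdSimplex ℝ 1⟩ := by
      rw [Subsingleton.elim t (stdSimplex.vertex 0)]
      exact stdSimplex.map_vertex _ _
    have h1 (t) : simplexFace (1 : Fin 2) t = ⟨_, single_mem_stdSimplex ℝ 0⟩ := by
      rw [Subsingleton.elim t (stdSimplex.vertex 0)]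
      exact stdSimplex.map_vertex _ _
    rw [add_comm]
    congr 3 <;> ext t <;> simp [h0, h1]

theorem exists_filling_of_card_le {b : ℕ} [Finite (ZerothHomotopy Y)]
    (h : Nat.card (ZerothHomotopy Y) ≤ b + 1) :
    ∃ κ : SingChain X → Fin (2 ^ (b + 1)), ∀ z ∈ singIn 1 Y, ∀ z' ∈ singIn 1 Y,
      κ z = κ z' → ∃ e ∈ singIn 2 Y, singBd e = z + z' := by
  classical
  let T : (Y →₀ ZMod 2) →ₗ[ZMod 2] SingChain X :=
    Finsupp.linearCombination (ZMod 2) fun y : Y => singPt (y : X)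
  let m : Y → ZerothHomotopy Y := Quotient.mk _
  have hT : singIn 1 Y ≤ LinearMap.range T := by
    rw [singIn, Finsupp.supported_eq_span_single, Submodule.span_le]
    rintro _ ⟨⟨i, σ⟩, ⟨hi, hs⟩, rfl⟩
    obtain rfl : i = 1 := hi
    refine ⟨Finsupp.single ⟨σ default, hs ⟨_, rfl⟩⟩ 1, ?_⟩
    rw [Finsupp.linearCombination_single, one_smul, singPt]
    congr 2
    ext t
    rw [Subsingleton.elim t default]
    rfl
  have hout : ∀ x, ∃ e ∈ singIn 2 Y, singBd e = T x + T (x.mapDomain fun y => (m y).out) := by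
    intro x
    induction x using Finsupp.induction_linear with
    | zero => exact ⟨0, zero_mem _, by simp⟩
    | add x x' hx hx' =>
      obtain ⟨e, he, h1⟩ := hx
      obtain ⟨e', he', h1'⟩ := hx'
      refine ⟨e + e', add_mem he he', ?_⟩
      rw [map_add, h1, h1', Finsupp.mapDomain_add, map_add, map_add]
      abel
    | single y a =>
      obtain ⟨e, he, h1⟩ := exists_singBd_eq_of_joined
        (Quotient.exact (m y).out_eq.symm : Joined y _)
      refine ⟨a • e, Submodule.smul_mem _ _ he, ?_⟩
      rw [map_smul, h1, Finsupp.mapDomain_single, Finsupp.linearCombination_single,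
        Finsupp.linearCombination_single, smul_add]
  obtain ⟨f⟩ : Nonempty ((ZerothHomotopy Y → ZMod 2) ↪ Fin (2 ^ (b + 1))) := by
    have := Fintype.ofFinite (ZerothHomotopy Y)
    refine Function.Embedding.nonempty_of_card_le ?_
    rw [Fintype.card_fun, ZMod.card, Fintype.card_fin, ← Nat.card_eq_fintype_card]
    exact Nat.pow_le_pow_right two_pos h
  refine ⟨fun z => f ((Function.invFun T z).mapDomain m), fun z hz z' hz' he => ?_⟩
  have hmap : ∀ x : Y →₀ ZMod 2, x.mapDomain (fun y => (m y).out) =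
    (x.mapDomain m).mapDomain Quotient.out := fun x => Finsupp.mapDomain_comp
  have he := DFunLike.coe_injective (f.injective he)
  obtain ⟨e, he1, he2⟩ := hout (Function.invFun T z)
  obtain ⟨e', he1', he2'⟩ := hout (Function.invFun T z')
  rw [Function.invFun_eq (hT hz)] at he2
  rw [Function.invFun_eq (hT hz')] at he2'
  refine ⟨e + e', add_mem he1 he1', ?_⟩
  rw [map_add, he2, he2', hmap, hmap, he, add_add_add_comm, SimpChain.add_self_eq_zero, add_zero]

end Filling

section Placement

theorem Finset.exists_strictMonoOn_image_eq (T : Finset ℕ) :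
    ∃ f : ℕ → ℕ, StrictMonoOn f (Set.Iio T.card) ∧ (range T.card).image f = T := by
  have hT : (Set.ofPred (· ∈ T)).Finite := T.finite_toSet
  have hc : hT.toFinset = T := by ext; simp
  refine ⟨Nat.nth (· ∈ T), ?_, ?_⟩
  · have := Nat.nth_strictMonoOn hT
    rwa [hc] at this
  · have := Nat.image_nth_Iio_card hT
    rw [hc] at this
    apply Finset.coe_injective
    rw [coe_image, coe_range, this]
    rfl

/-- A monotone function which increases exactly at `I` and maps `I` onto `S`. -/
theorem exists_monotone_surjOn (I S : Finset ℕ) (h : I.card = S.card) (h0 : 0 ∉ S) :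
    ∃ θ : ℕ → ℕ, Monotone θ ∧ (∀ x y, x < y → y ∈ I → θ x < θ y) ∧
      (∀ x, θ x ∈ insert 0 S) ∧ ∀ k ∈ S, ∃ x ∈ I, θ x = k := by
  classical
  obtain ⟨f, hf, hfS⟩ := Finset.exists_strictMonoOn_image_eq (insert 0 S)
  rw [Finset.card_insert_of_notMem h0, ← h] at hf hfS
  have hI : (Set.ofPred (· ∈ I)).Finite := I.finite_toSet
  have hc : hI.toFinset = I := by ext; simp
  have hlt : ∀ x, Nat.count (· ∈ I) x < I.card + 1 := fun x => by
    have := Nat.count_le_card hI x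
    rw [hc] at this
    omega
  refine ⟨fun x => f (Nat.count (· ∈ I) (x + 1)), ?_, ?_, ?_, ?_⟩
  · intro x y hxy
    exact hf.monotoneOn (hlt _) (hlt _) (Nat.count_monotone _ (by omega))
  · intro x y hxy hy
    refine hf (hlt _) (hlt _) ?_
    rw [Nat.count_succ _ y, if_pos hy]
    exact Nat.lt_succ_of_le (Nat.count_monotone _ (by omega))
  · intro x
    rw [← hfS]
    exact Finset.mem_image_of_mem _ (Finset.mem_range.2 (hlt _))
  · intro k hk
    obtain ⟨j, hj, rfl⟩ := Finset.mem_image.1 (hfS.symm ▸ Finset.mem_insert_of_mem hk)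
    obtain ⟨i, hi, hi0⟩ := Finset.mem_image.1 (hfS.symm ▸ Finset.mem_insert_self 0 S)
    rw [Finset.mem_range] at hi hj
    obtain _ | j := j
    · have : f 0 ≤ f i := hf.monotoneOn (Set.mem_Iio.2 (Nat.succ_pos _)) hi (Nat.zero_le i)
      rw [hi0, Nat.le_zero] at this
      exact absurd (this ▸ hk) h0
    · have hj' : j < hI.toFinset.card := by rw [hc]; omega
      exact ⟨Nat.nth (· ∈ I) j, Nat.nth_mem_of_lt_card hI hj',
        congrArg f (Nat.count_nth_succ fun _ => hj')⟩

theorem add_mul_add_inj {n G k k' o o' : ℕ} (ho : o < G) (ho' : o' < G)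
    (h : n + k * G + o = n + k' * G + o') : k = k' ∧ o = o' := by
  have h1 : k * G + o = k' * G + o' := by omega
  have h2 : o = o' := by
    have := congrArg (· % G) h1
    simpa [Nat.mod_eq_of_lt ho, Nat.mod_eq_of_lt ho'] using this
  subst h2
  exact ⟨Nat.eq_of_mul_eq_mul_right (by omega) (Nat.add_right_cancel h1), rfl⟩

/-- Auxiliary vertices for the simplices with `J` or `J + 1` vertices: each such simplex `A` gets a
separate apex `w A`, and each simplex with `J + 1` vertices is completed to an `m`-element set in
which the apices of the simplex and of its facets occupy the prescribed positions. -/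
theorem exists_placement (n m J : ℕ) (hJ : 1 ≤ J) : ∃ q, n ≤ q ∧ ∀ I : Finset ℕ, I.card = J + 2 →
    (∀ x ∈ I, J + 1 ≤ x ∧ x < m) →
    ∃ (w : Finset ℕ → ℕ) (e : Finset ℕ → ℕ → ℕ) (M : Finset ℕ → Finset ℕ),
      (∀ A, n ≤ w A) ∧
      (∀ A ⊆ Finset.range n, A.card ≤ J + 1 → A ⊆ M A ∧ M A ⊆ Finset.range q) ∧
      (∀ A, A.card = J → w A ∈ M A) ∧
      (∀ A ⊆ Finset.range n, A.card = J + 1 → StrictMonoOn (e A) (Set.Iio m) ∧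
        (Finset.range m).image (e A) = M A ∧ (Finset.range (J + 1)).image (e A) = A ∧
        (∃ x ∈ I, e A x = w A) ∧ ∀ a ∈ A, ∃ x ∈ I, e A x = w (A.erase a)) ∧
      ∀ A ⊆ Finset.range n, A.card ≤ J + 1 → ∀ B ⊆ Finset.range n, B.card ≤ J + 1 →
        Disjoint A B → Disjoint (M A) (M B) := by
  classical
  let rk : Finset ℕ → ℕ := Encodable.encode
  have hrk : Function.Injective rk := Encodable.encode_injective
  set R := (Finset.range n).powerset.sup rk with hR
  have hrkR : ∀ A ⊆ Finset.range n, rk A ≤ R := fun A hA =>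
    Finset.le_sup (f := rk) (Finset.mem_powerset.2 hA)
  set G := R * m + m + 1 with hG
  have hoff : ∀ A ⊆ Finset.range n, ∀ x < m, rk A * m + x + 1 < G := fun A hA x hx => by
    have := Nat.mul_le_mul_right m (hrkR A hA)
    omega
  refine ⟨n + (R + 2) * G, by omega, fun I hIc hI => ?_⟩
  let w : Finset ℕ → ℕ := fun A => n + (rk A + 1) * G
  have hθ : ∀ A : Finset ℕ, ∃ θ : ℕ → ℕ, A.card = J + 1 → Monotone θ ∧
      (∀ x y, x < y → y ∈ I → θ x < θ y) ∧
      (∀ x, θ x ∈ insert 0 ((insert A (A.image A.erase)).image fun B => rk B + 1)) ∧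
      ∀ B ∈ insert A (A.image A.erase), ∃ x ∈ I, θ x = rk B + 1 := by
    intro A
    by_cases hA : A.card = J + 1
    swap
    · exact ⟨id, fun h => absurd h hA⟩
    have hinj : Function.Injective fun B => rk B + 1 := fun B B' h => hrk (Nat.succ_injective h)
    obtain ⟨θ, h1, h2, h3, h4⟩ := exists_monotone_surjOn I
      ((insert A (A.image A.erase)).image fun B => rk B + 1) (by
        rw [Finset.card_image_of_injective _ hinj, Finset.card_insert_of_notMem,
          Finset.card_image_of_injOn, hA, hIc]
        · intro a ha b hb hab
          by_contra hne
          have : a ∈ A.erase b := Finset.mem_erase.2 ⟨hne, ha⟩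
          rw [← hab] at this
          exact Finset.notMem_erase a A this
        · intro h
          obtain ⟨a, ha, h⟩ := Finset.mem_image.1 h
          exact Finset.erase_ne_self.2 ha h) (by simp)
    exact ⟨θ, fun _ => ⟨h1, h2, h3, fun B hB => h4 _ (Finset.mem_image_of_mem _ hB)⟩⟩
  choose θ hθ using hθ
  choose f hf hfA using fun A : Finset ℕ => A.exists_strictMonoOn_image_eq
  let e : Finset ℕ → ℕ → ℕ := fun A x => if x < J + 1 then f A x else
    n + θ A x * G + if x ∈ I then 0 else rk A * m + x + 1
  let M : Finset ℕ → Finset ℕ := fun A => if A.card = J then insert (w A) A else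
    if A.card = J + 1 then (Finset.range m).image (e A) else A
  have hIm : J + 1 < m := by
    obtain ⟨x, hx⟩ : I.Nonempty := Finset.card_pos.1 (by omega)
    have := hI x hx
    omega
  have hfirst : ∀ A : Finset ℕ, A.card = J + 1 → (Finset.range (J + 1)).image (e A) = A := by
    intro A hA
    conv_rhs => rw [← hfA A, hA]
    exact Finset.image_congr fun x hx => if_pos (Finset.mem_range.1 hx)
  have hspecial : ∀ A : Finset ℕ, A.card = J + 1 → ∀ B ∈ insert A (A.image A.erase),
      ∃ x ∈ I, e A x = w B := by
    intro A hA B hB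
    obtain ⟨x, hx, h⟩ := (hθ A hA).2.2.2 B hB
    refine ⟨x, hx, ?_⟩
    simp only [e, w]
    rw [if_neg (by have := hI x hx; omega), if_pos hx, h, add_zero]
  have hM : ∀ A ⊆ Finset.range n, A.card ≤ J + 1 → ∀ p ∈ M A, p < n ∧ p ∈ A ∨
      (∃ B ⊆ A, B.Nonempty ∧ p = n + (rk B + 1) * G + 0) ∨
      ∃ k x, x < m ∧ k ≤ R + 1 ∧ A.Nonempty ∧ p = n + k * G + (rk A * m + x + 1) := by
    intro A hA hAc p hp
    simp only [M] at hp
    split_ifs at hp with h1 h2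
    · rcases Finset.mem_insert.1 hp with rfl | hp
      · exact .inr (.inl ⟨A, subset_rfl, Finset.card_pos.1 (by omega), rfl⟩)
      · exact .inl ⟨Finset.mem_range.1 (hA hp), hp⟩
    · obtain ⟨x, hx, rfl⟩ := Finset.mem_image.1 hp
      rw [Finset.mem_range] at hx
      by_cases hxJ : x < J + 1
      · have : e A x ∈ A := by
          have := Finset.mem_image_of_mem (e A) (Finset.mem_range.2 hxJ)
          rwa [hfirst A h2] at this
        exact .inl ⟨Finset.mem_range.1 (hA this), this⟩
      have hne : A.Nonempty := Finset.card_pos.1 (by omega)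
      have hmem : ∀ B ∈ insert A (A.image A.erase), B ⊆ A ∧ B.Nonempty := by
        intro B hB
        rcases Finset.mem_insert.1 hB with rfl | hB
        · exact ⟨subset_rfl, hne⟩
        · obtain ⟨a, ha, rfl⟩ := Finset.mem_image.1 hB
          refine ⟨Finset.erase_subset _ _, Finset.card_pos.1 ?_⟩
          rw [Finset.card_erase_of_mem ha]
          omega
      have hk := (hθ A h2).2.2.1 x
      by_cases hxI : x ∈ I
      · have hpos : 0 < θ A x := (Nat.zero_le _).trans_lt
          ((hθ A h2).2.1 0 x (by omega) hxI)
        rcases Finset.mem_insert.1 hk with h | h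
        · omega
        obtain ⟨B, hB, h⟩ := Finset.mem_image.1 h
        refine .inr (.inl ⟨B, (hmem B hB).1, (hmem B hB).2, ?_⟩)
        simp only [e]
        rw [if_neg hxJ, if_pos hxI, ← h]
      · refine .inr (.inr ⟨θ A x, x, hx, ?_, hne, ?_⟩)
        · rcases Finset.mem_insert.1 hk with h | h
          · omega
          obtain ⟨B, hB, h⟩ := Finset.mem_image.1 h
          rw [← h]
          exact Nat.succ_le_succ (hrkR B ((hmem B hB).1.trans hA))
        · simp only [e]
          rw [if_neg hxJ, if_neg hxI]
    · exact .inl ⟨Finset.mem_range.1 (hA hp), hp⟩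
  refine ⟨w, e, M, fun A => ?_, fun A hA hAc => ⟨?_, fun p hp => ?_⟩, fun A hA => ?_,
    fun A hA hAc => ⟨?_, ?_, hfirst A hAc, hspecial A hAc A (Finset.mem_insert_self _ _),
      fun a ha => hspecial A hAc _ (Finset.mem_insert_of_mem (Finset.mem_image_of_mem _ ha))⟩,
    fun A hA hAc B hB hBc hAB => ?_⟩
  · simp only [w]
    omega
  · simp only [M]
    split_ifs with h1 h2
    · exact Finset.subset_insert _ _
    · conv_lhs => rw [← hfirst A h2]
      exact Finset.image_subset_image (Finset.range_subset_range.2 hIm.le)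
    · exact subset_rfl
  · rw [Finset.mem_range]
    rcases hM A hA hAc p hp with h | ⟨B, hB, -, rfl⟩ | ⟨k, x, hx, hk, -, rfl⟩
    · omega
    · have h1 := hrkR B (hB.trans hA)
      have h2 : (rk B + 1) * G ≤ (R + 1) * G := Nat.mul_le_mul_right _ (by omega)
      have h3 : (R + 2) * G = (R + 1) * G + G := by ring
      omega
    · have h1 := hoff A hA x hx
      have h2 : k * G ≤ (R + 1) * G := Nat.mul_le_mul_right _ (by omega)
      have h3 : (R + 2) * G = (R + 1) * G + G := by ring
      omega
  · simp only [M]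
    rw [if_pos hA]
    exact Finset.mem_insert_self _ _
  · intro x hx y hy hxy
    rw [Set.mem_Iio] at hx hy
    simp only [e]
    by_cases hyJ : y < J + 1
    · rw [if_pos (hxy.trans hyJ), if_pos hyJ]
      exact hf A (by rw [hAc]; exact hxy.trans hyJ) (by rw [hAc]; exact hyJ) hxy
    rw [if_neg hyJ]
    by_cases hxJ : x < J + 1
    · rw [if_pos hxJ]
      have : f A x ∈ A := by
        have := Finset.mem_image_of_mem (f A) (Finset.mem_range.2 (hAc.symm ▸ hxJ))
        rwa [hfA A] at this
      have := Finset.mem_range.1 (hA this)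
      omega
    rw [if_neg hxJ]
    by_cases hyI : y ∈ I
    · have h1 := (hθ A hAc).2.1 x y hxy hyI
      have h2 : (θ A x + 1) * G ≤ θ A y * G := Nat.mul_le_mul_right _ h1
      have h3 : (θ A x + 1) * G = θ A x * G + G := by ring
      have h4 := hoff A hA x hx
      split_ifs <;> omega
    · have h1 := Nat.mul_le_mul_right G ((hθ A hAc).1 hxy.le)
      rw [if_neg hyI]
      split_ifs <;> omega
  · simp only [M]
    rw [if_neg (by omega), if_pos hAc]
  · rw [Finset.disjoint_left]
    intro p hpA hpB
    have hG0 : 0 < G := by omega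
    rcases hM A hA hAc p hpA with ⟨h, hp⟩ | ⟨C, hC, ⟨c, hc⟩, hp⟩ | ⟨k, x, hx, hk, ⟨c, hc⟩, hp⟩ <;>
    rcases hM B hB hBc p hpB with ⟨h', hp'⟩ | ⟨C', hC', hne', hp'⟩ | ⟨k', x', hx', hk', hne', hp'⟩
    · exact Finset.disjoint_left.1 hAB hp hp'
    · omega
    · omega
    · omega
    · have := (add_mul_add_inj hG0 hG0 (hp.symm.trans hp')).1
      obtain rfl := hrk (Nat.succ_injective this)
      exact Finset.disjoint_left.1 hAB (hC hc) (hC' hc)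
    · have := (add_mul_add_inj hG0 (hoff B hB x' hx') (hp.symm.trans hp')).2
      omega
    · omega
    · have := (add_mul_add_inj (hoff A hA x hx) hG0 (hp.symm.trans hp')).2
      omega
    · have := (add_mul_add_inj (hoff A hA x hx) (hoff B hB x' hx') (hp.symm.trans hp')).2
      have h2 : 0 + rk A * m + x = 0 + rk B * m + x' := by omega
      obtain rfl := hrk (add_mul_add_inj hx hx' h2).1
      exact Finset.disjoint_left.1 hAB hc hc

end Placement

section ChainSystem

variable {S : Type*} [AddCommGroup S]

/-- The image of the cone with apex `w` over the boundary of the simplex `σ`. -/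
def coneChain (γ : Finset ℕ → S) (σ : Finset ℕ) (w : ℕ) : S :=
  ∑ b ∈ σ, γ (insert w (σ.erase b))

theorem coneChain_image {γ : Finset ℕ → S} {g : ℕ → ℕ} (hg : g.Injective) (σ : Finset ℕ) (w : ℕ) :
    coneChain (fun A => γ (A.image g)) σ w = coneChain γ (σ.image g) (g w) := by
  rw [coneChain, coneChain, Finset.sum_image hg.injOn]
  refine Finset.sum_congr rfl fun b _ => ?_
  rw [Finset.image_insert, Finset.image_erase hg]

variable [Module (ZMod 2) S]

/-- A chain map from the `(J - 1)`-skeleton of the simplex on `n` vertices to an abstract complex,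
with carriers `C` of the images of the simplices indexed by finite sets which are disjoint for
disjoint simplices. -/
structure IsChainSystem (bd : S →ₗ[ZMod 2] S) (one : S)
    (C : ℕ → Finset ℕ → Submodule (ZMod 2) S) (J n N : ℕ) (γ : Finset ℕ → S)
    (Φ : Finset ℕ → Finset ℕ) : Prop where
  map_empty : γ ∅ = one
  subset : ∀ A ⊆ Finset.range n, A.card ≤ J → Φ A ⊆ Finset.range N
  mem : ∀ A ⊆ Finset.range n, A.card ≤ J → γ A ∈ C A.card (Φ A)
  bd_eq : ∀ A ⊆ Finset.range n, A.card ≤ J → A.Nonempty → bd (γ A) = ∑ a ∈ A, γ (A.erase a)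
  disjoint : ∀ A ⊆ Finset.range n, A.card ≤ J → ∀ B ⊆ Finset.range n, B.card ≤ J →
    Disjoint A B → Disjoint (Φ A) (Φ B)

/-- The union of the carriers of the simplices on a vertex set. -/
def carrierHull (Φ : Finset ℕ → Finset ℕ) (J : ℕ) (M : Finset ℕ) : Finset ℕ :=
  (M.powerset.filter fun A => A.card ≤ J).biUnion Φ

theorem sum_coneChain (γ : Finset ℕ → S) (τ : Finset ℕ) (w : ℕ) :
    ∑ a ∈ τ, coneChain γ (τ.erase a) w = 0 :=
  SimpChain.sum_sum_erase_eq_zero τ (fun a b => γ (insert w ((τ.erase a).erase b)))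
    fun a b => by rw [Finset.erase_right_comm]

theorem carrierHull_image_subset {Φ : Finset ℕ → Finset ℕ} {g : ℕ → ℕ} (hg : g.Injective) (J : ℕ)
    (M : Finset ℕ) :
    carrierHull Φ J (M.image g) ⊆ carrierHull (fun A => Φ (A.image g)) J M := by
  intro p hp
  obtain ⟨A, hA, hp⟩ := Finset.mem_biUnion.1 hp
  obtain ⟨hA, hAc⟩ := Finset.mem_filter.1 hA
  obtain ⟨B, hB, rfl⟩ := Finset.subset_image_iff.1 (Finset.mem_powerset.1 hA)
  rw [Finset.card_image_of_injective _ hg] at hAc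
  exact Finset.mem_biUnion.2 ⟨B, Finset.mem_filter.2 ⟨Finset.mem_powerset.2 (mod_cast hB), hAc⟩, hp⟩

namespace IsChainSystem

variable {bd : S →ₗ[ZMod 2] S} {one : S} {C : ℕ → Finset ℕ → Submodule (ZMod 2) S} {J n N : ℕ}
  {γ : Finset ℕ → S} {Φ : Finset ℕ → Finset ℕ}

theorem comap (h : IsChainSystem bd one C J n N γ Φ) {q : ℕ} {g : ℕ → ℕ} (hg : g.Injective)
    (hgn : ∀ x < q, g x < n) :
    IsChainSystem bd one C J q N (fun A => γ (A.image g)) fun A => Φ (A.image g) := by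
  have him : ∀ A ⊆ Finset.range q, A.image g ⊆ Finset.range n := fun A hA x hx => by
    obtain ⟨a, ha, rfl⟩ := Finset.mem_image.1 hx
    exact Finset.mem_range.2 (hgn a (Finset.mem_range.1 (hA ha)))
  have hcard : ∀ A : Finset ℕ, (A.image g).card = A.card := fun A =>
    Finset.card_image_of_injective A hg
  refine ⟨by simpa using h.map_empty, fun A hA hAc => ?_, fun A hA hAc => ?_,
    fun A hA hAc hne => ?_, fun A hA hAc B hB hBc hAB => ?_⟩
  · exact h.subset _ (him A hA) ((hcard A).trans_le hAc)
  · have := h.mem _ (him A hA) ((hcard A).trans_le hAc)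
    rwa [hcard] at this
  · simp only [Finset.image_erase hg]
    rw [h.bd_eq _ (him A hA) ((hcard A).trans_le hAc) (hne.image g), Finset.sum_image hg.injOn]
  · exact h.disjoint _ (him A hA) ((hcard A).trans_le hAc) _ (him B hB) ((hcard B).trans_le hBc)
      ((Finset.disjoint_image hg).2 hAB)

theorem mem_carrierHull (h : IsChainSystem bd one C J n N γ Φ) (hC : ∀ i, Monotone (C i))
    {A M : Finset ℕ} (hM : M ⊆ Finset.range n) (hA : A ⊆ M) (hAc : A.card ≤ J) :
    γ A ∈ C A.card (carrierHull Φ J M) :=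
  hC _ (Finset.subset_biUnion_of_mem Φ
    (Finset.mem_filter.2 ⟨Finset.mem_powerset.2 hA, hAc⟩)) (h.mem A (hA.trans hM) hAc)

theorem carrierHull_subset (h : IsChainSystem bd one C J n N γ Φ) {M : Finset ℕ}
    (hM : M ⊆ Finset.range n) : carrierHull Φ J M ⊆ Finset.range N := by
  refine Finset.biUnion_subset.2 fun A hA => ?_
  obtain ⟨hA, hAc⟩ := Finset.mem_filter.1 hA
  exact h.subset A ((Finset.mem_powerset.1 hA).trans hM) hAc

theorem disjoint_carrierHull (h : IsChainSystem bd one C J n N γ Φ) {M M' : Finset ℕ}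
    (hM : M ⊆ Finset.range n) (hM' : M' ⊆ Finset.range n) (hMM' : Disjoint M M') :
    Disjoint (carrierHull Φ J M) (carrierHull Φ J M') := by
  refine (Finset.disjoint_biUnion_left _ _ _).2 fun A hA =>
    (Finset.disjoint_biUnion_right _ _ _).2 fun B hB => ?_
  obtain ⟨hA, hAc⟩ := Finset.mem_filter.1 hA
  obtain ⟨hB, hBc⟩ := Finset.mem_filter.1 hB
  rw [Finset.mem_powerset] at hA hB
  exact h.disjoint A (hA.trans hM) hAc B (hB.trans hM') hBc (hMM'.mono hA hB)

theorem bd_coneChain (h : IsChainSystem bd one C J n N γ Φ) {σ : Finset ℕ} {w : ℕ}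
    (hσ : σ ⊆ Finset.range n) (hσc : σ.card = J) (hw : w < n) (hwσ : w ∉ σ) :
    bd (coneChain γ σ w) = ∑ a ∈ σ, γ (σ.erase a) := by
  have hsum : ∑ b ∈ σ, ∑ a ∈ σ.erase b, γ (insert w ((σ.erase b).erase a)) = 0 :=
    SimpChain.sum_sum_erase_eq_zero σ (fun b a => γ (insert w ((σ.erase b).erase a)))
      fun a b => by rw [Finset.erase_right_comm]
  rw [coneChain, map_sum, ← add_zero (∑ a ∈ σ, γ (σ.erase a)), ← hsum, ← Finset.sum_add_distrib]
  refine Finset.sum_congr rfl fun b hb => ?_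
  have hwb : w ∉ σ.erase b := fun hw => hwσ (Finset.mem_of_mem_erase hw)
  rw [h.bd_eq _ (Finset.insert_subset (Finset.mem_range.2 hw) ((Finset.erase_subset _ _).trans hσ))
    (by rw [Finset.card_insert_of_notMem hwb, Finset.card_erase_add_one hb, hσc])
    (Finset.insert_nonempty _ _), Finset.sum_insert hwb, Finset.erase_insert hwb]
  congr 1
  refine Finset.sum_congr rfl fun a ha => ?_
  rw [Finset.erase_insert_of_ne fun hwa : w = a => hwb (hwa ▸ ha)]

theorem coneChain_mem (h : IsChainSystem bd one C J n N γ Φ) (hC : ∀ i, Monotone (C i))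
    {σ M : Finset ℕ} {w : ℕ} (hM : M ⊆ Finset.range n) (hσ : σ ⊆ M) (hσc : σ.card = J)
    (hw : w ∈ M) (hwσ : w ∉ σ) : coneChain γ σ w ∈ C J (carrierHull Φ J M) := by
  refine Submodule.sum_mem _ fun b hb => ?_
  have hc : (insert w (σ.erase b)).card = J := by
    rw [Finset.card_insert_of_notMem fun hw => hwσ (Finset.mem_of_mem_erase hw),
      Finset.card_erase_add_one hb, hσc]
  have := h.mem_carrierHull hC hM (Finset.insert_subset hw ((Finset.erase_subset b σ).trans hσ))
    hc.le
  rwa [hc] at this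

end IsChainSystem

/-- The cones over the facets of `τ` with apices in `W` differ by boundaries carried by `M`. -/
def IsFillable (bd : S →ₗ[ZMod 2] S) (C : ℕ → Finset ℕ → Submodule (ZMod 2) S) (J : ℕ)
    (γ : Finset ℕ → S) (Φ : Finset ℕ → Finset ℕ) (τ M W : Finset ℕ) : Prop :=
  ∀ x ∈ W, ∀ y ∈ W, ∀ a ∈ τ, ∃ f ∈ C (J + 1) (carrierHull Φ J M),
    bd f = coneChain γ (τ.erase a) x + coneChain γ (τ.erase a) y

theorem IsFillable.comap {bd : S →ₗ[ZMod 2] S} {C : ℕ → Finset ℕ → Submodule (ZMod 2) S} {J : ℕ}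
    (hC : ∀ i, Monotone (C i)) {γ : Finset ℕ → S} {Φ : Finset ℕ → Finset ℕ} {τ M W : Finset ℕ}
    {g : ℕ → ℕ} (hg : g.Injective)
    (h : IsFillable bd C J γ Φ (τ.image g) (M.image g) (W.image g)) :
    IsFillable bd C J (fun A => γ (A.image g)) (fun A => Φ (A.image g)) τ M W := by
  intro x hx y hy a ha
  obtain ⟨f, hf, hbd⟩ := h _ (Finset.mem_image_of_mem g hx) _ (Finset.mem_image_of_mem g hy) _
    (Finset.mem_image_of_mem g ha)
  refine ⟨f, hC _ (carrierHull_image_subset hg J M) hf, ?_⟩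
  rw [hbd, coneChain_image hg, coneChain_image hg, Finset.image_erase hg]

/-- Carriers in which cycles are classified up to boundaries by `c` colors. -/
def HasFilling (bd : S →ₗ[ZMod 2] S) (C : ℕ → Finset ℕ → Submodule (ZMod 2) S) (c J : ℕ) : Prop :=
  ∀ Q, ∃ κ : S → Fin c, ∀ z ∈ C J Q, ∀ z' ∈ C J Q, bd z = 0 → bd z' = 0 → κ z = κ z' →
    ∃ e ∈ C (J + 1) Q, bd e = z + z'

theorem IsChainSystem.exists_isFillable {bd : S →ₗ[ZMod 2] S} {one : S}
    {C : ℕ → Finset ℕ → Submodule (ZMod 2) S} {J n N c m : ℕ} {γ : Finset ℕ → S}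
    {Φ : Finset ℕ → Finset ℕ} (h : IsChainSystem bd one C J n N γ Φ) (hC : ∀ i, Monotone (C i))
    (hfill : HasFilling bd C c J) (hJ : 1 ≤ J) (hm : (J + 1) * c ^ (J + 1) + (J + 1) < m)
    {e : ℕ → ℕ} (he : StrictMonoOn e (Set.Iio m)) (hen : ∀ x < m, e x < n) :
    ∃ I : Finset ℕ, I.card = J + 2 ∧ (∀ x ∈ I, J + 1 ≤ x ∧ x < m) ∧
      IsFillable bd C J γ Φ ((Finset.range (J + 1)).image e) ((Finset.range m).image e)
        (I.image e) := by
  classical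
  set τ := (Finset.range (J + 1)).image e with hτ
  set M := (Finset.range m).image e with hM
  obtain ⟨κ, hκ⟩ := hfill (carrierHull Φ J M)
  have hMn : M ⊆ Finset.range n := fun p hp => by
    obtain ⟨x, hx, rfl⟩ := Finset.mem_image.1 hp
    exact Finset.mem_range.2 (hen x (Finset.mem_range.1 hx))
  have hJm : J + 1 < m := by omega
  have hinj : Set.InjOn e (Set.Iio m) := he.injOn
  have hτM : τ ⊆ M := Finset.image_subset_image (Finset.range_subset_range.2 hJm.le)
  have hτc : τ.card = J + 1 := by
    rw [hτ, Finset.card_image_of_injOn, Finset.card_range]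
    exact hinj.mono fun x hx => (Finset.mem_range.1 (Finset.mem_coe.1 hx)).trans hJm
  have hnot : ∀ x, J + 1 ≤ x → x < m → e x ∉ τ := by
    intro x hx hxm hmem
    obtain ⟨y, hy, hxy⟩ := Finset.mem_image.1 hmem
    rw [Finset.mem_range] at hy
    have := hinj (Set.mem_Iio.2 (hy.trans hJm)) (Set.mem_Iio.2 hxm) hxy
    omega
  let z : ℕ → ℕ → S := fun a x => coneChain γ (τ.erase a) (e x) + γ (τ.erase a)
  have hz : ∀ a ∈ τ, ∀ x, J + 1 ≤ x → x < m →
      z a x ∈ C J (carrierHull Φ J M) ∧ bd (z a x) = 0 := by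
    intro a ha x hx hxm
    have hc : (τ.erase a).card = J := by rw [Finset.card_erase_of_mem ha, hτc]; rfl
    have hsub : τ.erase a ⊆ M := (Finset.erase_subset _ _).trans hτM
    have hw : e x ∉ τ.erase a := fun hw => hnot x hx hxm (Finset.mem_of_mem_erase hw)
    refine ⟨add_mem (h.coneChain_mem hC hMn hsub hc
      (Finset.mem_image_of_mem e (Finset.mem_range.2 hxm)) hw) ?_, ?_⟩
    · have := h.mem_carrierHull hC hMn hsub hc.le
      rwa [hc] at this
    · rw [map_add, h.bd_coneChain (hsub.trans hMn) hc (hen x hxm) hw,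
        h.bd_eq _ (hsub.trans hMn) hc.le (Finset.card_pos.1 (by omega)),
        SimpChain.add_self_eq_zero]
  let col : ℕ → Fin (J + 1) → Fin c := fun x i => κ (z (e i) x)
  obtain ⟨k, -, hk⟩ := Finset.exists_lt_card_fiber_of_mul_lt_card_of_maps_to (f := col)
    (s := Finset.Ico (J + 1) m) (t := Finset.univ) (n := J + 1) (fun _ _ => Finset.mem_univ _) (by
      rw [Finset.card_univ, Fintype.card_fun, Fintype.card_fin, Fintype.card_fin, Nat.card_Ico,
        mul_comm]
      omega)
  obtain ⟨I, hI, hIc⟩ := Finset.exists_subset_card_eq (Nat.succ_le_of_lt hk)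
  have hI' : ∀ x ∈ I, (J + 1 ≤ x ∧ x < m) ∧ col x = k := fun x hx => by
    simpa using hI hx
  refine ⟨I, hIc, fun x hx => (hI' x hx).1, fun p hp p' hp' a ha => ?_⟩
  obtain ⟨x, hx, rfl⟩ := Finset.mem_image.1 hp
  obtain ⟨y, hy, rfl⟩ := Finset.mem_image.1 hp'
  obtain ⟨i, hi, hia⟩ := Finset.mem_image.1 ha
  obtain ⟨⟨hx1, hx2⟩, hx3⟩ := hI' x hx
  obtain ⟨⟨hy1, hy2⟩, hy3⟩ := hI' y hy
  obtain ⟨f, hf, hbd⟩ := hκ (z a x) (hz a ha x hx1 hx2).1 (z a y) (hz a ha y hy1 hy2).1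
    (hz a ha x hx1 hx2).2 (hz a ha y hy1 hy2).2 (by
      have := congrFun (hx3.trans hy3.symm) ⟨i, Finset.mem_range.1 hi⟩
      simpa only [col, hia] using this)
  refine ⟨f, hf, ?_⟩
  rw [hbd, add_add_add_comm, SimpChain.add_self_eq_zero, add_zero]

theorem exists_uniform_isFillable (bd : S →ₗ[ZMod 2] S) (one : S) (J c m q : ℕ) (hJ : 1 ≤ J)
    (hm : (J + 1) * c ^ (J + 1) + (J + 1) < m) (hq : m ≤ q) :
    ∃ n, ∀ (C : ℕ → Finset ℕ → Submodule (ZMod 2) S), (∀ i, Monotone (C i)) →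
      HasFilling bd C c J → ∀ N γ Φ, IsChainSystem bd one C J n N γ Φ →
      ∃ γ' Φ', IsChainSystem bd one C J q N γ' Φ' ∧ ∃ I : Finset ℕ, I.card = J + 2 ∧
        (∀ x ∈ I, J + 1 ≤ x ∧ x < m) ∧ ∀ e : ℕ → ℕ, StrictMonoOn e (Set.Iio m) →
          (∀ x < m, e x < q) → IsFillable bd C J γ' Φ' ((Finset.range (J + 1)).image e)
            ((Finset.range m).image e) (I.image e) := by
  classical
  obtain ⟨n, hn⟩ := exists_ramsey_strictMono ((Finset.range m).powerset) m q
  refine ⟨n, fun C hC hfill N γ Φ h => ?_⟩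
  let ext : (Fin m → ℕ) → ℕ → ℕ := fun e x => if hx : x < m then e ⟨x, hx⟩ else 0
  have hex : ∀ e : Fin m → ℕ, ∃ I : (Finset.range m).powerset, StrictMono e → (∀ x, e x < n) →
      I.1.card = J + 2 ∧ (∀ x ∈ I.1, J + 1 ≤ x ∧ x < m) ∧
      IsFillable bd C J γ Φ ((Finset.range (J + 1)).image (ext e))
        ((Finset.range m).image (ext e)) (I.1.image (ext e)) := by
    intro e
    by_cases he : StrictMono e ∧ ∀ x, e x < n
    swap
    · exact ⟨⟨∅, by simp⟩, fun h1 h2 => absurd ⟨h1, h2⟩ he⟩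
    obtain ⟨I, h1, h2, h3⟩ := h.exists_isFillable (e := ext e) hC hfill hJ hm
      (fun x hx y hy hxy => by
        simp only [ext, dif_pos (Set.mem_Iio.1 hx), dif_pos (Set.mem_Iio.1 hy)]
        exact he.1 hxy) (fun x hx => by simp only [ext, dif_pos hx]; exact he.2 _)
    exact ⟨⟨I, Finset.mem_powerset.2 fun x hx => Finset.mem_range.2 (h2 x hx).2⟩,
      fun _ _ => ⟨h1, h2, h3⟩⟩
  choose I hI using hex
  obtain ⟨g₀, hg₀, hgn, I₀, hI₀⟩ := hn I
  let g : ℕ → ℕ := fun x => if x < q then g₀ x else n + x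
  have hg : g.Injective := by
    intro x y hxy
    simp only [g] at hxy
    split_ifs at hxy with h1 h2 h2
    · exact hg₀.injOn h1 h2 hxy
    · have := hgn x h1
      omega
    · have := hgn y h2
      omega
    · omega
  have hkey : ∀ e : ℕ → ℕ, StrictMonoOn e (Set.Iio m) → (∀ x < m, e x < q) →
      I₀.1.card = J + 2 ∧ (∀ x ∈ I₀.1, J + 1 ≤ x ∧ x < m) ∧
      IsFillable bd C J (fun A => γ (A.image g)) (fun A => Φ (A.image g))
        ((Finset.range (J + 1)).image e) ((Finset.range m).image e) (I₀.1.image e) := by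
    intro e he heq
    have he' : StrictMono fun x : Fin m => e x := fun x y hxy => he x.2 y.2 hxy
    have hk := hI₀ (fun x => e x) he' fun x => heq x x.2
    obtain ⟨h1, h2, h3⟩ := hI (fun x => g₀ (e x))
      (fun x y hxy => hg₀ (heq x x.2) (heq y y.2) (he' hxy)) fun x => hgn _ (heq x x.2)
    rw [hk] at h1 h2 h3
    have him : ∀ T : Finset ℕ, (∀ x ∈ T, x < m) →
        T.image (ext fun x => g₀ (e x)) = (T.image e).image g := by
      intro T hT
      rw [Finset.image_image]
      refine Finset.image_congr fun x hx => ?_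
      have hx := hT x hx
      simp only [ext, g, dif_pos hx, Function.comp_apply, if_pos (heq x hx)]
    rw [him _ fun x hx => by rw [Finset.mem_range] at hx; omega,
      him _ fun x hx => Finset.mem_range.1 hx, him _ fun x hx => (h2 x hx).2] at h3
    exact ⟨h1, h2, h3.comap hC hg⟩
  obtain ⟨h1, h2, -⟩ := hkey id (strictMono_id.strictMonoOn _) fun x hx => hx.trans_le hq
  exact ⟨_, _, h.comap hg fun x hx => by simp only [g, if_pos hx]; exact hgn x hx,
    I₀.1, h1, h2, fun e he heq => (hkey e he heq).2.2⟩

end ChainSystem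

section ChainSystemStep

variable {S : Type*} [AddCommGroup S] [Module (ZMod 2) S]

theorem exists_isChainSystem_succ (bd : S →ₗ[ZMod 2] S) (one : S) (J c n : ℕ) (hJ : 1 ≤ J) :
    ∃ n', ∀ C : ℕ → Finset ℕ → Submodule (ZMod 2) S, (∀ i, Monotone (C i)) →
      HasFilling bd C c J → ∀ N γ Φ, IsChainSystem bd one C J n' N γ Φ →
      ∃ γ' Φ', IsChainSystem bd one C (J + 1) n N γ' Φ' := by
  classical
  obtain ⟨q₀, hnq₀, hplace⟩ := exists_placement n ((J + 1) * c ^ (J + 1) + (J + 1) + 1) J hJ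
  set m := (J + 1) * c ^ (J + 1) + (J + 1) + 1 with hm
  obtain ⟨n', hn'⟩ := exists_uniform_isFillable bd one J c m (max q₀ m) hJ (by omega)
    (le_max_right _ _)
  refine ⟨n', fun C hC hfill N γ₀ Φ₀ h₀ => ?_⟩
  obtain ⟨γ, Φ, h, I, hIc, hIm, hI⟩ := hn' C hC hfill N γ₀ Φ₀ h₀
  obtain ⟨w, e, M, hw, hM, hwM, he, hdis⟩ := hplace I hIc hIm
  set q := max q₀ m with hq
  have hMq : ∀ A ⊆ Finset.range n, A.card ≤ J + 1 → M A ⊆ Finset.range q := fun A hA hAc =>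
    (hM A hA hAc).2.trans (Finset.range_subset_range.2 (le_max_left _ _))
  have hwA : ∀ A ⊆ Finset.range n, ∀ B, w B ∉ A := fun A hA B hB => by
    have := hw B
    have := Finset.mem_range.1 (hA hB)
    omega
  have hfil : ∀ A, ∃ f : ℕ → S, A ⊆ Finset.range n → A.card = J + 1 → ∀ a ∈ A,
      f a ∈ C (J + 1) (carrierHull Φ J (M A)) ∧
      bd (f a) = coneChain γ (A.erase a) (w (A.erase a)) + coneChain γ (A.erase a) (w A) := by
    intro A
    by_cases hA : A ⊆ Finset.range n ∧ A.card = J + 1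
    swap
    · exact ⟨0, fun h1 h2 => absurd ⟨h1, h2⟩ hA⟩
    obtain ⟨hA, hAc⟩ := hA
    obtain ⟨hmono, hiM, hiA, ⟨x, hx, hxw⟩, hface⟩ := he A hA hAc
    have hfi := hI (e A) hmono fun y hy => Finset.mem_range.1 (hMq A hA hAc.le (hiM ▸
      Finset.mem_image_of_mem _ (Finset.mem_range.2 hy)))
    rw [hiM, hiA] at hfi
    have : ∀ a, ∃ f, a ∈ A → f ∈ C (J + 1) (carrierHull Φ J (M A)) ∧
        bd f = coneChain γ (A.erase a) (w (A.erase a)) + coneChain γ (A.erase a) (w A) := by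
      intro a
      by_cases ha : a ∈ A
      swap
      · exact ⟨0, fun h => absurd h ha⟩
      obtain ⟨y, hy, hyw⟩ := hface a ha
      obtain ⟨f, hf⟩ := hfi _ (hyw ▸ Finset.mem_image_of_mem (e A) hy) _
        (hxw ▸ Finset.mem_image_of_mem (e A) hx) a ha
      exact ⟨f, fun _ => hf⟩
    choose f hf using this
    exact ⟨f, fun _ _ => hf⟩
  choose f hf using hfil
  let γ' : Finset ℕ → S := fun A =>
    if A.card < J then γ A else if A.card = J then coneChain γ A (w A) else ∑ a ∈ A, f A a
  have hlt : ∀ A : Finset ℕ, A.card < J → γ' A = γ A := fun A hA => if_pos hA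
  have heq : ∀ A : Finset ℕ, A.card = J → γ' A = coneChain γ A (w A) := fun A hA => by
    simp only [γ', hA, lt_irrefl, if_false, if_true]
  have hgt : ∀ A : Finset ℕ, A.card = J + 1 → γ' A = ∑ a ∈ A, f A a := fun A hA => by
    simp only [γ', hA]
    rw [if_neg (by omega), if_neg (by omega)]
  refine ⟨γ', fun A => carrierHull Φ J (M A), ?_, fun A hA hAc => ?_, fun A hA hAc => ?_,
    fun A hA hAc hne => ?_, fun A hA hAc B hB hBc hAB => ?_⟩
  · rw [hlt ∅ (Finset.card_empty.trans_lt hJ), h.map_empty]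
  · exact h.carrierHull_subset (hMq A hA hAc)
  · rcases lt_trichotomy A.card J with hc | hc | hc
    · rw [hlt A hc]
      exact h.mem_carrierHull hC (hMq A hA hAc) (hM A hA hAc).1 hc.le
    · rw [heq A hc, hc]
      exact h.coneChain_mem hC (hMq A hA hAc) (hM A hA hAc).1 hc (hwM A hc) (hwA A hA A)
    · have hc : A.card = J + 1 := by omega
      rw [hgt A hc, hc]
      exact Submodule.sum_mem _ fun a ha => (hf A hA hc a ha).1
  · rcases lt_trichotomy A.card J with hc | hc | hc
    · rw [hlt A hc, h.bd_eq A (hA.trans (Finset.range_subset_range.2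
        (hnq₀.trans (le_max_left _ _)))) hc.le hne]
      exact Finset.sum_congr rfl fun a ha =>
        (hlt _ ((Finset.card_erase_le).trans_lt hc)).symm
    · rw [heq A hc, h.bd_coneChain (((hM A hA hAc).1).trans (hMq A hA hAc)) hc
        (Finset.mem_range.1 (hMq A hA hAc (hwM A hc))) (hwA A hA A)]
      exact Finset.sum_congr rfl fun a ha =>
        (hlt _ ((Finset.card_erase_lt_of_mem ha).trans_eq hc)).symm
    · have hc : A.card = J + 1 := by omega
      rw [hgt A hc, map_sum, Finset.sum_congr rfl fun a ha => (hf A hA hc a ha).2,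
        Finset.sum_add_distrib, sum_coneChain, add_zero]
      refine Finset.sum_congr rfl fun a ha => (heq _ ?_).symm
      rw [Finset.card_erase_of_mem ha, hc]
      rfl
  · exact h.disjoint_carrierHull (hMq A hA hAc) (hMq B hB hBc) (hdis A hA hAc B hB hBc hAB)

theorem exists_isChainSystem (bd : S →ₗ[ZMod 2] S) (one : S) (c k n : ℕ) :
    ∃ N, ∀ C : ℕ → Finset ℕ → Submodule (ZMod 2) S, (∀ i, Monotone (C i)) →
      (∀ J, 1 ≤ J → J ≤ k → HasFilling bd C c J) → ∀ γ Φ, IsChainSystem bd one C 1 N N γ Φ →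
      ∃ γ' Φ', IsChainSystem bd one C (k + 1) n N γ' Φ' := by
  suffices H : ∃ n', ∀ C : ℕ → Finset ℕ → Submodule (ZMod 2) S, (∀ i, Monotone (C i)) →
      (∀ J, 1 ≤ J → J ≤ k → HasFilling bd C c J) → ∀ N γ Φ, IsChainSystem bd one C 1 n' N γ Φ →
      ∃ γ' Φ', IsChainSystem bd one C (k + 1) n N γ' Φ' by
    obtain ⟨n', h⟩ := H
    exact ⟨n', fun C hC hfill => h C hC hfill n'⟩
  induction k generalizing n with
  | zero => exact ⟨n, fun C _ _ N γ Φ h => ⟨γ, Φ, h⟩⟩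
  | succ k ih =>
    obtain ⟨n₁, h₁⟩ := exists_isChainSystem_succ bd one (k + 1) c n (Nat.le_add_left 1 k)
    obtain ⟨n₂, h₂⟩ := ih n₁
    refine ⟨n₂, fun C hC hfill N γ Φ h => ?_⟩
    obtain ⟨γ', Φ', h'⟩ := h₂ C hC (fun J hJ hJk => hfill J hJ (hJk.trans k.le_succ)) N γ Φ h
    exact h₁ C hC (hfill (k + 1) (Nat.le_add_left 1 k) le_rfl) N γ' Φ' h'

end ChainSystemStep

theorem subset_convFam {X : Type} (ℱ : Set (Set X)) (S : Set X) : S ⊆ convFam ℱ S :=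
  Set.subset_sInter fun _ hF => hF.2

theorem convFam_mono {X : Type} (ℱ : Set (Set X)) : Monotone (convFam ℱ) := fun _ _ h =>
  Set.sInter_subset_sInter fun _ hF => ⟨hF.1, h.trans hF.2⟩

theorem isChainSystem_one {X : Type} [TopologicalSpace X] (p : ℕ → X) {K : Finset ℕ → Set X}
    (hK : ∀ v, p v ∈ K {v}) (N : ℕ) :
    IsChainSystem singBd singOne (fun i Q => singIn i (K Q)) 1 N N
      (fun A => if h : A.Nonempty then singPt (p (A.min' h)) else singOne) id := by
  have hA : ∀ A : Finset ℕ, A.card ≤ 1 → A = ∅ ∨ ∃ v, A = {v} := fun A hA => by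
    rcases Nat.le_one_iff_eq_zero_or_eq_one.1 hA with h | h
    · exact Or.inl (Finset.card_eq_zero.1 h)
    · exact Or.inr (Finset.card_eq_one.1 h)
  refine ⟨by simp, fun A h _ => h, fun A _ hc => ?_, fun A _ hc hne => ?_,
    fun A _ _ B _ _ h => h⟩
  · rcases hA A hc with rfl | ⟨v, rfl⟩
    · simpa using singOne_mem
    · simpa using singPt_mem (hK v)
  · rcases hA A hc with rfl | ⟨v, rfl⟩
    · simp at hne
    · simp [singBd_singPt]

/-- **Patáková's bounded Radon number theorem.**
For all `b ≥ 0` and `d ≥ 1` there is `r = r(b,d)` such that: if `ℱ` is a family of subsets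
of `ℝ^d` such that for every finite `S ⊆ ℝ^d` the set `conv_ℱ(S)` has at most `b + 1`
path-connected components and `ℤ₂`-homology of dimension at most `b` in all degrees
`1 ≤ i ≤ ⌈d/2⌉ − 1`, then every `r`-point set `P ⊆ ℝ^d` contains two disjoint subsets
`A, B` with `conv_ℱ(A) ∩ conv_ℱ(B) ≠ ∅`. -/
theorem bounded_radon_number
    (b d : ℕ) (hd : 1 ≤ d) :
    ∃ r : ℕ, ∀ ℱ : Set (Set (Fin d → ℝ)),
      (∀ S : Set (Fin d → ℝ), S.Finite →
        (Finite (ZerothHomotopy ↥(convFam ℱ S)) ∧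
          Nat.card (ZerothHomotopy ↥(convFam ℱ S)) ≤ b + 1) ∧
        (∀ i : ℕ, 1 ≤ i → i ≤ (d + 1) / 2 - 1 →
          Module.rank (ZMod 2) (SingularHomology (ZMod 2) ↥(convFam ℱ S) i)
            ≤ (b : Cardinal))) →
      ∀ P : Set (Fin d → ℝ), P.Finite → P.ncard = r →
        ∃ A B : Set (Fin d → ℝ), A ⊆ P ∧ B ⊆ P ∧ Disjoint A B ∧
          (convFam ℱ A ∩ convFam ℱ B).Nonempty := by
  obtain ⟨k, hk⟩ : ∃ k, k = (d + 1) / 2 := ⟨_, rfl⟩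
  obtain ⟨N, hN⟩ := exists_isChainSystem (singBd (X := Fin d → ℝ)) singOne (2 ^ (b + 1)) k
    (2 * k + 3)
  refine ⟨N, fun ℱ hℱ P hP hPN => ?_⟩
  by_contra! hdis
  obtain ⟨p₀, hp₀⟩ : ∃ p₀ : Fin N ≃ P, True := by
    have := hP.to_subtype
    exact ⟨(Finite.equivFinOfCardEq (by rw [Nat.card_coe_set_eq, hPN])).symm, trivial⟩
  let p : ℕ → Fin d → ℝ := fun x => if hx : x < N then p₀ ⟨x, hx⟩ else 0
  have hpP : ∀ x < N, p x ∈ P := fun x hx => by simp [p, hx]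
  have hpinj : Set.InjOn p (Set.Iio N) := fun x hx y hy hxy => by
    simp only [p, dif_pos (Set.mem_Iio.1 hx), dif_pos (Set.mem_Iio.1 hy)] at hxy
    simpa using p₀.injective (Subtype.ext hxy)
  let K : Finset ℕ → Set (Fin d → ℝ) := fun Q => convFam ℱ (p '' Q)
  have hKmono : Monotone K := fun Q Q' h => convFam_mono ℱ (Set.image_mono (mod_cast h))
  have hfill : ∀ J, 1 ≤ J → J ≤ k →
      HasFilling singBd (fun i Q => singIn i (K Q)) (2 ^ (b + 1)) J := by
    intro J hJ hJk Q
    obtain ⟨⟨hfin, hcard⟩, hrank⟩ := hℱ (p '' Q) (Q.finite_toSet.image p)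
    obtain ⟨j, rfl⟩ := Nat.exists_eq_add_of_le' hJ
    rcases j with - | j
    · obtain ⟨κ, hκ⟩ := exists_filling_of_card_le hcard
      exact ⟨κ, fun z hz z' hz' _ _ => hκ z hz z' hz'⟩
    · exact exists_filling_of_rank_le (hrank (j + 1) (by omega) (by omega))
  obtain ⟨γ, Φ, h⟩ := hN (fun i Q => singIn i (K Q)) (fun i _ _ hQ => singIn_mono i (hKmono hQ))
    hfill _ _ (isChainSystem_one p (K := K)
      (fun v => subset_convFam ℱ (p '' ({v} : Finset ℕ)) ⟨v, by simp⟩) N)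
  refine false_of_disjoint_singChains (k := k) (by omega) γ (fun A => K (Φ A)) h.map_empty h.mem
    h.bd_eq fun A hA hAc B hB hBc hAB => ?_
  have hsub : ∀ Q ⊆ Finset.range N, (Q : Set ℕ) ⊆ Set.Iio N := fun Q hQ x hx =>
    Finset.mem_range.1 (hQ hx)
  have hΦA := hsub _ (h.subset A hA hAc)
  have hΦB := hsub _ (h.subset B hB hBc)
  rw [Set.disjoint_iff_inter_eq_empty]
  refine hdis _ _ ?_ ?_ ?_
  · rintro _ ⟨x, hx, rfl⟩
    exact hpP x (hΦA hx)
  · rintro _ ⟨x, hx, rfl⟩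
    exact hpP x (hΦB hx)
  · exact (Finset.disjoint_coe.2 (h.disjoint A hA hAc B hB hBc hAB)).image hpinj hΦA hΦB
end

section
/- Let X be a set, let ℱ be a family of subsets of X, and let k ≥ 1 be an integer. Suppose that every subset P ⊆ X with exactly k+1 elements contains two disjoint subsets P₁, P₂ ⊆ P such that conv_ℱ(P₁) ∩ conv_ℱ(P₂) ≠ ∅. Then for every finite subfamily 𝒢 ⊆ ℱ with ⋂𝒢 = ∅ there exists a subfamily 𝒢' ⊆ 𝒢 with at most k elements and ⋂𝒢' = ∅. -/
/-- **Levi's theorem**: a family with Radon number at most `k + 1` has Helly number at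
most `k`. If every `(k+1)`-point subset `P ⊆ X` contains two disjoint subsets `P₁, P₂`
with `conv_ℱ(P₁) ∩ conv_ℱ(P₂) ≠ ∅`, then every finite subfamily `𝒢 ⊆ ℱ` with empty
intersection contains a subfamily `𝒢'` with at most `k` members and empty intersection. -/
theorem levi_radon_implies_helly
    {X : Type} (ℱ : Set (Set X)) (k : ℕ) (hk : 1 ≤ k)
    (hradon : ∀ P : Set X, P.Finite → P.ncard = k + 1 →
      ∃ P₁ P₂ : Set X, P₁ ⊆ P ∧ P₂ ⊆ P ∧ Disjoint P₁ P₂ ∧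
        (convFam ℱ P₁ ∩ convFam ℱ P₂).Nonempty)
    (𝒢 : Finset (Set X)) (h𝒢 : ↑𝒢 ⊆ ℱ) (hempty : ⋂₀ (𝒢 : Set (Set X)) = ∅) :
    ∃ 𝒢' ⊆ 𝒢, 𝒢'.card ≤ k ∧ ⋂₀ (𝒢' : Set (Set X)) = ∅ := by
  classical
  induction 𝒢 using Finset.strongInduction with
  | H 𝒢 ih =>
    by_cases hcard : 𝒢.card ≤ k
    · exact ⟨𝒢, Finset.Subset.refl _, hcard, hempty⟩
    by_cases hmin : ∃ G ∈ 𝒢, ⋂₀ ((𝒢.erase G : Finset (Set X)) : Set (Set X)) = ∅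
    · obtain ⟨G, hG, hGe⟩ := hmin
      obtain ⟨𝒢', hsub, hc, he⟩ := ih (𝒢.erase G) (Finset.erase_ssubset hG)
        (fun F hF => h𝒢 (Finset.mem_of_mem_erase hF)) hGe
      exact ⟨𝒢', hsub.trans (Finset.erase_subset _ _), hc, he⟩
    exfalso
    push Not at hmin
    have hex : ∀ G ∈ 𝒢, ∃ x, ∀ H ∈ 𝒢, x ∈ H ↔ H ≠ G := by
      intro G hG
      obtain ⟨x, hx⟩ := hmin G hG
      have hmem : ∀ H ∈ 𝒢, H ≠ G → x ∈ H := fun H hH hne =>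
        hx H (Finset.mem_coe.2 (Finset.mem_erase.2 ⟨hne, hH⟩))
      refine ⟨x, fun H hH => ⟨?_, hmem H hH⟩⟩
      rintro hxH rfl
      have hxI : x ∈ ⋂₀ (𝒢 : Set (Set X)) := by
        intro K hK
        by_cases hKH : K = H
        · exact hKH ▸ hxH
        · exact hmem K hK hKH
      simp [hempty] at hxI
    have : Nonempty X := by
      obtain ⟨G, hG⟩ := Finset.card_pos.1 (show 0 < 𝒢.card by omega)
      exact ⟨(hex G hG).choose⟩
    choose! p hp using hex
    obtain ⟨𝒮, h𝒮, h𝒮c⟩ := Finset.exists_subset_card_eq (show k + 1 ≤ 𝒢.card by omega)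
    have hinj : Set.InjOn p (𝒮 : Set (Set X)) := by
      intro G hG H hH hGH
      by_contra hne
      have hmem := (hp H (h𝒮 hH) G (h𝒮 hG)).2 hne
      rw [← hGH] at hmem
      exact (hp G (h𝒮 hG) G (h𝒮 hG)).1 hmem rfl
    obtain ⟨P₁, P₂, h₁, h₂, hdisj, x, hx₁, hx₂⟩ := hradon (p '' (𝒮 : Set (Set X)))
      (𝒮.finite_toSet.image p)
      (by rw [hinj.ncard_image, Set.ncard_coe_finset, h𝒮c])
    have hsub : ∀ P ⊆ p '' (𝒮 : Set (Set X)), ∀ G ∈ 𝒢, p G ∉ P → P ⊆ G := by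
      intro P hP G hG hpG y hy
      obtain ⟨H, hH, rfl⟩ := hP hy
      refine (hp H (h𝒮 hH) G hG).2 ?_
      rintro rfl
      exact hpG hy
    have hxI : x ∈ ⋂₀ (𝒢 : Set (Set X)) := by
      intro G hG
      by_cases hpG : p G ∈ P₁
      · exact hx₂ G ⟨h𝒢 hG, hsub P₂ h₂ G hG (Set.disjoint_left.1 hdisj hpG)⟩
      · exact hx₁ G ⟨h𝒢 hG, hsub P₁ h₁ G hG hpG⟩
    simp [hempty] at hxI
end

section
/- For any positive integers k, m, n, c there exists a natural number N = N_k(n;m;c) with the following property. Let X be a finite set with |X| ≥ N, and suppose that for every subset V ⊆ X a coloring ρ_V from the k-element subsets of V to {1,…,c} is given (the empty map when |V| < k). Then there exists an n-element subset Y ⊆ X and a map M assigning to every m-element subset Z ⊆ Y a set M(Z) ⊆ X∖Y such that: (i) M is strongly injective, i.e., Z ≠ Z' implies M(Z) ∩ M(Z') = ∅; and (ii) M is k-monochromatic, i.e., for every m-element subset Z ⊆ Y, all k-element subsets of Z receive the same color under the coloring ρ_{Z ∪ M(Z)}. -/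
universe u v w

/-- **Off-diagonal finite Ramsey theorem** for colorings of `r`-element sets by a finite type. -/
theorem exists_ramsey_offDiag {κ : Type v} [Fintype κ] (r : ℕ) (g : κ → ℕ) :
    ∃ N : ℕ, ∀ (X : Type u) (S : Finset X), N ≤ S.card → ∀ f : Finset X → κ,
      ∃ i, ∃ T ⊆ S, T.card = g i ∧ ∀ A ⊆ T, A.card = r → f A = i := by
  classical
  induction r generalizing g with
  | zero =>
    refine ⟨Finset.univ.sup g, fun X S hS f => ?_⟩
    obtain ⟨T, hTS, hT⟩ := Finset.exists_subset_card_eq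
      ((Finset.le_sup (f := g) (Finset.mem_univ (f ∅))).trans hS)
    exact ⟨f ∅, T, hTS, hT, fun A _ hA => by rw [Finset.card_eq_zero.1 hA]⟩
  | succ r ihr =>
    induction hs : ∑ i, g i using Nat.strong_induction_on generalizing g with
    | _ s ihs =>
    by_cases h0 : ∃ i, g i = 0
    · obtain ⟨i, hi⟩ := h0
      refine ⟨0, fun X S _ f => ⟨i, ∅, by simp, by simp [hi], fun A hA hc => ?_⟩⟩
      simp [Finset.subset_empty.1 hA] at hc
    push Not at h0
    have step (i : κ) := ihs (∑ j, Function.update g i (g i - 1) j) (by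
      rw [← hs]
      refine Finset.sum_lt_sum (fun j _ => ?_) ⟨i, Finset.mem_univ i, ?_⟩
      · rcases eq_or_ne j i with rfl | hj <;> simp [*]
      · have := h0 i
        simp only [Function.update_self]
        omega) _ rfl
    choose N hN using step
    obtain ⟨N', hN'⟩ := ihr (g := fun _ : κ => Finset.univ.sup N)
    refine ⟨N' + 1, fun X S hS f => ?_⟩
    obtain ⟨v, hv⟩ : S.Nonempty := Finset.card_pos.1 (by omega)
    obtain ⟨i, T, hTS, hT, hfT⟩ := hN' X (S.erase v)
      (by rw [Finset.card_erase_of_mem hv]; omega) (fun A => f (insert v A))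
    obtain ⟨j, U, hUT, hU, hfU⟩ := hN i X T
      (by rw [hT]; exact Finset.le_sup (f := N) (Finset.mem_univ i)) f
    have hUS : U ⊆ S.erase v := hUT.trans hTS
    rcases eq_or_ne j i with rfl | hj
    · have hvU : v ∉ U := fun h => by simpa using hUS h
      refine ⟨j, insert v U, Finset.insert_subset hv (hUS.trans (Finset.erase_subset _ _)), ?_,
        fun A hA hAc => ?_⟩
      · have := h0 j
        rw [Finset.card_insert_of_notMem hvU, hU, Function.update_self]
        omega
      · by_cases hvA : v ∈ A
        · rw [← Finset.insert_erase hvA]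
          refine hfT _ ((Finset.subset_insert_iff.1 hA).trans hUT) ?_
          rw [Finset.card_erase_of_mem hvA, hAc, Nat.add_sub_cancel]
        · exact hfU A ((Finset.subset_insert_iff_of_notMem hvA).1 hA) hAc
    · exact ⟨j, U, hUS.trans (Finset.erase_subset _ _), by simpa [hj] using hU, hfU⟩

/-- **Finite Ramsey theorem** for colorings of `r`-element sets by a finite type. -/
theorem exists_ramsey (κ : Type v) [Fintype κ] (r s : ℕ) :
    ∃ N : ℕ, ∀ (X : Type u) (S : Finset X), N ≤ S.card → ∀ f : Finset X → κ,
      ∃ i, ∃ T ⊆ S, T.card = s ∧ ∀ A ⊆ T, A.card = r → f A = i :=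
  exists_ramsey_offDiag r fun _ => s

/-- **Ramsey dichotomy**: a predicate on `r`-element sets holds everywhere on a large set, or fails
everywhere on a large set. -/
theorem exists_ramsey_prop (r s : ℕ) :
    ∃ N : ℕ, ∀ (X : Type u) (S : Finset X), N ≤ S.card → ∀ p : Finset X → Prop,
      ∃ T ⊆ S, T.card = s ∧
        ((∀ A ⊆ T, A.card = r → p A) ∨ ∀ A ⊆ T, A.card = r → ¬ p A) := by
  obtain ⟨N, hN⟩ := exists_ramsey.{u} Prop r s
  refine ⟨N, fun X S hS p => ?_⟩
  obtain ⟨i, T, hTS, hT, h⟩ := hN X S hS p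
  refine ⟨T, hTS, hT, ?_⟩
  by_cases hi : i
  · exact .inl fun A hA hc => (h A hA hc).symm ▸ hi
  · exact .inr fun A hA hc => (h A hA hc).symm ▸ hi

/-- Among more than `m + (m + 1) * b` points, some `m + 1` points are free for a set mapping of
order `m` with values of size at most `b`. -/
theorem exists_free_of_card_lt {X : Type u} [DecidableEq X] {m b : ℕ} {S : Finset X}
    (hS : m + (m + 1) * b < S.card) (F : Finset X → Finset X)
    (hF : ∀ Z ⊆ S, Z.card = m → (F Z).card ≤ b) :
    ∃ A ⊆ S, A.card = m + 1 ∧ ∀ x ∈ A, x ∉ F (A.erase x) := by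
  by_contra! h
  have hsub : S.powersetCard (m + 1) ⊆
      (S.powersetCard m).biUnion fun Z => (F Z).image (insert · Z) := by
    intro A hA
    obtain ⟨hAS, hAc⟩ := Finset.mem_powersetCard.1 hA
    obtain ⟨x, hx, hxF⟩ := h A hAS hAc
    refine Finset.mem_biUnion.2 ⟨A.erase x, Finset.mem_powersetCard.2
      ⟨(Finset.erase_subset _ _).trans hAS, ?_⟩, Finset.mem_image.2 ⟨x, hxF, ?_⟩⟩
    · rw [Finset.card_erase_of_mem hx, hAc, Nat.add_sub_cancel]
    · exact Finset.insert_erase hx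
  have hle : S.card.choose (m + 1) ≤ S.card.choose m * b := by
    have := (Finset.card_le_card hsub).trans (Finset.card_biUnion_le_card_mul _ _ b fun Z hZ =>
      Finset.card_image_le.trans
        (hF Z (Finset.mem_powersetCard.1 hZ).1 (Finset.mem_powersetCard.1 hZ).2))
    simpa only [Finset.card_powersetCard] using this
  have hpos : 0 < S.card.choose m := Nat.choose_pos (by omega)
  have heq := Nat.choose_succ_right_eq S.card m
  have hlt : (m + 1) * b < S.card - m := by omega
  nlinarith

/-- **Finite free set theorem** for set mappings of order `m` with values of size at most `b`. -/
theorem exists_free_set (m b s : ℕ) :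
    ∃ N : ℕ, ∀ (X : Type u) (S : Finset X), N ≤ S.card → ∀ F : Finset X → Finset X,
      (∀ Z ⊆ S, Z.card = m → (F Z).card ≤ b) →
      ∃ V ⊆ S, V.card = s ∧ ∀ Z ⊆ V, Z.card = m → ∀ x ∈ V, x ∉ Z → x ∉ F Z := by
  classical
  obtain ⟨N, hN⟩ := exists_ramsey_prop.{u} (m + 1) (max s (m + (m + 1) * b + 1))
  refine ⟨N, fun X S hS F hF => ?_⟩
  obtain ⟨T, hTS, hT, h | h⟩ := hN X S hS fun A => ∀ x ∈ A, x ∉ F (A.erase x)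
  · obtain ⟨V, hVT, hV⟩ := Finset.exists_subset_card_eq ((le_max_left _ _).trans hT.ge)
    refine ⟨V, hVT.trans hTS, hV, fun Z hZ hZc x hx hxZ => ?_⟩
    have := h (insert x Z) ((Finset.insert_subset hx hZ).trans hVT)
      (by rw [Finset.card_insert_of_notMem hxZ, hZc]) x (Finset.mem_insert_self _ _)
    rwa [Finset.erase_insert hxZ] at this
  · obtain ⟨A, hA, hAc, hfree⟩ := exists_free_of_card_lt (b := b)
      ((le_max_right _ _).trans hT.ge) F fun Z hZ => hF Z (hZ.trans hTS)
    exact absurd hfree (h A hA hAc)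

/-- Greedy selection of pairwise disjoint sets: if each requirement `good i` can be met by a set of
size at most `r` avoiding any prescribed small set, then all requirements can be met disjointly. -/
theorem exists_pairwiseDisjoint_of_avoid {X : Type u} {ι : Type w} [DecidableEq X]
    (I : Finset ι) (good : ι → Finset X → Prop) (Y : Finset X) (r : ℕ)
    (h : ∀ i ∈ I, ∀ T : Finset X, T.card ≤ Y.card + I.card * r →
      ∃ M, good i M ∧ M.card ≤ r ∧ Disjoint M T) :
    ∃ M : ι → Finset X, (∀ i ∈ I, good i (M i) ∧ (M i).card ≤ r ∧ Disjoint (M i) Y) ∧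
      (I : Set ι).PairwiseDisjoint M := by
  classical
  induction I using Finset.induction_on with
  | empty => exact ⟨fun _ => ∅, by simp, by simp⟩
  | insert a I ha ih =>
    rw [Finset.card_insert_of_notMem ha] at h
    obtain ⟨M, hM, hdisj⟩ := ih fun i hi T hT => h i (Finset.mem_insert_of_mem hi) T
      (hT.trans (by gcongr; omega))
    obtain ⟨Ma, hgood, hcard, hMa⟩ := h a (Finset.mem_insert_self a I) (Y ∪ I.biUnion M) (by
      have := Finset.card_union_le Y (I.biUnion M)
      have := Finset.card_biUnion_le_card_mul I M r fun i hi => (hM i hi).2.1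
      nlinarith)
    rw [Finset.disjoint_union_right, Finset.disjoint_biUnion_right] at hMa
    have hne : ∀ i ∈ I, i ≠ a := fun i hi hia => ha (hia ▸ hi)
    refine ⟨Function.update M a Ma, fun i hi => ?_, ?_⟩
    · rcases Finset.mem_insert.1 hi with rfl | hi
      · simpa using ⟨hgood, hcard, hMa.1⟩
      · simpa [hne i hi] using hM i hi
    · rw [Finset.coe_insert, Set.pairwiseDisjoint_insert]
      refine ⟨fun i hi j hj hij => ?_, fun j hj _ => ?_⟩
      · simpa [Function.onFun, hne i hi, hne j hj] using hdisj hi hj hij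
      · simpa [hne j hj] using hMa.2 j hj

/-- **Ramsey-type selection proposition** (used in the proof of the bounded Radon number
theorem). For all positive `k, m, n, c` there is `N = N_k(n;m;c)` such that: for every
finite set `X` with `|X| ≥ N` and every system of colorings `ρ V e` (assigning to each
`V ⊆ X` a coloring of the `k`-element subsets `e ⊆ V` by `c` colors), there are an
`n`-element subset `Y ⊆ X` and a map `M` assigning to every `m`-element subset `Z ⊆ Y`
a subset `M Z ⊆ X ∖ Y` such that `M` is strongly injective (distinct `m`-subsets get
disjoint sets) and `k`-monochromatic (for each `m`-subset `Z ⊆ Y`, all `k`-element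
subsets of `Z` receive the same color in the coloring `ρ (Z ∪ M Z)`). -/
theorem ramsey_selection
    (k m n c : ℕ) (hk : 1 ≤ k) (hm : 1 ≤ m) (hn : 1 ≤ n) (hc : 1 ≤ c) :
    ∃ N : ℕ, ∀ (X : Type) [DecidableEq X] [Fintype X], N ≤ Fintype.card X →
      ∀ ρ : Finset X → Finset X → Fin c,
      ∃ Y : Finset X, Y.card = n ∧
        ∃ M : Finset X → Finset X,
          (∀ Z ⊆ Y, Z.card = m → Disjoint (M Z) Y) ∧
          (∀ Z ⊆ Y, ∀ Z' ⊆ Y, Z.card = m → Z'.card = m → Z ≠ Z' →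
            Disjoint (M Z) (M Z')) ∧
          (∀ Z ⊆ Y, Z.card = m → ∀ e ⊆ Z, e.card = k → ∀ e' ⊆ Z, e'.card = k →
            ρ (Z ∪ M Z) e = ρ (Z ∪ M Z) e') := by
  obtain ⟨R, hR⟩ := exists_ramsey.{0} (Fin c) k m
  obtain ⟨S₀, hS₀⟩ := exists_free_set.{0} m (n + n.choose m * R) R
  obtain ⟨N, hN⟩ := exists_ramsey_prop.{0} m (max n S₀)
  refine ⟨N, fun X _ _ hX ρ => ?_⟩
  let good (Z M : Finset X) : Prop := ∀ e ⊆ Z, e.card = k → ∀ e' ⊆ Z, e'.card = k →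
    ρ (Z ∪ M) e = ρ (Z ∪ M) e'
  obtain ⟨S, -, hS, h | h⟩ := hN X Finset.univ hX fun Z => ∀ T : Finset X,
    T.card ≤ n + n.choose m * R → ∃ M, good Z M ∧ M.card ≤ R ∧ Disjoint M T
  · obtain ⟨Y, hYS, hY⟩ := Finset.exists_subset_card_eq ((le_max_left _ _).trans hS.ge)
    have mem_iff (Z : Finset X) : Z ∈ Y.powersetCard m ↔ Z ⊆ Y ∧ Z.card = m :=
      Finset.mem_powersetCard
    obtain ⟨M, hM, hdisj⟩ := exists_pairwiseDisjoint_of_avoid (Y.powersetCard m) good Y R (by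
      intro Z hZ T hT
      rw [mem_iff] at hZ
      rw [Finset.card_powersetCard, hY] at hT
      exact h Z (hZ.1.trans hYS) hZ.2 T hT)
    exact ⟨Y, hY, M, fun Z hZ hZm => (hM Z ((mem_iff Z).2 ⟨hZ, hZm⟩)).2.2,
      fun Z hZ Z' hZ' hZm hZm' hne =>
        hdisj ((mem_iff Z).2 ⟨hZ, hZm⟩) ((mem_iff Z').2 ⟨hZ', hZm'⟩) hne,
      fun Z hZ hZm => (hM Z ((mem_iff Z).2 ⟨hZ, hZm⟩)).1⟩
  · push Not at h
    choose! F hFcard hF using h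
    obtain ⟨V, hVS, hV, hfree⟩ := hS₀ X S ((le_max_right _ _).trans hS.ge) F hFcard
    obtain ⟨i, Z, hZV, hZ, hmono⟩ := hR X V hV.ge (ρ V)
    refine absurd ?_ (hF Z (hZV.trans hVS) hZ (V \ Z) ?_ ?_)
    · refine Finset.disjoint_left.2 fun x hx => ?_
      rw [Finset.mem_sdiff] at hx
      exact hfree Z hZV hZ x hx.1 hx.2
    · intro e he hek e' he' hek'
      rw [Finset.union_sdiff_of_subset hZV, hmono e he hek, hmono e' he' hek']
    · exact (Finset.card_le_card Finset.sdiff_subset).trans hV.le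
end
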